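/- For every ε > 0 there is a constant c = c_ε > 0 such that every string graph on n > 2 vertices contains a clique with at least n^{c/log₂ log₂ n} vertices or an independent set of size at least n^{1−ε}. -/

import Mathlib

/-- A curve in the plane: the image of a continuous map from `[0,1]` to `ℝ²`. -/
def IsCurve (c : Set (ℝ × ℝ)) : Prop :=
  ∃ f : ℝ → ℝ × ℝ, ContinuousOn f (Set.Icc 0 1) ∧ c = f '' Set.Icc 0 1

/-- A string graph: an intersection graph of curves in the plane. -/
def IsStringGraph {V : Type*} (G : SimpleGraph V) : Prop :=
  ∃ γ : V → Set (ℝ × ℝ), (∀ v, IsCurve (γ v)) ∧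
    ∀ u v : V, u ≠ v → (G.Adj u v ↔ (γ u ∩ γ v).Nonempty)


namespace SG

abbrev Pt := ℤ × ℤ

def BW : SimpleGraph Pt where
  Adj p q := (p.2 = q.2 ∧ (p.1 + 1 = q.1 ∨ q.1 + 1 = p.1)) ∨
    (p.1 = q.1 ∧ ((p.2 + 1 = q.2 ∧ (p.1 + p.2) % 2 = 0) ∨ (q.2 + 1 = p.2 ∧ (q.1 + q.2) % 2 = 0)))
  symm := ⟨by
    intro p q h
    rcases h with ⟨h1, h2⟩ | ⟨h1, h2⟩
    · left; exact ⟨h1.symm, h2.symm⟩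
    · right; exact ⟨h1.symm, h2.symm⟩⟩
  loopless := ⟨by
    intro p h
    rcases h with ⟨h1, h2⟩ | ⟨h1, h2⟩ <;> omega⟩

def stepv (p q u : Pt) : ZMod 2 :=
  if p.1 = q.1 ∧ u.1 < p.1 ∧ ((p.2 = u.2 ∧ q.2 = u.2 + 1) ∨ (q.2 = u.2 ∧ p.2 = u.2 + 1)) then 1 else 0

def hv (p q u : Pt) : ZMod 2 :=
  if p.1 = q.1 ∧ p.1 < u.1 ∧ ((p.2 + 1 = q.2 ∧ u.2 = q.2) ∨ (q.2 + 1 = p.2 ∧ u.2 = p.2)) then 1 else 0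

def fpre (i u : Pt) : ZMod 2 :=
  if i.2 < u.2 ∨ (i.2 = u.2 ∧ u.1 < i.1) then 1 else 0

theorem bw_cases {p q : Pt} (h : BW.Adj p q) :
    (p.2 = q.2 ∧ (p.1 + 1 = q.1 ∨ q.1 + 1 = p.1)) ∨
    (p.1 = q.1 ∧ (p.2 + 1 = q.2  ∨ q.2 + 1 = p.2)) := by
  rcases h with ⟨h1, h2⟩ | ⟨h1, h2⟩
  · left; exact ⟨h1, h2⟩
  · right; exact ⟨h1, by omega⟩

theorem zmod2_self (x : ZMod 2) : x + x = 0 := CharTwo.add_self_eq_zero x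

theorem single_step {a b p q : Pt} (hab : BW.Adj a b) (hpq : BW.Adj p q)
    (h1 : p ≠ a) (h2 : p ≠ b) (h3 : q ≠ a) (h4 : q ≠ b) :
    stepv a b p + stepv a b q = hv p q a + hv p q b := by
  obtain ⟨a1, a2⟩ := a
  obtain ⟨b1, b2⟩ := b
  obtain ⟨p1, p2⟩ := p
  obtain ⟨q1, q2⟩ := q
  have hab := bw_cases hab
  have hpq := bw_cases hpq
  simp only [ne_eq, Prod.mk.injEq] at *
  unfold stepv hv
  simp only
  rcases hab with ⟨e1, e2 | e2⟩ | ⟨e1, e2⟩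
  · rw [if_neg (by omega), if_neg (by omega)]
    by_cases c : (p1 = q1 ∧ p1 < a1 ∧ (p2 + 1 = q2 ∧ a2 = q2 ∨ q2 + 1 = p2 ∧ a2 = p2))
    · rw [if_pos c, if_pos (by omega)]; rfl
    · rw [if_neg c, if_neg (by omega)]
  · rw [if_neg (by omega), if_neg (by omega)]
    by_cases c : (p1 = q1 ∧ p1 < a1 ∧ (p2 + 1 = q2 ∧ a2 = q2 ∨ q2 + 1 = p2 ∧ a2 = p2))
    · rw [if_pos c, if_pos (by omega)]; rfl
    · rw [if_neg c, if_neg (by omega)]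
  · rcases hpq with ⟨f1, f2⟩ | ⟨f1, f2⟩
    · rw [if_neg (c := p1 = q1 ∧ _) (by omega), if_neg (c := p1 = q1 ∧ _) (by omega)]
      by_cases c : a1 = b1 ∧ p1 < a1 ∧ (a2 = p2 ∧ b2 = p2 + 1 ∨ b2 = p2 ∧ a2 = p2 + 1)
      · rw [if_pos c, if_pos (by omega)]; rfl
      · rw [if_neg c, if_neg (by omega)]
    · subst e1 f1
      by_cases d : p1 < a1
      · simp only [d, true_and]
        clear d h1 h2 h3 h4
        rcases e2 with rfl | rfl <;> rcases f2 with rfl | rfl <;>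
        · split_ifs <;> first | rfl | (exfalso; omega)
      · simp only [d, false_and, and_false, if_false]

theorem single_pre {p q u : Pt} (hpq : BW.Adj p q) (h1 : u ≠ p) (h2 : u ≠ q) :
    hv p q u + stepv p q u = fpre p u + fpre q u := by
  obtain ⟨u1, u2⟩ := u
  obtain ⟨p1, p2⟩ := p
  obtain ⟨q1, q2⟩ := q
  have hpq := bw_cases hpq
  simp only [ne_eq, Prod.mk.injEq] at *
  unfold stepv hv fpre
  simp only
  split_ifs <;> first | rfl | (exfalso; omega)

theorem fpre_flip {p u : Pt} (h : p ≠ u) : fpre p u + fpre u p = 1 := by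
  obtain ⟨u1, u2⟩ := u
  obtain ⟨p1, p2⟩ := p
  simp only [ne_eq, Prod.mk.injEq] at *
  unfold fpre
  simp only
  split_ifs <;> first | rfl | (exfalso; omega)

def ry : {a b : Pt} → BW.Walk a b → Pt → ZMod 2
  | _, _, .nil, _ => 0
  | a, _, .cons (v := v) _ w, p => stepv a v p + ry w p

def ly : {a b : Pt} → BW.Walk a b → Pt → ZMod 2
  | _, _, .nil, _ => 0
  | a, _, .cons (v := v) _ w, p => hv a v p + ly w p

theorem ry_append {a b c : Pt} (w : BW.Walk a b) (w' : BW.Walk b c) (p : Pt) :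
    ry (w.append w') p = ry w p + ry w' p := by
  induction w with
  | nil => simp [ry]
  | cons h w ih => simp [ry, ih, add_assoc]

theorem stepv_comm (p q u : Pt) : stepv p q u = stepv q p u := by
  unfold stepv
  congr 1
  apply propext
  constructor <;> rintro ⟨h1, h2, h3⟩ <;> refine ⟨h1.symm, by omega, h3.symm⟩

theorem ry_reverse {a b : Pt} (w : BW.Walk a b) (p : Pt) : ry w.reverse p = ry w p := by
  induction w with
  | nil => simp [ry]
  | cons h w ih =>
    rw [SimpleGraph.Walk.reverse_cons, ry_append, ih]
    simp only [ry, add_zero]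
    rw [stepv_comm, add_comm]

theorem ry_step {a b : Pt} (w : BW.Walk a b) {p q : Pt} (hpq : BW.Adj p q)
    (hp : p ∉ w.support) (hq : q ∉ w.support) : ry w p + ry w q = hv p q a + hv p q b := by
  induction w with
  | nil => simp [ry, zmod2_self]
  | @cons u v x h w ih =>
    simp only [SimpleGraph.Walk.support_cons, List.mem_cons, not_or] at hp hq
    have ih := ih hp.2 hq.2
    have hpv : p ≠ v := fun e => hp.2 (e ▸ w.start_mem_support)
    have hqv : q ≠ v := fun e => hq.2 (e ▸ w.start_mem_support)
    have := single_step h hpq hp.1 hpv hq.1 hqv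
    simp only [ry]
    have e : stepv u v p + ry w p + (stepv u v q + ry w q)
      = (stepv u v p + stepv u v q) + (ry w p + ry w q) := by ring
    rw [e, this, ih]
    have e2 : hv p q u + hv p q v + (hv p q v + hv p q x)
      = hv p q u + hv p q x + (hv p q v + hv p q v) := by ring
    rw [e2, zmod2_self, add_zero]

theorem ry_walk {a b p q : Pt} (w : BW.Walk a b) (v : BW.Walk p q)
    (h : ∀ x ∈ v.support, x ∉ w.support) : ry w p + ry w q = ly v a + ly v b := by
  induction v with
  | nil => simp [ly, zmod2_self]
  | @cons u v x hu t ih =>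
    simp only [SimpleGraph.Walk.support_cons, List.mem_cons, forall_eq_or_imp] at h
    have ih := ih h.2
    have := ry_step w hu h.1 (h.2 _ t.start_mem_support)
    simp only [ly]
    have e : ry w u + ry w x = (ry w u + ry w v) + (ry w v + ry w x) := by
      have := zmod2_self (ry w v)
      linear_combination -this
    rw [e, this, ih]; ring

theorem ly_ry {p q : Pt} (v : BW.Walk p q) (u : Pt) (h : u ∉ v.support) :
    ly v u + ry v u = fpre p u + fpre q u := by
  induction v with
  | nil => simp [ly, ry, zmod2_self]
  | @cons a b x hu t ih =>
    simp only [SimpleGraph.Walk.support_cons, List.mem_cons, not_or] at h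
    have ih := ih h.2
    have hb : u ≠ b := fun e => h.2 (e ▸ t.start_mem_support)
    have := single_pre hu h.1 hb
    simp only [ly, ry]
    have e := zmod2_self (fpre b u)
    linear_combination this + ih + e

/-- crossing parity of disjoint walks -/
theorem disj_walks {a b p q : Pt} (w : BW.Walk a b) (v : BW.Walk p q)
    (h : ∀ x ∈ v.support, x ∉ w.support) :
    ry w p + ry w q + ry v a + ry v b = fpre p a + fpre q a + fpre p b + fpre q b := by
  have h1 := ry_walk w v h
  have h2 := ly_ry v a (fun hx => h _ hx w.start_mem_support)
  have h3 := ly_ry v b (fun hx => h _ hx w.end_mem_support)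
  linear_combination h1 + h2 + h3

def Cn (S : Set Pt) : Prop := ∀ u ∈ S, ∀ v ∈ S, ∃ w : BW.Walk u v, ∀ x ∈ w.support, x ∈ S

theorem closed_const {a : Pt} (w : BW.Walk a a) {S : Set Pt} (hS : Cn S)
    (h : ∀ x ∈ w.support, x ∉ S) {u v : Pt} (hu : u ∈ S) (hv' : v ∈ S) : ry w u = ry w v := by
  obtain ⟨t, ht⟩ := hS u hu v hv'
  have := ry_walk w t (fun x hx hx' => h x hx' (ht x hx))
  have e := zmod2_self (ly t a)
  have e2 := zmod2_self (ry w v)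
  linear_combination this + e - e2

theorem Cn.union {S T : Set Pt} (hS : Cn S) (hT : Cn T) (h : (S ∩ T).Nonempty) : Cn (S ∪ T) := by
  obtain ⟨z, hzS, hzT⟩ := h
  have key : ∀ u ∈ S ∪ T, ∃ w : BW.Walk u z, ∀ x ∈ w.support, x ∈ S ∪ T := by
    rintro u (hu | hu)
    · obtain ⟨w, hw⟩ := hS u hu z hzS
      exact ⟨w, fun x hx => Or.inl (hw x hx)⟩
    · obtain ⟨w, hw⟩ := hT u hu z hzT
      exact ⟨w, fun x hx => Or.inr (hw x hx)⟩
  intro u hu v hv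
  obtain ⟨w1, h1⟩ := key u hu
  obtain ⟨w2, h2⟩ := key v hv
  refine ⟨w1.append w2.reverse, fun x hx => ?_⟩
  rw [SimpleGraph.Walk.mem_support_append_iff] at hx
  rcases hx with hx | hx
  · exact h1 x hx
  · rw [SimpleGraph.Walk.support_reverse, List.mem_reverse] at hx
    exact h2 x hx

theorem Cn.union_adj {S T : Set Pt} (hS : Cn S) (hT : Cn T) {a b : Pt} (ha : a ∈ S) (hb : b ∈ T)
    (h : BW.Adj a b) : Cn (S ∪ T) := by
  have h1 : Cn ({a, b} : Set Pt) := by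
    rintro u hu v hv
    rcases hu with rfl | rfl <;> rcases hv with rfl | rfl
    · exact ⟨.nil, by simp⟩
    · exact ⟨.cons h .nil, by simp⟩
    · exact ⟨.cons h.symm .nil, by simp⟩
    · exact ⟨.nil, by simp⟩
  have h2 := (hS.union h1 ⟨a, ha, by simp⟩).union hT ⟨b, by simp, hb⟩
  have : S ∪ {a, b} ∪ T = S ∪ T := by
    ext x; simp only [Set.mem_union, Set.mem_insert_iff, Set.mem_singleton_iff]
    constructor
    · rintro ((h | rfl | rfl) | h) <;> simp_all
    · rintro (h | h) <;> simp_all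
  rwa [this] at h2

theorem Cn.walk {a b : Pt} (w : BW.Walk a b) : Cn {x | x ∈ w.support} := by
  intro u hu v hv
  have hu' : u ∈ w.support := hu
  have hv' : v ∈ w.support := hv
  refine ⟨(w.takeUntil u hu').reverse.append (w.takeUntil v hv'), fun x hx => ?_⟩
  rw [SimpleGraph.Walk.mem_support_append_iff] at hx
  rcases hx with hx | hx
  · rw [SimpleGraph.Walk.support_reverse, List.mem_reverse] at hx
    exact w.support_takeUntil_subset_support hu' hx
  · exact w.support_takeUntil_subset_support hv' hx

end SG

namespace SG

theorem K5 (q : Fin 5 → Pt) (S : Fin 5 → Fin 5 → Set Pt) (hS : ∀ i j, i < j → Cn (S i j))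
    (hi : ∀ i j, i < j → q i ∈ S i j) (hj : ∀ i j, i < j → q j ∈ S i j) :
    ∃ i j k l, i < j ∧ k < l ∧ i ≠ k ∧ i ≠ l ∧ j ≠ k ∧ j ≠ l ∧ (S i j ∩ S k l).Nonempty := by
  by_contra hcon
  push Not at hcon
  have hdis : ∀ i j k l, i < j ∧ k < l ∧ i < k ∧ i ≠ l ∧ j ≠ k ∧ j ≠ l →
      ∀ x ∈ S k l, x ∉ S i j := by
    intro i j k l h x hx hx'
    have := hcon i j k l h.1 h.2.1 h.2.2.1.ne h.2.2.2.1 h.2.2.2.2.1 h.2.2.2.2.2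
    exact Set.notMem_empty x (this ▸ ⟨hx', hx⟩)
  have hdis2 : ∀ i j k l, i < j ∧ k < l ∧ i ≠ k ∧ i ≠ l ∧ j ≠ k ∧ j ≠ l →
      ∀ x ∈ S k l, x ∉ S i j := by
    intro i j k l h x hx hx'
    have := hcon i j k l h.1 h.2.1 h.2.2.1 h.2.2.2.1 h.2.2.2.2.1 h.2.2.2.2.2
    exact Set.notMem_empty x (this ▸ ⟨hx', hx⟩)
  choose w hw using fun (i j : Fin 5) (h : i < j) => hS i j h (q i) (hi i j h) (q j) (hj i j h)
  have hinj : ∀ i j : Fin 5, i ≠ j → q i ≠ q j := by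
    have aux : ∀ i j : Fin 5, i ≠ j → ∃ k l, k ≠ l ∧ k ≠ i ∧ k ≠ j ∧ l ≠ i ∧ l ≠ j := by decide
    intro i j hij e
    obtain ⟨k, l, h1, h2, h3, h4, h5⟩ := aux i j hij
    have mem : ∀ a b : Fin 5, a ≠ b → ∃ c d, c < d ∧ (c = a ∧ d = b ∨ c = b ∧ d = a) ∧ q a ∈ S c d := by
      intro a b hab
      rcases lt_or_gt_of_ne hab with h | h
      · exact ⟨a, b, h, Or.inl ⟨rfl, rfl⟩, hi _ _ h⟩
      · exact ⟨b, a, h, Or.inr ⟨rfl, rfl⟩, hj _ _ h⟩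
    obtain ⟨c, d, hcd, hc, hm⟩ := mem i k h2.symm
    obtain ⟨c', d', hcd', hc', hm'⟩ := mem j l h5.symm
    refine hdis2 c d c' d' ⟨hcd, hcd', ?_⟩ _ hm' (e ▸ hm)
    rcases hc with ⟨rfl, rfl⟩ | ⟨rfl, rfl⟩ <;> rcases hc' with ⟨rfl, rfl⟩ | ⟨rfl, rfl⟩ <;>
      simp_all [eq_comm]
  let R : Fin 5 → Fin 5 → Fin 5 → ZMod 2 := fun i j k => if h : i < j then ry (w i j h) (q k) else 0
  let F : Fin 5 → Fin 5 → ZMod 2 := fun i j => fpre (q i) (q j)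
  have E : ∀ i j k l, i < j ∧ k < l ∧ i < k ∧ i ≠ l ∧ j ≠ k ∧ j ≠ l →
      R i j k + R i j l + R k l i + R k l j = F k i + F l i + F k j + F l j := by
    intro i j k l h
    simp only [R, F, dif_pos h.1, dif_pos h.2.1]
    apply disj_walks
    intro x hx hx'
    exact hdis i j k l h x (hw _ _ _ _ hx) (hw _ _ _ _ hx')
  have D : ∀ i j, i ≠ j → F i j + F j i = 1 := fun i j h => fpre_flip (hinj i j h)
  clear_value R F
  have h2 : (2 : ZMod 2) = 0 := rfl
  have : (1 : ZMod 2) = 0 := by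
    linear_combination E 0 1 2 3 (by decide) + E 0 1 2 4 (by decide) + E 0 1 3 4 (by decide) + E 0 2 1 3 (by decide) + E 0 2 1 4 (by decide) + E 0 2 3 4 (by decide) + E 0 3 1 2 (by decide) + E 0 3 1 4 (by decide) + E 0 3 2 4 (by decide) + E 0 4 1 2 (by decide) + E 0 4 1 3 (by decide) + E 0 4 2 3 (by decide) + E 1 2 3 4 (by decide) + E 1 3 2 4 (by decide) + E 1 4 2 3 (by decide) + (6) * D 2 0 (by decide) + (6) * D 3 0 (by decide) + (4) * D 2 1 (by decide) + (4) * D 3 1 (by decide) + (6) * D 4 0 (by decide) + (4) * D 4 1 (by decide) + (6) * D 1 0 (by decide) + (3) * D 3 2 (by decide) + (3) * D 4 2 (by decide) + (3) * D 4 3 (by decide) - ((1) * R 0 1 2 + (1) * R 0 1 3 + (1) * R 2 3 0 + (1) * R 2 3 1 + (1) * R 0 1 4 + (1) * R 2 4 0 + (1) * R 2 4 1 + (1) * R 3 4 0 + (1) * R 3 4 1 + (1) * R 0 2 1 + (1) * R 0 2 3 + (1) * R 1 3 0 + (1) * R 1 3 2 + (1) * F 1 2 + (1) * R 0 2 4 +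 (1) * R 1 4 0 + (1) * R 1 4 2 + (1) * R 3 4 2 + (1) * R 0 3 1 + (1) * R 0 3 2 + (1) * R 1 2 0 + (1) * R 1 2 3 + (1) * F 1 3 + (1) * R 0 3 4 + (1) * R 1 4 3 + (1) * R 2 4 3 + (1) * R 0 4 1 + (1) * R 0 4 2 + (1) * R 1 2 4 + (1) * F 1 4 + (1) * R 0 4 3 + (1) * R 1 3 4 + (1) * R 2 3 4 + (3) * F 0 2 + (3) * F 0 3 + (3) * F 0 4 + (3) * F 0 1 + (-23)) * h2
  exact absurd this (by decide)

end SG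

namespace SG
open SimpleGraph

theorem Cn.mono_walk {X : Set Pt} (h : Cn X) {a b : Pt} (ha : a ∈ X) (hb : b ∈ X) :
    ∃ w : BW.Walk a b, w.IsPath ∧ ∀ x ∈ w.support, x ∈ X := by
  obtain ⟨w, hw⟩ := h a ha b hb
  exact ⟨w.bypass, w.bypass_isPath, fun x hx => hw x (w.support_bypass_subset_support hx)⟩

theorem path_mid {a b c : Pt} {w : BW.Walk a b} {w' : BW.Walk b c} (h : (w.append w').IsPath)
    {x : Pt} (h1 : x ∈ w.support) (h2 : x ∈ w'.support) : x = b := by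
  have := h.support_nodup
  rw [Walk.support_append] at this
  have hd := (List.nodup_append.1 this).2.2
  rw [Walk.mem_support_iff] at h2
  rcases h2 with h2 | h2
  · exact h2
  · exact absurd rfl (hd x h1 x h2)

theorem first_hit {a b : Pt} (w : BW.Walk a b) (T : Set Pt) (h : ∃ x ∈ w.support, x ∈ T) :
    ∃ (q : Pt) (w1 : BW.Walk a q) (w2 : BW.Walk q b), w = w1.append w2 ∧ q ∈ T ∧
      ∀ x ∈ w1.support, x ∈ T → x = q := by
  induction w with
  | @nil u =>
    obtain ⟨x, hx, hT⟩ := h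
    simp only [Walk.support_nil, List.mem_singleton] at hx
    subst hx
    exact ⟨x, .nil, .nil, rfl, hT, by simp⟩
  | @cons u v x hu t ih =>
    by_cases huT : u ∈ T
    · exact ⟨u, .nil, .cons hu t, rfl, huT, by simp⟩
    · have : ∃ x ∈ t.support, x ∈ T := by
        obtain ⟨y, hy, hT⟩ := h
        rw [Walk.support_cons, List.mem_cons] at hy
        rcases hy with rfl | hy
        · exact absurd hT huT
        · exact ⟨y, hy, hT⟩
      obtain ⟨q, w1, w2, e, hq, hx⟩ := ih this
      refine ⟨q, .cons hu w1, w2, by rw [e]; rfl, hq, ?_⟩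
      intro y hy hyT
      rw [Walk.support_cons, List.mem_cons] at hy
      rcases hy with rfl | hy
      · exact absurd hyT huT
      · exact hx y hy hyT

theorem deg3 {q n0 n1 n2 n3 : Pt} (h0 : BW.Adj n0 q) (h1 : BW.Adj n1 q) (h2 : BW.Adj n2 q)
    (h3 : BW.Adj n3 q) (h01 : n0 ≠ n1) (h02 : n0 ≠ n2) (h03 : n0 ≠ n3) (h12 : n1 ≠ n2)
    (h13 : n1 ≠ n3) (h23 : n2 ≠ n3) : False := by
  have key : ∀ n, BW.Adj n q → n ∈ ({(q.1 + 1, q.2), (q.1 - 1, q.2),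
      if (q.1 + q.2) % 2 = 0 then (q.1, q.2 + 1) else (q.1, q.2 - 1)} : Finset Pt) := by
    intro n hn
    obtain ⟨a, b⟩ := n
    obtain ⟨c, d⟩ := q
    simp only [Finset.mem_insert, Finset.mem_singleton]
    rcases hn with ⟨e, e2⟩ | ⟨e, e2⟩ <;> simp only at e e2 ⊢
    · simp only [Prod.mk.injEq]; omega
    · right; right
      split_ifs <;> simp only [Prod.mk.injEq] <;> omega
  have hsub : ({n0, n1, n2, n3} : Finset Pt) ⊆ ({(q.1 + 1, q.2), (q.1 - 1, q.2),
      if (q.1 + q.2) % 2 = 0 then (q.1, q.2 + 1) else (q.1, q.2 - 1)} : Finset Pt) := by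
    intro x hx
    simp only [Finset.mem_insert, Finset.mem_singleton] at hx
    rcases hx with rfl | rfl | rfl | rfl <;> apply key <;> assumption
  have h4 : ({n0, n1, n2, n3} : Finset Pt).card = 4 := by
    rw [Finset.card_insert_of_notMem, Finset.card_insert_of_notMem, Finset.card_insert_of_notMem,
      Finset.card_singleton] <;> simp_all
  have := Finset.card_le_card hsub
  have := Finset.card_le_three (a := (q.1 + 1, q.2)) (b := (q.1 - 1, q.2))
    (c := if (q.1 + q.2) % 2 = 0 then (q.1, q.2 + 1) else (q.1, q.2 - 1))
  omega

theorem pred_ex {u v q : Pt} (w : BW.Walk v q) (h : BW.Adj u v) :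
    ∃ n, BW.Adj n q ∧ (n = u ∨ (n ∈ w.support ∧ n ≠ q)) := by
  by_cases hn : w.Nil
  · have := hn.eq
    subst this
    exact ⟨u, h, Or.inl rfl⟩
  · have := w.adj_penultimate hn
    exact ⟨_, this, Or.inr ⟨w.getVert_mem_support _, this.ne⟩⟩

/-- two vertex-disjoint walks inside `X` -/
def Lk (X : Set Pt) (a b c d : Pt) : Prop :=
  ∃ (P : BW.Walk a b) (Q : BW.Walk c d), (∀ x ∈ P.support, x ∈ X) ∧ (∀ x ∈ Q.support, x ∈ X) ∧
    ∀ x ∈ P.support, x ∉ Q.support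

theorem Lk.flip {X : Set Pt} {a b c d : Pt} (h : Lk X a b c d) : Lk X a b d c := by
  obtain ⟨P, Q, h1, h2, h3⟩ := h
  exact ⟨P, Q.reverse, h1, by simpa using h2, by simpa using h3⟩

theorem Lk_aux {X : Set Pt} {v0 v1 v2 v3 q2 q3 : Pt} (P1 : BW.Walk v0 q2) (P2 : BW.Walk q2 q3)
    (P3 : BW.Walk q3 v1) (Q2 : BW.Walk v2 q2) (Q3 : BW.Walk v3 q3)
    (hP : (P1.append (P2.append P3)).IsPath) (hne : q2 ≠ q3)
    (h2 : ∀ x ∈ Q2.support, x ∈ (P1.append (P2.append P3)).support → x = q2)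
    (h3 : ∀ x ∈ Q3.support, x ∈ (P1.append (P2.append P3)).support → x = q3)
    (h23 : ∀ x ∈ Q2.support, x ∉ Q3.support)
    (hX : ∀ x ∈ (P1.append (P2.append P3)).support, x ∈ X)
    (hX2 : ∀ x ∈ Q2.support, x ∈ X) (hX3 : ∀ x ∈ Q3.support, x ∈ X) :
    Lk X v0 v2 v1 v3 := by
  have m1 : ∀ x ∈ P1.support, x ∈ (P1.append (P2.append P3)).support := by
    intro x hx; rw [Walk.mem_support_append_iff]; exact Or.inl hx
  have m3 : ∀ x ∈ P3.support, x ∈ (P2.append P3).support := by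
    intro x hx; rw [Walk.mem_support_append_iff]; exact Or.inr hx
  have m3' : ∀ x ∈ P3.support, x ∈ (P1.append (P2.append P3)).support := by
    intro x hx; rw [Walk.mem_support_append_iff]; exact Or.inr (m3 x hx)
  have hP2 := hP.of_append_right
  have n2 : q2 ∉ P3.support := fun h => hne (path_mid hP2 P2.start_mem_support h)
  have n3 : q3 ∉ P1.support := fun h => hne (path_mid hP h (m3 _ P3.start_mem_support)).symm
  refine ⟨P1.append Q2.reverse, P3.reverse.append Q3.reverse, ?_, ?_, ?_⟩
  · intro x hx
    rw [Walk.mem_support_append_iff, Walk.support_reverse, List.mem_reverse] at hx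
    rcases hx with hx | hx
    · exact hX x (m1 x hx)
    · exact hX2 x hx
  · intro x hx
    rw [Walk.mem_support_append_iff, Walk.support_reverse, Walk.support_reverse, List.mem_reverse,
      List.mem_reverse] at hx
    rcases hx with hx | hx
    · exact hX x (m3' x hx)
    · exact hX3 x hx
  · intro x hx hx'
    rw [Walk.mem_support_append_iff, Walk.support_reverse, List.mem_reverse] at hx
    rw [Walk.mem_support_append_iff, Walk.support_reverse, Walk.support_reverse, List.mem_reverse,
      List.mem_reverse] at hx'
    rcases hx with hx | hx <;> rcases hx' with hx' | hx'
    · exact n2 (path_mid hP hx (m3 x hx') ▸ hx')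
    · exact n3 (h3 x hx' (m1 x hx) ▸ hx)
    · exact n2 (h2 x hx (m3' x hx') ▸ hx')
    · exact h23 x hx hx'

theorem Hlemma {X : Set Pt} (hX : Cn X) {v0 v1 v2 v3 u0 u1 u2 u3 : Pt}
    (hv0 : v0 ∈ X) (hv1 : v1 ∈ X) (hv2 : v2 ∈ X) (hv3 : v3 ∈ X)
    (hu0 : u0 ∉ X) (hu1 : u1 ∉ X) (hu2 : u2 ∉ X) (hu3 : u3 ∉ X)
    (a0 : BW.Adj u0 v0) (a1 : BW.Adj u1 v1) (a2 : BW.Adj u2 v2) (a3 : BW.Adj u3 v3)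
    (h01 : u0 ≠ u1) (h02 : u0 ≠ u2) (h03 : u0 ≠ u3) (h12 : u1 ≠ u2)
    (h13 : u1 ≠ u3) (h23 : u2 ≠ u3) :
    Lk X v0 v1 v2 v3 ∨ Lk X v0 v2 v1 v3 ∨ Lk X v0 v3 v1 v2 := by
  obtain ⟨P, hP, hPX⟩ := hX.mono_walk hv0 hv1
  obtain ⟨Q, hQ, hQX⟩ := hX.mono_walk hv2 hv3
  by_cases hdis : ∀ x ∈ P.support, x ∉ Q.support
  · exact Or.inl ⟨P, Q, hPX, hQX, hdis⟩
  right
  push Not at hdis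
  obtain ⟨z, hz, hz'⟩ := hdis
  obtain ⟨q2, Q2, Q', rfl, hq2, hf2⟩ := first_hit Q {x | x ∈ P.support} ⟨z, hz', hz⟩
  obtain ⟨q3, Q3, Q'', e, hq3, hf3⟩ := first_hit Q'.reverse {x | x ∈ P.support}
    ⟨q2, by simp, hq2⟩
  have e' : Q' = Q''.reverse.append Q3.reverse := by
    rw [← Walk.reverse_append, ← e, Walk.reverse_reverse]
  clear e
  subst e'
  simp only [Set.mem_ofPred_eq] at hq2 hq3 hf2 hf3
  have hQ' := hQ.of_append_right
  have s2 : ∀ x ∈ Q2.support, x ∈ X := fun x hx => hQX x (by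
    rw [Walk.mem_support_append_iff]; exact Or.inl hx)
  have s3' : ∀ x ∈ Q3.support, x ∈ (Q''.reverse.append Q3.reverse).support := fun x hx => by
    rw [Walk.mem_support_append_iff]; right; simpa using hx
  have s3 : ∀ x ∈ Q3.support, x ∈ X := fun x hx => hQX x (by
    rw [Walk.mem_support_append_iff]; exact Or.inr (s3' x hx))
  have d23 : ∀ x ∈ Q2.support, x ∈ Q3.support → x = q2 ∧ x = q3 := by
    intro x hx hx'
    have := path_mid hQ hx (s3' x hx')
    exact ⟨this, hf3 x hx' (this ▸ hq2)⟩
  obtain ⟨P1, P2, rfl⟩ := Walk.mem_support_iff_exists_append.1 hq2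
  by_cases hne : q2 = q3
  · exfalso
    subst hne
    obtain ⟨n0, b0, c0⟩ := pred_ex P1 a0
    obtain ⟨n1, b1, c1⟩ := pred_ex P2.reverse a1
    obtain ⟨n2, b2, c2⟩ := pred_ex Q2 a2
    obtain ⟨n3, b3, c3⟩ := pred_ex Q3 a3
    simp only [Walk.support_reverse, List.mem_reverse] at c1
    have t0 : ∀ x ∈ P1.support, x ∈ (P1.append P2).support := fun x hx => by
      rw [Walk.mem_support_append_iff]; exact Or.inl hx
    have t1 : ∀ x ∈ P2.support, x ∈ (P1.append P2).support := fun x hx => by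
      rw [Walk.mem_support_append_iff]; exact Or.inr hx
    refine deg3 b0 b1 b2 b3 ?_ ?_ ?_ ?_ ?_ ?_ <;> rintro rfl
    · rcases c0 with rfl | ⟨c0, c⟩ <;> rcases c1 with rfl | ⟨c1, c'⟩
      · exact h01 rfl
      · exact hu0 (hPX _ (t1 _ c1))
      · exact hu1 (hPX _ (t0 _ c0))
      · exact c (path_mid hP c0 c1)
    · rcases c0 with rfl | ⟨c0, c⟩ <;> rcases c2 with rfl | ⟨c2, c'⟩
      · exact h02 rfl
      · exact hu0 (s2 _ c2)
      · exact hu2 (hPX _ (t0 _ c0))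
      · exact c (hf2 _ c2 (t0 _ c0))
    · rcases c0 with rfl | ⟨c0, c⟩ <;> rcases c3 with rfl | ⟨c3, c'⟩
      · exact h03 rfl
      · exact hu0 (s3 _ c3)
      · exact hu3 (hPX _ (t0 _ c0))
      · exact c (hf3 _ c3 (t0 _ c0))
    · rcases c1 with rfl | ⟨c1, c⟩ <;> rcases c2 with rfl | ⟨c2, c'⟩
      · exact h12 rfl
      · exact hu1 (s2 _ c2)
      · exact hu2 (hPX _ (t1 _ c1))
      · exact c (hf2 _ c2 (t1 _ c1))
    · rcases c1 with rfl | ⟨c1, c⟩ <;> rcases c3 with rfl | ⟨c3, c'⟩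
      · exact h13 rfl
      · exact hu1 (s3 _ c3)
      · exact hu3 (hPX _ (t1 _ c1))
      · exact c (hf3 _ c3 (t1 _ c1))
    · rcases c2 with rfl | ⟨c2, c⟩ <;> rcases c3 with rfl | ⟨c3, c'⟩
      · exact h23 rfl
      · exact hu2 (s3 _ c3)
      · exact hu3 (s2 _ c2)
      · exact c (d23 _ c2 c3).1
  · have d23' : ∀ x ∈ Q2.support, x ∉ Q3.support := fun x hx hx' =>
      hne ((d23 x hx hx').1.symm.trans (d23 x hx hx').2)
    rw [Walk.mem_support_append_iff] at hq3
    rcases hq3 with hq3 | hq3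
    · obtain ⟨P11, P12, rfl⟩ := Walk.mem_support_iff_exists_append.1 hq3
      right
      rw [← Walk.append_assoc] at *
      refine Lk_aux P11 P12 P2 Q3 Q2 hP (Ne.symm hne) hf3 hf2 ?_ hPX s3 s2
      intro x hx hx'
      exact d23' x hx' hx
    · obtain ⟨P21, P22, rfl⟩ := Walk.mem_support_iff_exists_append.1 hq3
      left
      exact Lk_aux P1 P21 P22 Q2 Q3 hP hne hf2 hf3 d23' hPX s2 s3

end SG

namespace SG
open SimpleGraph

/-- `c` is a chord between `X` and `Y`. -/
structure IsCh (X Y c : Set Pt) : Prop where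
  cn : Cn c
  dX : ∀ x ∈ c, x ∉ X
  dY : ∀ x ∈ c, x ∉ Y
  aX : ∃ v ∈ X, ∃ u ∈ c, BW.Adj u v
  aY : ∃ v ∈ Y, ∃ u ∈ c, BW.Adj u v

structure Chd (X Y : Set Pt) (x0 y0 : Pt) (c : Set Pt) where
  u : Pt
  hu : u ∈ c
  A : BW.Walk x0 u
  B : BW.Walk u y0
  hA : ∀ x ∈ A.support, x ∈ X ∨ x ∈ c
  hB : ∀ x ∈ B.support, x ∈ Y ∨ x ∈ c

variable {X Y : Set Pt} {x0 y0 : Pt} {c c' : Set Pt}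

theorem IsCh.cX (h : IsCh X Y c) (hX : Cn X) : Cn (X ∪ c) := by
  obtain ⟨v, hv, u, hu, a⟩ := h.aX
  exact hX.union_adj h.cn hv hu a.symm

theorem IsCh.cY (h : IsCh X Y c) (hY : Cn Y) : Cn (Y ∪ c) := by
  obtain ⟨v, hv, u, hu, a⟩ := h.aY
  exact hY.union_adj h.cn hv hu a.symm

theorem IsCh.chd (h : IsCh X Y c) (hX : Cn X) (hY : Cn Y) (hx : x0 ∈ X) (hy : y0 ∈ Y) :
    Nonempty (Chd X Y x0 y0 c) := by
  obtain ⟨v, hv, u, hu, a⟩ := h.aX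
  obtain ⟨A, hA⟩ := h.cX hX x0 (Or.inl hx) u (Or.inr hu)
  obtain ⟨B, hB⟩ := h.cY hY u (Or.inr hu) y0 (Or.inl hy)
  exact ⟨⟨u, hu, A, B, hA, hB⟩⟩

namespace Chd

def P (d : Chd X Y x0 y0 c) (p : Pt) : ZMod 2 := ry d.A p + ry d.B p

def tau (d : Chd X Y x0 y0 c) : ZMod 2 :=
  ry d.A y0 + ry d.B x0 + fpre d.u x0 + fpre y0 d.u

end Chd

theorem chd_flip (hXY : ∀ x ∈ X, x ∉ Y) (h : IsCh X Y c) (h' : IsCh X Y c')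
    (d : Chd X Y x0 y0 c) (d' : Chd X Y x0 y0 c') (hd : ∀ x ∈ c, x ∉ c') :
    d.P d'.u + d'.P d.u = 1 + d.tau + d'.tau := by
  have e1 := disj_walks d.A d'.B (by
    intro x hx hx'
    rcases d.hA x hx' with a | a <;> rcases d'.hB x hx with b | b
    · exact hXY x a b
    · exact h'.dX x b a
    · exact h.dY x a b
    · exact hd x a b)
  have e2 := disj_walks d'.A d.B (by
    intro x hx hx'
    rcases d'.hA x hx' with a | a <;> rcases d.hB x hx with b | b
    · exact hXY x a b
    · exact h.dX x b a
    · exact h'.dY x a b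
    · exact hd x b a)
  have e3 : fpre d'.u d.u + fpre d.u d'.u = 1 := fpre_flip (fun e => hd _ d.hu (e ▸ d'.hu))
  have h2 : (2 : ZMod 2) = 0 := rfl
  unfold Chd.P Chd.tau
  linear_combination e1 + e2 + e3 - (ry d.A y0 + ry d.B x0 + ry d'.A y0 + ry d'.B x0 - fpre y0 x0) * h2

/-- separation parity -/
def sp {c0 c1 c2 c3 : Set Pt} (d0 : Chd X Y x0 y0 c0) (d1 : Chd X Y x0 y0 c1)
    (d2 : Chd X Y x0 y0 c2) (d3 : Chd X Y x0 y0 c3) : ZMod 2 :=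
  (d0.P d2.u + d1.P d2.u) + (d0.P d3.u + d1.P d3.u)

theorem sp_sum {c0 c1 c2 c3 : Set Pt} (hXY : ∀ x ∈ X, x ∉ Y) (d0 : Chd X Y x0 y0 c0)
    (d1 : Chd X Y x0 y0 c1) (d2 : Chd X Y x0 y0 c2) (d3 : Chd X Y x0 y0 c3)
    (h1 : IsCh X Y c1) (h2 : IsCh X Y c2) (h3 : IsCh X Y c3)
    (h12 : ∀ x ∈ c1, x ∉ c2) (h13 : ∀ x ∈ c1, x ∉ c3) (h23 : ∀ x ∈ c2, x ∉ c3) :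
    sp d0 d1 d2 d3 + sp d0 d2 d1 d3 + sp d0 d3 d1 d2 = 1 := by
  have e12 := chd_flip hXY h1 h2 d1 d2 h12
  have e13 := chd_flip hXY h1 h3 d1 d3 h13
  have e23 := chd_flip hXY h2 h3 d2 d3 h23
  have h2 : (2 : ZMod 2) = 0 := rfl
  unfold sp
  linear_combination e12 + e13 + e23 + (d0.P d1.u + d0.P d2.u + d0.P d3.u + 1 + d1.tau + d2.tau + d3.tau) * h2

theorem sp_zero {c0 c1 c2 c3 Z : Set Pt} (hX : Cn X) (hY : Cn Y) (hXY : ∀ x ∈ X, x ∉ Y)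
    (d0 : Chd X Y x0 y0 c0)
    (d1 : Chd X Y x0 y0 c1) (d2 : Chd X Y x0 y0 c2) (d3 : Chd X Y x0 y0 c3)
    (h0 : IsCh X Y c0) (h1 : IsCh X Y c1) (h2 : IsCh X Y c2) (h3 : IsCh X Y c3)
    (h02 : ∀ x ∈ c0, x ∉ c2) (h03 : ∀ x ∈ c0, x ∉ c3)
    (h12 : ∀ x ∈ c1, x ∉ c2) (h13 : ∀ x ∈ c1, x ∉ c3) (hZ : Cn Z)
    (hZX : ∀ x ∈ Z, x ∉ X) (hZY : ∀ x ∈ Z, x ∉ Y)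
    (hZ2 : ∀ x ∈ Z, x ∉ c2) (hZ3 : ∀ x ∈ Z, x ∉ c3)
    (hZ0 : (Z ∩ c0).Nonempty) (hZ1 : (Z ∩ c1).Nonempty) :
    sp d0 d1 d2 d3 = 0 := by
  have hC : Cn (c0 ∪ Z ∪ c1) := (h0.cn.union hZ (by rwa [Set.inter_comm])).union h1.cn
    (hZ1.mono (fun x hx => ⟨Or.inr hx.1, hx.2⟩))
  obtain ⟨M, hM⟩ := hC d0.u (Or.inl (Or.inl d0.hu)) d1.u (Or.inr d1.hu)
  have hXX : Cn ((X ∪ c2) ∪ (X ∪ c3)) := (h2.cX hX).union (h3.cX hX) (by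
    obtain ⟨v, hv, _⟩ := h2.aX
    exact ⟨v, Or.inl hv, Or.inl hv⟩)
  have hYY : Cn ((Y ∪ c2) ∪ (Y ∪ c3)) := (h2.cY hY).union (h3.cY hY) (by
    obtain ⟨v, hv, _⟩ := h2.aY
    exact ⟨v, Or.inl hv, Or.inl hv⟩)
  have e1 := closed_const (d0.A.append (M.append d1.A.reverse)) hYY (by
    intro x hx
    simp only [Walk.mem_support_append_iff, Walk.support_reverse, List.mem_reverse] at hx
    have hx' : x ∈ X ∨ x ∈ c0 ∨ x ∈ c1 ∨ x ∈ Z := by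
      rcases hx with hx | hx | hx
      · rcases d0.hA x hx with h | h <;> simp [h]
      · rcases hM x hx with (h | h) | h <;> simp [h]
      · rcases d1.hA x hx with h | h <;> simp [h]
    rcases hx' with a | a | a | a <;> rintro ((b | b) | (b | b)) <;>
      first
        | exact hXY x a b | exact h0.dY x a b | exact h1.dY x a b | exact hZY x a b
        | exact h2.dX x b a | exact h3.dX x b a | exact h02 x a b | exact h03 x a b
        | exact h12 x a b | exact h13 x a b | exact hZ2 x a b | exact hZ3 x a b)
    (u := d2.u) (v := d3.u) (Or.inl (Or.inr d2.hu)) (Or.inr (Or.inr d3.hu))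
  have e2 := closed_const (d0.B.reverse.append (M.append d1.B)) hXX (by
    intro x hx
    simp only [Walk.mem_support_append_iff, Walk.support_reverse, List.mem_reverse] at hx
    have hx' : x ∈ Y ∨ x ∈ c0 ∨ x ∈ c1 ∨ x ∈ Z := by
      rcases hx with hx | hx | hx
      · rcases d0.hB x hx with h | h <;> simp [h]
      · rcases hM x hx with (h | h) | h <;> simp [h]
      · rcases d1.hB x hx with h | h <;> simp [h]
    rcases hx' with a | a | a | a <;> rintro ((b | b) | (b | b)) <;>
      first
        | exact hXY x b a | exact h0.dX x a b | exact h1.dX x a b | exact hZX x a b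
        | exact h2.dY x b a | exact h3.dY x b a | exact h02 x a b | exact h03 x a b
        | exact h12 x a b | exact h13 x a b | exact hZ2 x a b | exact hZ3 x a b)
    (u := d2.u) (v := d3.u) (Or.inl (Or.inr d2.hu)) (Or.inr (Or.inr d3.hu))
  simp only [ry_append, ry_reverse] at e1 e2
  have h2 : (2 : ZMod 2) = 0 := rfl
  unfold sp Chd.P
  linear_combination e1 + e2 + (ry d0.A d3.u + ry d1.A d3.u + ry d0.B d3.u + ry d1.B d3.u
    - ry M d2.u + ry M d3.u) * h2

/-- strip data -/
structure Strip (X Y : Set Pt) (x0 y0 w0 : Pt) where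
  cX : Cn X
  cY : Cn Y
  hXY : ∀ x ∈ X, x ∉ Y
  hx0 : x0 ∈ X
  hy0 : y0 ∈ Y
  adj : BW.Adj x0 w0
  K : BW.Walk w0 y0
  hK : ∀ x ∈ K.support, x ∉ X

def Strip.k {w0 : Pt} (T : Strip X Y x0 y0 w0) (p : Pt) : ZMod 2 := ry (Walk.cons T.adj T.K) p

def Strip.n {w0 : Pt} (T : Strip X Y x0 y0 w0) (d : Chd X Y x0 y0 c) (d' : Chd X Y x0 y0 c') :
    ZMod 2 := d.P d'.u + T.k d'.u + d.tau + T.k d.u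

theorem Strip.n_flip {w0 : Pt} (T : Strip X Y x0 y0 w0) (h : IsCh X Y c) (h' : IsCh X Y c')
    (d : Chd X Y x0 y0 c) (d' : Chd X Y x0 y0 c') (hd : ∀ x ∈ c, x ∉ c') :
    T.n d d' + T.n d' d = 1 := by
  have := chd_flip T.hXY h h' d d' hd
  have h2 : (2 : ZMod 2) = 0 := rfl
  unfold Strip.n
  linear_combination this + (T.k d.u + T.k d'.u + d.tau + d'.tau) * h2

/-- chords on different sides of a chord are disjoint -/
theorem Strip.dis {w0 : Pt} (T : Strip X Y x0 y0 w0) {ci cj ck : Set Pt}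
    (hj : IsCh X Y cj) (hk : IsCh X Y ck)
    (di : Chd X Y x0 y0 ci) (dj : Chd X Y x0 y0 cj) (dk : Chd X Y x0 y0 ck)
    (hij : ∀ x ∈ ci, x ∉ cj) (hik : ∀ x ∈ ci, x ∉ ck)
    (kj : ∀ x ∈ T.K.support, x ∉ cj) (kk : ∀ x ∈ T.K.support, x ∉ ck)
    (hn : T.n di dj ≠ T.n di dk) : ∀ x ∈ cj, x ∉ ck := by
  intro z hz hz'
  apply hn
  have e := closed_const ((di.A.append di.B).append (Walk.cons T.adj T.K).reverse)
    (hj.cn.union hk.cn ⟨z, hz, hz'⟩) (by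
    intro x hx
    simp only [Walk.mem_support_append_iff, Walk.support_reverse, List.mem_reverse,
      Walk.support_cons, List.mem_cons] at hx
    have hx' : x ∈ X ∨ x ∈ Y ∨ x ∈ ci ∨ x ∈ T.K.support := by
      rcases hx with (hx | hx) | hx | hx
      · rcases di.hA x hx with h | h <;> simp [h]
      · rcases di.hB x hx with h | h <;> simp [h]
      · exact Or.inl (hx ▸ T.hx0)
      · simp [hx]
    rcases hx' with a | a | a | a <;> rintro (b | b) <;>
    first
      | exact hj.dX x b a | exact hk.dX x b a | exact hj.dY x b a | exact hk.dY x b a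
      | exact hij x a b | exact hik x a b | exact kj x a b | exact kk x a b)
    (u := dj.u) (v := dk.u) (Or.inl dj.hu) (Or.inr dk.hu)
  simp only [ry_append, ry_reverse] at e
  unfold Strip.n Chd.P Strip.k
  linear_combination e

theorem Strip.nolk {w0 : Pt} (T : Strip X Y x0 y0 w0) {ci cj ck : Set Pt}
    (hi : IsCh X Y ci) (hj : IsCh X Y cj) (hk : IsCh X Y ck)
    (di : Chd X Y x0 y0 ci) (dj : Chd X Y x0 y0 cj) (dk : Chd X Y x0 y0 ck)
    (hij : ∀ x ∈ ci, x ∉ cj) (hik : ∀ x ∈ ci, x ∉ ck)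
    (kj : ∀ x ∈ T.K.support, x ∉ cj) (kk : ∀ x ∈ T.K.support, x ∉ ck)
    {vi vj vk ui uj uk : Pt} (hui : ui ∈ ci) (huj : uj ∈ cj) (huk : uk ∈ ck)
    (ai : BW.Adj ui vi) (aj : BW.Adj uj vj) (ak : BW.Adj uk vk)
    (L : Lk X x0 vi vj vk) : T.n di dj = T.n di dk := by
  obtain ⟨P, Q, hP, hQ, hPQ⟩ := L
  obtain ⟨R, hR⟩ := hi.cn ui hui di.u di.hu
  have hQc : Cn ((cj ∪ {x | x ∈ Q.support}) ∪ ck) := by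
    refine Cn.union_adj (hj.cn.union_adj (Cn.walk Q) huj Q.start_mem_support aj) hk.cn
      (Or.inr Q.end_mem_support) huk ak.symm
  have hYc : Cn ((Y ∪ cj) ∪ (Y ∪ ck)) := (hj.cY T.cY).union (hk.cY T.cY)
    ⟨y0, Or.inl T.hy0, Or.inl T.hy0⟩
  let D := P.append (Walk.cons ai.symm R)
  have hD : ∀ x ∈ D.support, x ∈ P.support ∨ x ∈ ci := by
    intro x hx
    simp only [D, Walk.mem_support_append_iff, Walk.support_cons, List.mem_cons] at hx
    rcases hx with hx | hx | hx
    · exact Or.inl hx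
    · exact Or.inl (hx ▸ P.end_mem_support)
    · exact Or.inr (hR x hx)
  have e1 := closed_const ((D.append di.B).append (Walk.cons T.adj T.K).reverse) hQc (by
    intro x hx
    simp only [Walk.mem_support_append_iff, Walk.support_reverse, List.mem_reverse,
      Walk.support_cons, List.mem_cons] at hx
    have hx' : x ∈ P.support ∨ x ∈ Y ∨ x ∈ ci ∨ x ∈ T.K.support := by
      rcases hx with (hx | hx) | hx | hx
      · rcases hD x hx with h | h <;> simp [h]
      · rcases di.hB x hx with h | h <;> simp [h]
      · exact Or.inl (hx ▸ P.start_mem_support)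
      · simp [hx]
    rcases hx' with a | a | a | a <;> rintro ((b | b) | b) <;>
    first
      | exact hj.dX x b (hP x a) | exact hk.dX x b (hP x a) | exact hj.dY x b a | exact hk.dY x b a
      | exact hij x a b | exact hik x a b | exact kj x a b | exact kk x a b
      | exact hPQ x a b | exact T.hXY x (hQ x b) a | exact hi.dX x a (hQ x b)
      | exact T.hK x a (hQ x b))
    (u := dj.u) (v := dk.u) (Or.inl (Or.inl dj.hu)) (Or.inr dk.hu)
  have e2 := closed_const (di.A.append D.reverse) hYc (by
    intro x hx
    simp only [Walk.mem_support_append_iff, Walk.support_reverse, List.mem_reverse] at hx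
    have hx' : x ∈ X ∨ x ∈ ci := by
      rcases hx with hx | hx
      · exact di.hA x hx
      · rcases hD x hx with h | h
        · exact Or.inl (hP x h)
        · exact Or.inr h
    rcases hx' with a | a <;> rintro ((b | b) | (b | b)) <;>
    first
      | exact T.hXY x a b | exact hj.dX x b a | exact hk.dX x b a | exact hi.dY x a b
      | exact hij x a b | exact hik x a b)
    (u := dj.u) (v := dk.u) (Or.inl (Or.inr dj.hu)) (Or.inr (Or.inr dk.hu))
  simp only [ry_append, ry_reverse] at e1 e2
  have h2 : (2 : ZMod 2) = 0 := rfl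
  unfold Strip.n Chd.P Strip.k
  linear_combination e1 + e2 + (ry D dk.u - ry D dj.u) * h2

theorem Strip.nocyc {w0 : Pt} (T : Strip X Y x0 y0 w0) {ci cj ck : Set Pt}
    (hi : IsCh X Y ci) (hj : IsCh X Y cj) (hk : IsCh X Y ck)
    (di : Chd X Y x0 y0 ci) (dj : Chd X Y x0 y0 cj) (dk : Chd X Y x0 y0 ck)
    (hij : ∀ x ∈ ci, x ∉ cj) (hik : ∀ x ∈ ci, x ∉ ck) (hjk : ∀ x ∈ cj, x ∉ ck)
    (ki : ∀ x ∈ T.K.support, x ∉ ci)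
    (kj : ∀ x ∈ T.K.support, x ∉ cj) (kk : ∀ x ∈ T.K.support, x ∉ ck)
    (n1 : T.n di dj = 0) (n2 : T.n dk di = 0) (n3 : T.n dj dk = 0) : False := by
  have sy : ∀ {a b : Set Pt}, (∀ x ∈ a, x ∉ b) → ∀ x ∈ b, x ∉ a := fun h x hx hx' => h x hx' hx
  have f1 := T.n_flip hi hj di dj hij
  have f2 := T.n_flip hi hk di dk hik
  have f3 := T.n_flip hj hk dj dk hjk
  obtain ⟨vi, hvi, ui, hui, ai⟩ := hi.aX
  obtain ⟨vj, hvj, uj, huj, aj⟩ := hj.aX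
  obtain ⟨vk, hvk, uk, huk, ak⟩ := hk.aX
  rw [n1, zero_add] at f1
  rw [n2, add_zero] at f2
  rw [n3, zero_add] at f3
  have one : (1 : ZMod 2) ≠ 0 := by decide
  rcases Hlemma T.cX T.hx0 hvi hvj hvk (T.hK _ T.K.start_mem_support) (hi.dX _ hui) (hj.dX _ huj)
    (hk.dX _ huk) T.adj.symm ai aj ak
    (fun e => ki _ T.K.start_mem_support (e ▸ hui)) (fun e => kj _ T.K.start_mem_support (e ▸ huj))
    (fun e => kk _ T.K.start_mem_support (e ▸ huk)) (fun e => hij _ hui (e ▸ huj))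
    (fun e => hik _ hui (e ▸ huk)) (fun e => hjk _ huj (e ▸ huk)) with L | L | L
  · have := T.nolk hi hj hk di dj dk hij hik kj kk hui huj huk ai aj ak L
    rw [n1, f2] at this; exact one this.symm
  · have := T.nolk hj hi hk dj di dk (sy hij) hjk ki kk huj hui huk aj ai ak L
    rw [f1, n3] at this; exact one this
  · have := T.nolk hk hi hj dk di dj (sy hik) (sy hjk) ki kj huk hui huj ak ai aj L
    rw [n2, f3] at this; exact one this.symm

/-- a family of strip chords carries a partial order whose comparability is disjointness -/
theorem Strip.order {w0 : Pt} (T : Strip X Y x0 y0 w0) {ι : Type*} (c : ι → Set Pt)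
    (hc : ∀ i, IsCh X Y (c i)) (hK : ∀ i, ∀ x ∈ T.K.support, x ∉ c i) :
    ∃ r : ι → ι → Prop, (∀ i, ¬ r i i) ∧ (∀ i j k, r i j → r j k → r i k) ∧
      ∀ i j, (c i ∩ c j = ∅) ↔ (r i j ∨ r j i) := by
  have d := fun i => Classical.choice ((hc i).chd T.cX T.cY T.hx0 T.hy0)
  have sy : ∀ {a b : Set Pt}, (∀ x ∈ a, x ∉ b) → ∀ x ∈ b, x ∉ a := fun h x hx hx' => h x hx' hx
  have z01 : ∀ x : ZMod 2, x = 0 ∨ x = 1 := by decide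
  have ne (i) : (c i).Nonempty := by
    obtain ⟨_, _, u, hu, _⟩ := (hc i).aX
    exact ⟨u, hu⟩
  refine ⟨fun j i => (∀ x ∈ c i, x ∉ c j) ∧ T.n (d i) (d j) = 0, ?_, ?_, ?_⟩
  · intro i h
    obtain ⟨u, hu⟩ := ne i
    exact h.1 u hu hu
  · rintro j i k ⟨h1, n1⟩ ⟨h2, n2⟩
    have f2 := T.n_flip (hc k) (hc i) (d k) (d i) h2
    rw [n2, zero_add] at f2
    have hjk : ∀ x ∈ c j, x ∉ c k := T.dis (hc j) (hc k) (d i) (d j) (d k) h1 (sy h2) (hK j) (hK k)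
      (by rw [n1, f2]; decide)
    refine ⟨sy hjk, ?_⟩
    rcases z01 (T.n (d k) (d j)) with h | h
    · exact h
    · exfalso
      have f3 := T.n_flip (hc j) (hc k) (d j) (d k) hjk
      rw [h] at f3
      have f3 : T.n (d j) (d k) = 0 := by linear_combination f3
      exact T.nocyc (hc i) (hc j) (hc k) (d i) (d j) (d k) h1 (sy h2) hjk (hK i) (hK j) (hK k)
        n1 n2 f3
  · intro i j
    constructor
    · intro h
      have hd : ∀ x ∈ c i, x ∉ c j := fun x hx hx' => Set.notMem_empty x (h ▸ ⟨hx, hx'⟩)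
      have f := T.n_flip (hc i) (hc j) (d i) (d j) hd
      rcases z01 (T.n (d i) (d j)) with h | h
      · exact Or.inr ⟨hd, h⟩
      · rw [h] at f
        exact Or.inl ⟨sy hd, by linear_combination f⟩
    · rintro (⟨h, _⟩ | ⟨h, _⟩)
      · ext x; simp only [Set.mem_inter_iff, Set.mem_empty_iff_false, iff_false]
        exact fun hx => h x hx.2 hx.1
      · ext x; simp only [Set.mem_inter_iff, Set.mem_empty_iff_false, iff_false]
        exact fun hx => h x hx.1 hx.2

end SG

namespace SG
open Finset

section Poset
open scoped Classical

variable {ι : Type*} 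

theorem lin_ext (r : ι → ι → Prop) (irr : ∀ i, ¬ r i i) (tr : ∀ i j k, r i j → r j k → r i k) :
    ∀ (m : ℕ) (B : Finset ι), B.card = m → ∃ pos : ι → ℕ, (∀ x ∈ B, pos x < m) ∧
      (∀ x ∈ B, ∀ y ∈ B, pos x = pos y → x = y) ∧ ∀ x ∈ B, ∀ y ∈ B, r x y → pos x < pos y := by
  intro m
  induction m with
  | zero =>
    intro B hB
    rw [Finset.card_eq_zero] at hB
    subst hB
    exact ⟨fun _ => 0, by simp, by simp, by simp⟩
  | succ m ih =>
    intro B hB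
    obtain ⟨x, hx, hmax⟩ := Finset.exists_max_image B (fun x => (B.filter (fun y => r y x)).card)
      (by rw [← Finset.card_pos]; omega)
    have hnr : ∀ y ∈ B, ¬ r x y := by
      intro y hy hr
      have h1 := hmax y hy
      have h2 : (B.filter (fun z => r z x)) ⊂ (B.filter (fun z => r z y)) := by
        rw [Finset.ssubset_iff_of_subset]
        · exact ⟨x, by simp [hx, hr], by simp [irr]⟩
        · intro z hz
          simp only [Finset.mem_filter] at hz ⊢
          exact ⟨hz.1, tr _ _ _ hz.2 hr⟩
      have := Finset.card_lt_card h2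
      omega
    obtain ⟨pos, h1, h2, h3⟩ := ih (B.erase x) (by rw [Finset.card_erase_of_mem hx]; omega)
    refine ⟨fun y => if y = x then m else pos y, ?_, ?_, ?_⟩
    · intro y hy
      by_cases e : y = x
      · simp [e]
      · simp only [e, if_false]
        have := h1 y (by simp [e, hy]); omega
    · intro y hy z hz
      by_cases e : y = x <;> by_cases e' : z = x
      · intro _; rw [e, e']
      · simp only [e, e', if_true, if_false]
        have := h1 z (by simp [e', hz]); intro; omega
      · simp only [e, e', if_true, if_false]
        have := h1 y (by simp [e, hy]); intro; omega
      · simp only [e, e', if_false]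
        exact h2 y (by simp [e, hy]) z (by simp [e', hz])
    · intro y hy z hz hr
      by_cases e : y = x
      · subst e; exact absurd hr (hnr z hz)
      by_cases e' : z = x
      · simp only [e, e', if_true, if_false]
        exact h1 y (by simp [e, hy])
      · simp only [e, e', if_false]
        exact h3 y (by simp [e, hy]) z (by simp [e', hz]) hr

structure PD (r : ι → ι → Prop) (B : Finset ι) (pos : ι → ℕ) (s : ℕ) : Prop where
  tr : ∀ i j k, r i j → r j k → r i k
  lt : ∀ x ∈ B, pos x < B.card
  inj : ∀ x ∈ B, ∀ y ∈ B, pos x = pos y → x = y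
  mono : ∀ x ∈ B, ∀ y ∈ B, r x y → pos x < pos y
  s1 : 1 ≤ s
  nb : ∀ A ⊆ B, ∀ A' ⊆ B, s ≤ A.card → s ≤ A'.card → ∃ a ∈ A, ∃ a' ∈ A', a ≠ a' ∧ (r a a' ∨ r a' a)

variable {r : ι → ι → Prop} {B : Finset ι} {pos : ι → ℕ} {s : ℕ}

/-- number of elements in a full window -/
theorem PD.win (h : PD r B pos s) {a b : ℕ} (hb : b ≤ B.card) :
    (B.filter (fun y => a ≤ pos y ∧ pos y < b)).card = b - a := by
  have himg : B.image pos = Finset.range B.card := by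
    apply Finset.eq_of_subset_of_card_le
    · intro z hz
      obtain ⟨x, hx, rfl⟩ := Finset.mem_image.1 hz
      exact Finset.mem_range.2 (h.lt x hx)
    · rw [Finset.card_image_of_injOn (fun x hx y hy e => h.inj x hx y hy e), Finset.card_range]
  rw [← Nat.card_Ico, ← Finset.card_image_of_injOn (f := pos)
    (fun x hx y hy e => h.inj x (Finset.mem_filter.1 hx).1 y (Finset.mem_filter.1 hy).1 e)]
  congr 1
  ext z
  simp only [Finset.mem_image, Finset.mem_filter, Finset.mem_Ico]
  constructor
  · rintro ⟨x, ⟨_, h1, h2⟩, rfl⟩; exact ⟨h1, h2⟩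
  · rintro ⟨h1, h2⟩
    have : z ∈ B.image pos := by rw [himg]; exact Finset.mem_range.2 (by omega)
    obtain ⟨x, hx, rfl⟩ := Finset.mem_image.1 this
    exact ⟨x, ⟨hx, h1, h2⟩, rfl⟩

theorem PD.win_le (h : PD r B pos s) (a b : ℕ) :
    (B.filter (fun y => a ≤ pos y ∧ pos y < b)).card ≤ b - a := by
  rw [← Nat.card_Ico, ← Finset.card_image_of_injOn (f := pos)
    (fun x hx y hy e => h.inj x (Finset.mem_filter.1 hx).1 y (Finset.mem_filter.1 hy).1 e)]
  apply Finset.card_le_card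
  intro z
  simp only [Finset.mem_image, Finset.mem_filter, Finset.mem_Ico]
  rintro ⟨x, ⟨_, h1, h2⟩, rfl⟩; exact ⟨h1, h2⟩

/-- few elements of a later set are not above a set of size `s` -/
theorem PD.few (h : PD r B pos s) {X Y : Finset ι} (hX : X ⊆ B) (hY : Y ⊆ B) (hs : s ≤ X.card)
    (hlt : ∀ x ∈ X, ∀ y ∈ Y, pos x < pos y) (hn : ∀ x ∈ X, ∀ y ∈ Y, ¬ r x y) : Y.card < s := by
  by_contra hc
  push Not at hc
  obtain ⟨a, ha, b, hb, _, h1 | h1⟩ := h.nb X hX Y hY hs hc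
  · exact hn a ha b hb h1
  · have := h.mono b (hY hb) a (hX ha) h1
    have := hlt a ha b hb
    omega

theorem PD.grow (h : PD r B pos s) : ∀ (k : ℕ) (X : Finset ι) (p : ℕ), X ⊆ B → X.card ≤ 2 ^ k →
    (∀ x ∈ X, pos x < p) → p + 3 * s * (k + 1) ≤ B.card →
    s ≤ (B.filter (fun y => p ≤ pos y ∧ pos y < p + 3 * s ∧ ∃ x ∈ X, r x y)).card →
    ∃ x ∈ X, s ≤ (B.filter (fun y => p ≤ pos y ∧ pos y < p + 3 * s * (k + 1) ∧ r x y)).card := by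
  intro k
  induction k with
  | zero =>
    intro X p hX hc hlt hm hs
    have hne : X.Nonempty := by
      by_contra he
      rw [Finset.not_nonempty_iff_eq_empty] at he
      subst he
      have := h.s1
      simp at hs; omega
    obtain ⟨x, hx⟩ : ∃ x, X = {x} := Finset.card_eq_one.1 (by
      have := hne.card_pos; simp at hc; omega)
    subst hx
    refine ⟨x, by simp, ?_⟩
    simpa using hs
  | succ k ih =>
    intro X p hX hc hlt hm hs
    obtain ⟨X1, hX1, hc1⟩ := Finset.exists_subset_card_eq (s := X) (n := X.card / 2) (by omega)
    set T := B.filter (fun y => p ≤ pos y ∧ pos y < p + 3 * s ∧ ∃ x ∈ X, r x y) with hT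
    have hm' : p + 3 * s + 3 * s * (k + 1) ≤ B.card := by
      have : p + 3 * s + 3 * s * (k + 1) = p + 3 * s * (k + 1 + 1) := by ring
      omega
    have hw : (B.filter (fun y => p + 3 * s ≤ pos y ∧ pos y < p + 3 * s + 3 * s)).card = 3 * s := by
      rw [h.win]
      · omega
      · have : 3 * s ≤ 3 * s * (k + 1) := Nat.le_mul_of_pos_right _ (by omega)
        omega
    set W := B.filter (fun y => p + 3 * s ≤ pos y ∧ pos y < p + 3 * s + 3 * s) with hW
    have hfew : (W.filter (fun y => ¬ ∃ t ∈ T, r t y)).card < s := by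
      apply h.few (X := T) (Finset.filter_subset _ _)
        ((Finset.filter_subset _ _).trans (Finset.filter_subset _ _)) hs
      · intro x hx y hy
        simp only [hT, hW, Finset.mem_filter] at hx hy
        omega
      · intro x hx y hy hr
        simp only [Finset.mem_filter] at hy
        exact hy.2 ⟨x, hx, hr⟩
    have hun : W ⊆ (W.filter (fun y => ¬ ∃ t ∈ T, r t y)) ∪
        ((W.filter (fun y => ∃ x ∈ X1, r x y)) ∪ (W.filter (fun y => ∃ x ∈ X \ X1, r x y))) := by
      intro y hy
      simp only [Finset.mem_union, Finset.mem_filter, hy, true_and]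
      by_cases hh : ∃ t ∈ T, r t y
      · right
        obtain ⟨t, ht, hr⟩ := hh
        rw [hT, Finset.mem_filter] at ht
        obtain ⟨x, hx, hr'⟩ := ht.2.2.2
        by_cases hx1 : x ∈ X1
        · exact Or.inl ⟨x, hx1, h.tr _ _ _ hr' hr⟩
        · exact Or.inr ⟨x, Finset.mem_sdiff.2 ⟨hx, hx1⟩, h.tr _ _ _ hr' hr⟩
      · exact Or.inl hh
    have hcard := (Finset.card_le_card hun).trans ((Finset.card_union_le _ _).trans
      (Nat.add_le_add_left (Finset.card_union_le _ _) _))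
    have hpow : 2 ^ (k + 1) = 2 * 2 ^ k := by ring
    have main : ∀ X' ⊆ X, X'.card ≤ 2 ^ k → s ≤ (W.filter (fun y => ∃ x ∈ X', r x y)).card →
      ∃ x ∈ X, s ≤ (B.filter (fun y => p ≤ pos y ∧ pos y < p + 3 * s * (k + 1 + 1) ∧ r x y)).card := by
      intro X' hX' hc' hs'
      obtain ⟨x, hx, hh⟩ := ih X' (p + 3 * s) (hX'.trans hX) hc'
        (fun x hx => by have := hlt x (hX' hx); omega) hm' (hs'.trans (Finset.card_le_card (by
          intro y hy
          simp only [hW, Finset.mem_filter] at hy ⊢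
          exact ⟨hy.1.1, hy.1.2.1, hy.1.2.2, hy.2⟩)))
      refine ⟨x, hX' hx, hh.trans (Finset.card_le_card ?_)⟩
      intro y hy
      simp only [Finset.mem_filter] at hy ⊢
      have : p + 3 * s + 3 * s * (k + 1) = p + 3 * s * (k + 1 + 1) := by ring
      exact ⟨hy.1, by omega, by omega, hy.2.2.2⟩
    by_cases hcase : s ≤ (W.filter (fun y => ∃ x ∈ X1, r x y)).card
    · exact main X1 hX1 (by omega) hcase
    · refine main (X \ X1) Finset.sdiff_subset ?_ (by omega)
      rw [Finset.card_sdiff_of_subset hX1]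
      omega

theorem PD.bad (h : PD r B pos s) {L : ℕ} (hL : B.card ≤ 2 ^ L) (p : ℕ) :
    (B.filter (fun x => pos x < p ∧ s ≤ (B.filter (fun y => p + 3 * s * (L + 1) ≤ pos y ∧
      ¬ r x y)).card)).card < s := by
  by_contra hc
  push Not at hc
  set X := B.filter (fun x => pos x < p ∧ s ≤ (B.filter (fun y => p + 3 * s * (L + 1) ≤ pos y ∧
      ¬ r x y)).card) with hX
  have hXB : X ⊆ B := Finset.filter_subset _ _
  have hs1 := h.s1
  have hm : p + 3 * s * (L + 1) ≤ B.card := by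
    by_contra hm
    obtain ⟨x, hx⟩ : X.Nonempty := Finset.card_pos.1 (by omega)
    rw [hX, Finset.mem_filter] at hx
    have := hx.2.2
    have h0 : (B.filter (fun y => p + 3 * s * (L + 1) ≤ pos y ∧ ¬ r x y)) = ∅ := by
      apply Finset.filter_eq_empty_iff.2
      intro y hy
      have := h.lt y hy
      omega
    rw [h0] at this
    simp at this; omega
  have h3 : 3 * s ≤ 3 * s * (L + 1) := Nat.le_mul_of_pos_right _ (by omega)
  have hw := h.win (a := p) (b := p + 3 * s) (by omega)
  set W := B.filter (fun y => p ≤ pos y ∧ pos y < p + 3 * s) with hW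
  have hfew : (W.filter (fun y => ¬ ∃ x ∈ X, r x y)).card < s := by
    apply h.few hXB ((Finset.filter_subset _ _).trans (Finset.filter_subset _ _)) hc
    · intro x hx y hy
      simp only [hX, hW, Finset.mem_filter] at hx hy
      omega
    · intro x hx y hy hr
      simp only [Finset.mem_filter] at hy
      exact hy.2 ⟨x, hx, hr⟩
  have hsum := Finset.card_filter_add_card_filter_not (s := W) (fun y => ∃ x ∈ X, r x y)
  have hW' : W.filter (fun y => ∃ x ∈ X, r x y) = B.filter (fun y => p ≤ pos y ∧
        pos y < p + 3 * s ∧ ∃ x ∈ X, r x y) := by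
      rw [hW, Finset.filter_filter]
      congr 1
      ext y; simp only [and_assoc]
  obtain ⟨x, hx, hT⟩ := h.grow L X p hXB ((Finset.card_le_card hXB).trans hL)
    (fun x hx => by rw [hX, Finset.mem_filter] at hx; exact hx.2.1) hm (by rw [← hW']; omega)
  rw [hX, Finset.mem_filter] at hx
  have := h.few (Finset.filter_subset _ _) (Finset.filter_subset _ _) hT
    (Y := (B.filter (fun y => p + 3 * s * (L + 1) ≤ pos y ∧ ¬ r x y))) (by
      intro a ha b hb
      simp only [Finset.mem_filter] at ha hb
      omega) (by
      intro a ha b hb hr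
      simp only [Finset.mem_filter] at ha hb
      exact hb.2.2 (h.tr _ _ _ ha.2.2.2 hr))
  omega

theorem PD.count (h : PD r B pos s) {L β : ℕ} (hL : B.card ≤ 2 ^ L) (hβ : 3 * s * (L + 1) ≤ β) :
    ∑ x ∈ B, (B.filter (fun y => pos x < pos y ∧ ¬ r x y)).card
      ≤ B.card * ((B.card / β + 1) * s + 2 * β + s) := by
  set m := B.card with hm
  have hs1 := h.s1
  have hβ0 : 0 < β := by nlinarith
  let bad : ℕ → Finset ι := fun p => B.filter (fun x => pos x < p ∧ s ≤ (B.filter (fun y =>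
    p + 3 * s * (L + 1) ≤ pos y ∧ ¬ r x y)).card)
  let Bad := (Finset.range (m / β + 1)).biUnion (fun j => bad ((j + 1) * β))
  have hBad : Bad.card ≤ (m / β + 1) * s := by
    have := Finset.card_biUnion_le_card_mul (Finset.range (m / β + 1)) (fun j => bad ((j + 1) * β)) s
      (fun j _ => (h.bad hL ((j + 1) * β)).le)
    simpa using this
  have hx : ∀ x ∈ B, (B.filter (fun y => pos x < pos y ∧ ¬ r x y)).card ≤
      (if x ∈ Bad then m else 0) + (2 * β + s) := by
    intro x hx
    split_ifs with hb
    · have := Finset.card_filter_le B (fun y => pos x < pos y ∧ ¬ r x y)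
      omega
    · set p := (pos x / β + 1) * β with hp
      have hpx : pos x < p := Nat.lt_mul_of_div_lt (by omega) hβ0
      have hpx2 : p ≤ pos x + β := by
        have := Nat.div_mul_le_self (pos x) β
        rw [hp, add_mul]; omega
      have hnb : x ∉ bad p := by
        intro hh
        apply hb
        rw [Finset.mem_biUnion]
        refine ⟨pos x / β, ?_, hh⟩
        rw [Finset.mem_range, Nat.lt_succ_iff]
        exact Nat.div_le_div_right (h.lt x hx).le
      have hlt : (B.filter (fun y => p + 3 * s * (L + 1) ≤ pos y ∧ ¬ r x y)).card < s := by
        by_contra hc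
        exact hnb (Finset.mem_filter.2 ⟨hx, hpx, by omega⟩)
      have hsub : (B.filter (fun y => pos x < pos y ∧ ¬ r x y)) ⊆
          (B.filter (fun y => pos x ≤ pos y ∧ pos y < p + 3 * s * (L + 1))) ∪
          (B.filter (fun y => p + 3 * s * (L + 1) ≤ pos y ∧ ¬ r x y)) := by
        intro y hy
        simp only [Finset.mem_union, Finset.mem_filter] at hy ⊢
        rcases lt_or_ge (pos y) (p + 3 * s * (L + 1)) with h1 | h1
        · exact Or.inl ⟨hy.1, hy.2.1.le, h1⟩
        · exact Or.inr ⟨hy.1, h1, hy.2.2⟩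
      have h1 := (Finset.card_le_card hsub).trans (Finset.card_union_le _ _)
      have h2 := h.win_le (pos x) (p + 3 * s * (L + 1))
      omega
  calc _ ≤ ∑ x ∈ B, ((if x ∈ Bad then m else 0) + (2 * β + s)) := Finset.sum_le_sum hx
    _ = (B.filter (fun x => x ∈ Bad)).card * m + m * (2 * β + s) := by
      rw [Finset.sum_add_distrib, ← Finset.sum_filter, Finset.sum_const, Finset.sum_const]
      simp [hm]
    _ ≤ ((m / β + 1) * s) * m + m * (2 * β + s) := by
      gcongr
      refine (Finset.card_le_card ?_).trans hBad
      intro x hx; exact (Finset.mem_filter.1 hx).2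
    _ = _ := by ring

/-- dense incomparability graphs contain large bicliques -/
theorem poset_count (r : ι → ι → Prop) (irr : ∀ i, ¬ r i i) (tr : ∀ i j k, r i j → r j k → r i k)
    (B : Finset ι) {s L β : ℕ} (hs : 1 ≤ s) (hL : B.card ≤ 2 ^ L) (hβ : 3 * s * (L + 1) ≤ β)
    (nb : ∀ A ⊆ B, ∀ A' ⊆ B, s ≤ A.card → s ≤ A'.card →
      ∃ a ∈ A, ∃ a' ∈ A', a ≠ a' ∧ (r a a' ∨ r a' a)) :
    ((B ×ˢ B).filter (fun x => x.1 ≠ x.2 ∧ ¬ (r x.1 x.2 ∨ r x.2 x.1))).card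
      ≤ 2 * (B.card * ((B.card / β + 1) * s + 2 * β + s)) := by
  obtain ⟨pos, h1, h2, h3⟩ := lin_ext r irr tr B.card B rfl
  have h : PD r B pos s := ⟨tr, h1, h2, h3, hs, nb⟩
  have hc := h.count hL hβ
  have e1 : ∑ x ∈ B, (B.filter (fun y => pos x < pos y ∧ ¬ r x y)).card =
      ((B ×ˢ B).filter (fun x => pos x.1 < pos x.2 ∧ ¬ r x.1 x.2)).card := by
    simp only [Finset.card_filter, Finset.sum_product]
  have e2 : ∑ x ∈ B, (B.filter (fun y => pos x < pos y ∧ ¬ r x y)).card =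
      ((B ×ˢ B).filter (fun x => pos x.2 < pos x.1 ∧ ¬ r x.2 x.1)).card := by
    simp only [Finset.card_filter, Finset.sum_product]
    rw [Finset.sum_comm]
  have hsub : ((B ×ˢ B).filter (fun x => x.1 ≠ x.2 ∧ ¬ (r x.1 x.2 ∨ r x.2 x.1))) ⊆
      ((B ×ˢ B).filter (fun x => pos x.1 < pos x.2 ∧ ¬ r x.1 x.2)) ∪
      ((B ×ˢ B).filter (fun x => pos x.2 < pos x.1 ∧ ¬ r x.2 x.1)) := by
    rintro ⟨a, b⟩ hab
    simp only [Finset.mem_union, Finset.mem_filter, Finset.mem_product, not_or] at hab ⊢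
    rcases lt_trichotomy (pos a) (pos b) with h | h | h
    · exact Or.inl ⟨hab.1, h, hab.2.2.1⟩
    · exact absurd (h2 a hab.1.1 b hab.1.2 h) hab.2.1
    · exact Or.inr ⟨hab.1, h, hab.2.2.2⟩
  have := (Finset.card_le_card hsub).trans (Finset.card_union_le _ _)
  omega

end Poset
end SG

namespace SG
open Finset

section Fam
open scoped Classical

variable {V : Type*}

/-- number of ordered crossing pairs -/
noncomputable def CR (c : V → Set Pt) (B : Finset V) : ℕ :=
  ((B ×ˢ B).filter (fun x => x.1 ≠ x.2 ∧ (c x.1 ∩ c x.2).Nonempty)).card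

def NB (R : V → Set Pt) (U : Finset V) (s : ℕ) : Prop :=
  ∀ A ⊆ U, ∀ B ⊆ U, s ≤ A.card → s ≤ B.card → ∃ a ∈ A, ∃ b ∈ B, a ≠ b ∧ R a ∩ R b = ∅

theorem NB.mono {R c : V → Set Pt} {U B : Finset V} {s : ℕ} (h : NB R U s) (hB : B ⊆ U)
    (hc : ∀ b ∈ B, c b ⊆ R b) : NB c B s := by
  intro A hA A' hA' h1 h2
  obtain ⟨a, ha, b, hb, hne, e⟩ := h A (hA.trans hB) A' (hA'.trans hB) h1 h2
  refine ⟨a, ha, b, hb, hne, ?_⟩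
  apply Set.eq_empty_of_subset_empty
  rw [← e]
  exact Set.inter_subset_inter (hc a (hA ha)) (hc b (hA' hb))

theorem CR_congr {c c' : V → Set Pt} {B : Finset V} (h : ∀ b ∈ B, c b = c' b) :
    CR c B = CR c' B := by
  unfold CR
  congr 1
  apply Finset.filter_congr
  rintro ⟨x, y⟩ hx
  rw [Finset.mem_product] at hx
  simp only
  rw [h x hx.1, h y hx.2]

theorem lemI {X Y : Set Pt} {x0 y0 w0 : Pt} (T : Strip X Y x0 y0 w0) (c : V → Set Pt)
    (B : Finset V) (hc : ∀ i ∈ B, IsCh X Y (c i)) (hK : ∀ i ∈ B, ∀ x ∈ T.K.support, x ∉ c i)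
    {s L β : ℕ} (hs : 1 ≤ s) (hL : B.card ≤ 2 ^ L) (hβ : 3 * s * (L + 1) ≤ β) (hNB : NB c B s) :
    CR c B ≤ 2 * (B.card * ((B.card / β + 1) * s + 2 * β + s)) := by
  rcases B.eq_empty_or_nonempty with rfl | ⟨b0, hb0⟩
  · simp [CR]
  let c' : V → Set Pt := fun i => if i ∈ B then c i else c b0
  have hcc : ∀ b ∈ B, c b = c' b := by intro b hb; simp [c', hb]
  obtain ⟨r, irr, tr, hr⟩ := T.order c' (by
    intro i; by_cases hi : i ∈ B
    · rw [← hcc i hi]; exact hc i hi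
    · simp only [c', hi, if_false]; exact hc b0 hb0) (by
    intro i; by_cases hi : i ∈ B
    · rw [← hcc i hi]; exact hK i hi
    · simp only [c', hi, if_false]; exact hK b0 hb0)
  have := poset_count r irr tr B hs hL hβ (by
    intro A hA A' hA' h1 h2
    obtain ⟨a, ha, b, hb, hne, e⟩ := hNB A hA A' hA' h1 h2
    rw [hcc a (hA ha), hcc b (hA' hb)] at e
    exact ⟨a, ha, b, hb, hne, (hr a b).1 e⟩)
  rw [CR_congr hcc]
  refine le_trans (Finset.card_le_card ?_) this
  rintro ⟨x, y⟩ hx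
  simp only [Finset.mem_filter] at hx ⊢
  refine ⟨hx.1, hx.2.1, ?_⟩
  rw [← hr]
  exact hx.2.2.ne_empty

theorem sum_pow4 (B : Finset V) (f : V → ℕ) (N : ℕ) (hB : B.card ≤ N) :
    (∑ b ∈ B, f b) ^ 4 ≤ N ^ 3 * ∑ b ∈ B, f b ^ 4 := by
  have h1 : (∑ b ∈ B, f b) ^ 2 ≤ N * ∑ b ∈ B, f b ^ 2 :=
    sq_sum_le_card_mul_sum_sq.trans (Nat.mul_le_mul_right _ hB)
  have h2 : (∑ b ∈ B, f b ^ 2) ^ 2 ≤ N * ∑ b ∈ B, (f b ^ 2) ^ 2 :=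
    sq_sum_le_card_mul_sum_sq.trans (Nat.mul_le_mul_right _ hB)
  calc (∑ b ∈ B, f b) ^ 4 = ((∑ b ∈ B, f b) ^ 2) ^ 2 := by ring
    _ ≤ (N * ∑ b ∈ B, f b ^ 2) ^ 2 := by gcongr
    _ = N ^ 2 * (∑ b ∈ B, f b ^ 2) ^ 2 := by ring
    _ ≤ N ^ 2 * (N * ∑ b ∈ B, (f b ^ 2) ^ 2) := by gcongr
    _ = _ := by simp only [← pow_mul]; ring

/-- fixed pair estimate of Lemma S -/
theorem lemS_pair {X Y : Set Pt} {x0 y0 : Pt} (hX : Cn X) (hY : Cn Y) (hXY : ∀ x ∈ X, x ∉ Y)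
    (c Z : V → Set Pt) (A B : Finset V) (hc : ∀ a, IsCh X Y (c a))
    (d : ∀ a, Chd X Y x0 y0 (c a)) (hZ : ∀ b ∈ B, Cn (Z b))
    (hZX : ∀ b ∈ B, ∀ x ∈ Z b, x ∉ X) (hZY : ∀ b ∈ B, ∀ x ∈ Z b, x ∉ Y) {t N : ℕ}
    (hA : A.card ≤ N) (hB : B.card ≤ N)
    (nb : ∀ A' ⊆ A, ∀ B' ⊆ B, t ≤ A'.card → t ≤ B'.card → ∃ a ∈ A', ∃ b ∈ B', Z b ∩ c a = ∅)
    (a0 a1 : V) :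
    (∑ b ∈ B, ∑ a2 ∈ A, ∑ a3 ∈ A, if ((Z b ∩ c a0).Nonempty ∧ (Z b ∩ c a1).Nonempty ∧
      (c a0 ∩ c a2 = ∅) ∧ (c a0 ∩ c a3 = ∅) ∧ (c a1 ∩ c a2 = ∅) ∧ (c a1 ∩ c a3 = ∅) ∧
      sp (d a0) (d a1) (d a2) (d a3) = 1) then 1 else 0) ≤ 4 * t * N ^ 2 := by
  let I : V → ZMod 2 := fun a => (d a0).P (d a).u + (d a1).P (d a).u
  let good : V → Prop := fun a => (c a0 ∩ c a = ∅) ∧ (c a1 ∩ c a = ∅)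
  let Lf := A.filter (fun a => good a ∧ I a = 0)
  let Rf := A.filter (fun a => good a ∧ I a = 1)
  let B1 := B.filter (fun b => (Z b ∩ c a0).Nonempty ∧ (Z b ∩ c a1).Nonempty)
  have dj : ∀ {P Q : Set Pt}, P ∩ Q = ∅ → ∀ x ∈ P, x ∉ Q := by
    intro P Q h x hx hx'
    exact Set.notMem_empty x (h ▸ ⟨hx, hx'⟩)
  have key : ∀ b ∈ B1, (∀ a ∈ Lf, Z b ∩ c a ≠ ∅) ∨ (∀ a ∈ Rf, Z b ∩ c a ≠ ∅) := by
    intro b hb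
    by_contra hcon
    push Not at hcon
    obtain ⟨⟨a2, h2, e2⟩, ⟨a3, h3, e3⟩⟩ := hcon
    simp only [Lf, Rf, B1, good, Finset.mem_filter] at h2 h3 hb
    have := sp_zero hX hY hXY (d a0) (d a1) (d a2) (d a3) (hc _) (hc _) (hc _) (hc _)
      (dj h2.2.1.1) (dj h3.2.1.1) (dj h2.2.1.2) (dj h3.2.1.2) (hZ b hb.1) (hZX b hb.1) (hZY b hb.1)
      (dj e2) (dj e3) hb.2.1 hb.2.2
    have h4 : sp (d a0) (d a1) (d a2) (d a3) = I a2 + I a3 := rfl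
    rw [h4, h2.2.2, h3.2.2] at this
    exact absurd this (by decide)
  have hLc : Lf.card ≤ N := (Finset.card_filter_le _ _).trans hA
  have hRc : Rf.card ≤ N := (Finset.card_filter_le _ _).trans hA
  have hBc : B1.card ≤ N := (Finset.card_filter_le _ _).trans hB
  have prod : B1.card * Lf.card * Rf.card ≤ 2 * t * N ^ 2 := by
    by_cases hL : Lf.card < t
    · calc B1.card * Lf.card * Rf.card ≤ N * t * N := by gcongr
        _ ≤ 2 * t * N ^ 2 := by nlinarith [Nat.zero_le (t * N ^ 2)]
    by_cases hR : Rf.card < t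
    · calc B1.card * Lf.card * Rf.card ≤ N * N * t := by gcongr
        _ ≤ 2 * t * N ^ 2 := by nlinarith [Nat.zero_le (t * N ^ 2)]
    push Not at hL hR
    have hBt : B1.card ≤ 2 * t := by
      let BL := B1.filter (fun b => ∀ a ∈ Lf, Z b ∩ c a ≠ ∅)
      let BR := B1.filter (fun b => ∀ a ∈ Rf, Z b ∩ c a ≠ ∅)
      have hsub : B1 ⊆ BL ∪ BR := by
        intro b hb
        simp only [BL, BR, Finset.mem_union, Finset.mem_filter]
        rcases key b hb with h | h
        · exact Or.inl ⟨hb, h⟩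
        · exact Or.inr ⟨hb, h⟩
      have h1 : BL.card < t := by
        by_contra hh
        obtain ⟨a, ha, b, hb, e⟩ := nb Lf (Finset.filter_subset _ _) BL
          ((Finset.filter_subset _ _).trans (Finset.filter_subset _ _)) hL (by omega)
        exact (Finset.mem_filter.1 hb).2 a ha e
      have h2 : BR.card < t := by
        by_contra hh
        obtain ⟨a, ha, b, hb, e⟩ := nb Rf (Finset.filter_subset _ _) BR
          ((Finset.filter_subset _ _).trans (Finset.filter_subset _ _)) hR (by omega)
        exact (Finset.mem_filter.1 hb).2 a ha e
      have := (Finset.card_le_card hsub).trans (Finset.card_union_le _ _)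
      omega
    calc B1.card * Lf.card * Rf.card ≤ (2 * t) * N * N := by gcongr
      _ = _ := by ring
  have pw : ∀ b ∈ B, ∀ a2 ∈ A, ∀ a3 ∈ A, (if ((Z b ∩ c a0).Nonempty ∧ (Z b ∩ c a1).Nonempty ∧
      (c a0 ∩ c a2 = ∅) ∧ (c a0 ∩ c a3 = ∅) ∧ (c a1 ∩ c a2 = ∅) ∧ (c a1 ∩ c a3 = ∅) ∧
      sp (d a0) (d a1) (d a2) (d a3) = 1) then 1 else 0) ≤
      (if b ∈ B1 then 1 else 0) * ((if a2 ∈ Lf then 1 else 0) * (if a3 ∈ Rf then 1 else 0) +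
        (if a2 ∈ Rf then 1 else 0) * (if a3 ∈ Lf then 1 else 0)) := by
    intro b hb a2 h2 a3 h3
    by_cases hcond : ((Z b ∩ c a0).Nonempty ∧ (Z b ∩ c a1).Nonempty ∧
      (c a0 ∩ c a2 = ∅) ∧ (c a0 ∩ c a3 = ∅) ∧ (c a1 ∩ c a2 = ∅) ∧ (c a1 ∩ c a3 = ∅) ∧
      sp (d a0) (d a1) (d a2) (d a3) = 1)
    swap
    · rw [if_neg hcond]; exact Nat.zero_le _
    rw [if_pos hcond]
    obtain ⟨z0, z1, e02, e03, e12, e13, hsp⟩ := hcond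
    have z01 : ∀ x y : ZMod 2, x + y = 1 → (x = 0 ∧ y = 1) ∨ (x = 1 ∧ y = 0) := by decide
    have hb1 : b ∈ B1 := Finset.mem_filter.2 ⟨hb, z0, z1⟩
    rw [if_pos hb1]
    rcases z01 (I a2) (I a3) hsp with ⟨h, h'⟩ | ⟨h, h'⟩
    · have m2 : a2 ∈ Lf := Finset.mem_filter.2 ⟨h2, ⟨e02, e12⟩, h⟩
      have m3 : a3 ∈ Rf := Finset.mem_filter.2 ⟨h3, ⟨e03, e13⟩, h'⟩
      rw [if_pos m2, if_pos m3, one_mul, one_mul]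
      exact Nat.le_add_right _ _
    · have m2 : a2 ∈ Rf := Finset.mem_filter.2 ⟨h2, ⟨e02, e12⟩, h⟩
      have m3 : a3 ∈ Lf := Finset.mem_filter.2 ⟨h3, ⟨e03, e13⟩, h'⟩
      rw [if_pos m2, if_pos m3, one_mul, one_mul]
      exact Nat.le_add_left _ _
  refine (Finset.sum_le_sum fun b hb => Finset.sum_le_sum fun a2 h2 => Finset.sum_le_sum fun a3 h3 =>
    pw b hb a2 h2 a3 h3).trans ?_
  simp only [← Finset.mul_sum, ← Finset.sum_mul, Finset.sum_add_distrib]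
  have c1 : ∀ S T : Finset V, S ⊆ T → ∑ x ∈ T, (if x ∈ S then 1 else 0) = S.card := by
    intro S T h
    rw [← Finset.sum_filter, Finset.sum_const, smul_eq_mul, mul_one]
    congr 1
    ext x; simp only [Finset.mem_filter]; exact ⟨fun h => h.2, fun hx => ⟨h hx, hx⟩⟩
  rw [c1 B1 B (Finset.filter_subset _ _), c1 Lf A (Finset.filter_subset _ _),
    c1 Rf A (Finset.filter_subset _ _)]
  calc B1.card * (Lf.card * Rf.card + Rf.card * Lf.card)
      = 2 * (B1.card * Lf.card * Rf.card) := by ring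
    _ ≤ 2 * (2 * t * N ^ 2) := by gcongr
    _ = _ := by ring

end Fam
end SG

namespace SG
open Finset

section Fam
open scoped Classical

variable {V : Type*}

theorem pow4_expand (A : Finset V) (h : V → ℕ) :
    (∑ a ∈ A, h a) ^ 4 = ∑ a0 ∈ A, ∑ a1 ∈ A, ∑ a2 ∈ A, ∑ a3 ∈ A, h a0 * h a1 * h a2 * h a3 := by
  simp only [← Finset.mul_sum, ← Finset.sum_mul]
  ring

theorem lemS_aux {X Y : Set Pt} {x0 y0 : Pt} (hX : Cn X) (hY : Cn Y) (hXY : ∀ x ∈ X, x ∉ Y)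
    (c Z : V → Set Pt) (A B : Finset V) (hc : ∀ a, IsCh X Y (c a))
    (d : ∀ a, Chd X Y x0 y0 (c a)) (hZ : ∀ b ∈ B, Cn (Z b))
    (hZX : ∀ b ∈ B, ∀ x ∈ Z b, x ∉ X) (hZY : ∀ b ∈ B, ∀ x ∈ Z b, x ∉ Y) {t N : ℕ}
    (hA : A.card ≤ N) (hB : B.card ≤ N)
    (nb : ∀ A' ⊆ A, ∀ B' ⊆ B, t ≤ A'.card → t ≤ B'.card → ∃ a ∈ A', ∃ b ∈ B', Z b ∩ c a = ∅) :
    (∑ b ∈ B, ∑ a ∈ A, if (Z b ∩ c a).Nonempty then 1 else 0) ^ 4 ≤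
      N ^ 3 * (12 * t * N ^ 4 + 6 * (CR c A + N) * N ^ 3) := by
  let h : V → V → ℕ := fun b a => if (Z b ∩ c a).Nonempty then 1 else 0
  let E : V → V → ℕ := fun a a' => if (c a ∩ c a').Nonempty then 1 else 0
  let G : V → V → V → V → V → ℕ := fun b a0 a1 a2 a3 =>
    if ((Z b ∩ c a0).Nonempty ∧ (Z b ∩ c a1).Nonempty ∧
      (c a0 ∩ c a2 = ∅) ∧ (c a0 ∩ c a3 = ∅) ∧ (c a1 ∩ c a2 = ∅) ∧ (c a1 ∩ c a3 = ∅) ∧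
      sp (d a0) (d a1) (d a2) (d a3) = 1) then 1 else 0
  have hG : ∀ a0 a1, ∑ b ∈ B, ∑ a2 ∈ A, ∑ a3 ∈ A, G b a0 a1 a2 a3 ≤ 4 * t * N ^ 2 :=
    fun a0 a1 => lemS_pair hX hY hXY c Z A B hc d hZ hZX hZY hA hB nb a0 a1
  have hGs : ∑ b ∈ B, ∑ a0 ∈ A, ∑ a1 ∈ A, ∑ a2 ∈ A, ∑ a3 ∈ A, G b a0 a1 a2 a3 ≤ 4 * t * N ^ 4 := by
    calc _ = ∑ a0 ∈ A, ∑ a1 ∈ A, ∑ b ∈ B, ∑ a2 ∈ A, ∑ a3 ∈ A, G b a0 a1 a2 a3 := by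
          rw [Finset.sum_comm]
          refine Finset.sum_congr rfl fun a0 _ => ?_
          rw [Finset.sum_comm]
      _ ≤ ∑ a0 ∈ A, ∑ a1 ∈ A, 4 * t * N ^ 2 :=
          Finset.sum_le_sum fun a0 _ => Finset.sum_le_sum fun a1 _ => hG a0 a1
      _ = A.card * (A.card * (4 * t * N ^ 2)) := by simp
      _ ≤ N * (N * (4 * t * N ^ 2)) := by gcongr
      _ = _ := by ring
  have hE : ∑ a ∈ A, ∑ a' ∈ A, E a a' ≤ CR c A + N := by
    have e : ∑ a ∈ A, ∑ a' ∈ A, E a a' ≤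
        ((A ×ˢ A).filter (fun x => (c x.1 ∩ c x.2).Nonempty)).card := by
      simp only [Finset.card_filter, Finset.sum_product]
      exact le_rfl
    refine e.trans ?_
    have hsub : ((A ×ˢ A).filter (fun x => (c x.1 ∩ c x.2).Nonempty)) ⊆
      ((A ×ˢ A).filter (fun x => x.1 ≠ x.2 ∧ (c x.1 ∩ c x.2).Nonempty)) ∪ A.image (fun a => (a, a)) := by
      rintro ⟨a, b⟩ hx
      simp only [Finset.mem_filter, Finset.mem_union, Finset.mem_image, Finset.mem_product] at hx ⊢
      by_cases e : a = b
      · right; exact ⟨a, hx.1.1, by rw [e]⟩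
      · left; exact ⟨hx.1, e, hx.2⟩
    refine (Finset.card_le_card hsub).trans ((Finset.card_union_le _ _).trans ?_)
    exact Nat.add_le_add le_rfl (Finset.card_image_le.trans hA)
  have pw : ∀ b a0 a1 a2 a3, h b a0 * h b a1 * h b a2 * h b a3 ≤
      (G b a0 a1 a2 a3 + G b a0 a2 a1 a3 + G b a0 a3 a1 a2) +
      (E a0 a1 + E a0 a2 + E a0 a3 + E a1 a2 + E a1 a3 + E a2 a3) := by
    intro b a0 a1 a2 a3
    by_cases hh : (Z b ∩ c a0).Nonempty ∧ (Z b ∩ c a1).Nonempty ∧ (Z b ∩ c a2).Nonempty ∧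
      (Z b ∩ c a3).Nonempty
    swap
    · have : h b a0 * h b a1 * h b a2 * h b a3 = 0 := by
        simp only [h]
        by_contra hne
        apply hh
        refine ⟨?_, ?_, ?_, ?_⟩ <;> · by_contra h'; simp [h'] at hne
      rw [this]; exact Nat.zero_le _
    obtain ⟨z0, z1, z2, z3⟩ := hh
    have h1 : h b a0 * h b a1 * h b a2 * h b a3 = 1 := by simp [h, z0, z1, z2, z3]
    rw [h1]
    by_cases k01 : (c a0 ∩ c a1).Nonempty
    · have : E a0 a1 = 1 := if_pos k01
      omega
    by_cases k02 : (c a0 ∩ c a2).Nonempty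
    · have : E a0 a2 = 1 := if_pos k02
      omega
    by_cases k03 : (c a0 ∩ c a3).Nonempty
    · have : E a0 a3 = 1 := if_pos k03
      omega
    by_cases k12 : (c a1 ∩ c a2).Nonempty
    · have : E a1 a2 = 1 := if_pos k12
      omega
    by_cases k13 : (c a1 ∩ c a3).Nonempty
    · have : E a1 a3 = 1 := if_pos k13
      omega
    by_cases k23 : (c a2 ∩ c a3).Nonempty
    · have : E a2 a3 = 1 := if_pos k23
      omega
    rw [Set.not_nonempty_iff_eq_empty] at *
    have dj : ∀ {P Q : Set Pt}, P ∩ Q = ∅ → ∀ x ∈ P, x ∉ Q := by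
      intro P Q h x hx hx'
      exact Set.notMem_empty x (h ▸ ⟨hx, hx'⟩)
    have hs := sp_sum hXY (d a0) (d a1) (d a2) (d a3) (hc _) (hc _) (hc _) (dj k12) (dj k13) (dj k23)
    have z3' : ∀ x y z : ZMod 2, x + y + z = 1 → x = 1 ∨ y = 1 ∨ z = 1 := by decide
    have k21 : c a2 ∩ c a1 = ∅ := by rw [Set.inter_comm]; exact k12
    have k31 : c a3 ∩ c a1 = ∅ := by rw [Set.inter_comm]; exact k13
    have k32 : c a3 ∩ c a2 = ∅ := by rw [Set.inter_comm]; exact k23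
    rcases z3' _ _ _ hs with e | e | e
    · have : G b a0 a1 a2 a3 = 1 := if_pos ⟨z0, z1, k02, k03, k12, k13, e⟩
      omega
    · have : G b a0 a2 a1 a3 = 1 := if_pos ⟨z0, z2, k01, k03, k21, k23, e⟩
      omega
    · have : G b a0 a3 a1 a2 = 1 := if_pos ⟨z0, z3, k01, k02, k31, k32, e⟩
      omega
  refine (sum_pow4 B (fun b => ∑ a ∈ A, h b a) N hB).trans ?_
  gcongr
  simp only [pow4_expand]
  refine (Finset.sum_le_sum fun b _ => Finset.sum_le_sum fun a0 _ => Finset.sum_le_sum fun a1 _ =>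
    Finset.sum_le_sum fun a2 _ => Finset.sum_le_sum fun a3 _ => pw b a0 a1 a2 a3).trans ?_
  have hG2 : ∑ b ∈ B, ∑ a0 ∈ A, ∑ a1 ∈ A, ∑ a2 ∈ A, ∑ a3 ∈ A, G b a0 a2 a1 a3 =
      ∑ b ∈ B, ∑ a0 ∈ A, ∑ a1 ∈ A, ∑ a2 ∈ A, ∑ a3 ∈ A, G b a0 a1 a2 a3 := by
    refine Finset.sum_congr rfl fun b _ => Finset.sum_congr rfl fun a0 _ => ?_
    rw [Finset.sum_comm]
  have hG3 : ∑ b ∈ B, ∑ a0 ∈ A, ∑ a1 ∈ A, ∑ a2 ∈ A, ∑ a3 ∈ A, G b a0 a3 a1 a2 =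
      ∑ b ∈ B, ∑ a0 ∈ A, ∑ a1 ∈ A, ∑ a2 ∈ A, ∑ a3 ∈ A, G b a0 a1 a2 a3 := by
    refine Finset.sum_congr rfl fun b _ => Finset.sum_congr rfl fun a0 _ => ?_
    rw [← Finset.sum_comm]
    refine (Finset.sum_congr rfl fun a1 _ => Finset.sum_comm).trans ?_
    rw [Finset.sum_comm]
    refine Finset.sum_congr rfl fun a1 _ => ?_
    rw [Finset.sum_comm]
  simp only [Finset.sum_add_distrib]
  rw [hG2, hG3]
  simp only [Finset.sum_const, smul_eq_mul, ← Finset.mul_sum]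
  set S := ∑ a ∈ A, ∑ a' ∈ A, E a a' with hS
  have hEb : B.card * (A.card * (A.card * S)) ≤ N * (N * (N * (CR c A + N))) := by gcongr
  nlinarith [hGs, hEb]

theorem lemS {X Y : Set Pt} (hX : Cn X) (hY : Cn Y) (hXY : ∀ x ∈ X, x ∉ Y)
    (c Z : V → Set Pt) (A B : Finset V) (hc : ∀ a ∈ A, IsCh X Y (c a)) (hZ : ∀ b ∈ B, Cn (Z b))
    (hZX : ∀ b ∈ B, ∀ x ∈ Z b, x ∉ X) (hZY : ∀ b ∈ B, ∀ x ∈ Z b, x ∉ Y) {t N : ℕ}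
    (hA : A.card ≤ N) (hB : B.card ≤ N)
    (nb : ∀ A' ⊆ A, ∀ B' ⊆ B, t ≤ A'.card → t ≤ B'.card → ∃ a ∈ A', ∃ b ∈ B', Z b ∩ c a = ∅) :
    (∑ b ∈ B, ∑ a ∈ A, if (Z b ∩ c a).Nonempty then 1 else 0) ^ 4 ≤
      N ^ 3 * (12 * t * N ^ 4 + 6 * (CR c A + N) * N ^ 3) := by
  rcases A.eq_empty_or_nonempty with rfl | ⟨b0, hb0⟩
  · simp
  let c' : V → Set Pt := fun i => if i ∈ A then c i else c b0
  have hcc : ∀ b ∈ A, c b = c' b := by intro b hb; simp [c', hb]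
  have hc' : ∀ i, IsCh X Y (c' i) := by
    intro i; by_cases hi : i ∈ A
    · rw [← hcc i hi]; exact hc i hi
    · simp only [c', hi, if_false]; exact hc b0 hb0
  obtain ⟨x0, hx0, _⟩ := (hc b0 hb0).aX
  obtain ⟨y0, hy0, _⟩ := (hc b0 hb0).aY
  have d := fun i => Classical.choice ((hc' i).chd hX hY hx0 hy0)
  have := lemS_aux hX hY hXY c' Z A B hc' d hZ hZX hZY hA hB (by
    intro A' hA' B' hB' h1 h2
    obtain ⟨a, ha, b, hb, e⟩ := nb A' hA' B' hB' h1 h2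
    exact ⟨a, ha, b, hb, by rw [← hcc a (hA' ha)]; exact e⟩)
  rw [CR_congr hcc]
  convert this using 2
  refine Finset.sum_congr rfl fun b _ => Finset.sum_congr rfl fun a ha => ?_
  rw [hcc a ha]

end Fam
end SG

namespace SG
open SimpleGraph

def St (g : ℕ → Pt) : Prop := ∀ i, g i = g (i + 1) ∨ BW.Adj (g i) (g (i + 1))

theorem St.walk {g : ℕ → Pt} (h : St g) (i k : ℕ) :
    ∃ w : BW.Walk (g i) (g (i + k)), ∀ x ∈ w.support, ∃ j, i ≤ j ∧ j ≤ i + k ∧ g j = x := by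
  induction k with
  | zero => exact ⟨.nil, by intro x hx; simp at hx; exact ⟨i, le_rfl, le_rfl, hx.symm⟩⟩
  | succ k ih =>
    obtain ⟨w, hw⟩ := ih
    rcases h (i + k) with e | e
    · refine ⟨w.copy rfl e, ?_⟩
      intro x hx
      rw [Walk.support_copy] at hx
      obtain ⟨j, h1, h2, h3⟩ := hw x hx
      exact ⟨j, h1, by omega, h3⟩
    · refine ⟨w.append (Walk.cons e Walk.nil), ?_⟩
      intro x hx
      rw [Walk.mem_support_append_iff] at hx
      rcases hx with hx | hx
      · obtain ⟨j, h1, h2, h3⟩ := hw x hx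
        exact ⟨j, h1, by omega, h3⟩
      · simp only [Walk.support_cons, Walk.support_nil, List.mem_cons, List.not_mem_nil, or_false] at hx
        rcases hx with rfl | rfl
        · exact ⟨i + k, by omega, by omega, rfl⟩
        · exact ⟨i + (k + 1), by omega, by omega, rfl⟩

theorem St.cn {g : ℕ → Pt} (h : St g) (P : ℕ → Prop)
    (hP : ∀ i j k, P i → P k → i ≤ j → j ≤ k → P j) : Cn {x | ∃ i, P i ∧ g i = x} := by
  have key : ∀ i k, P i → P k → i ≤ k → ∃ w : BW.Walk (g i) (g k),
      ∀ x ∈ w.support, ∃ j, P j ∧ g j = x := by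
    intro i k hi hk hik
    obtain ⟨m, rfl⟩ := Nat.exists_eq_add_of_le hik
    obtain ⟨w, hw⟩ := h.walk i m
    refine ⟨w, fun x hx => ?_⟩
    obtain ⟨j, h1, h2, h3⟩ := hw x hx
    exact ⟨j, hP i j _ hi hk h1 h2, h3⟩
  rintro u ⟨i, hi, rfl⟩ v ⟨k, hk, rfl⟩
  rcases le_total i k with hik | hik
  · exact key i k hi hk hik
  · obtain ⟨w, hw⟩ := key k i hk hi hik
    exact ⟨w.reverse, by simpa using hw⟩

theorem St.cn_range {g : ℕ → Pt} (h : St g) : Cn (Set.range g) := by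
  have := h.cn (fun _ => True) (by simp)
  convert this using 1
  ext x; simp

/-- head of `g` before meeting `T` -/
def hd (g : ℕ → Pt) (T : Set Pt) : Set Pt := {x | ∃ i, (∀ j ≤ i, g j ∉ T) ∧ g i = x}

theorem hd_sub (g : ℕ → Pt) (T : Set Pt) : hd g T ⊆ Set.range g := by
  rintro x ⟨i, _, rfl⟩; exact ⟨i, rfl⟩

theorem hd_dis {g : ℕ → Pt} {T : Set Pt} : ∀ x ∈ hd g T, x ∉ T := by
  rintro x ⟨i, h, rfl⟩; exact h i le_rfl

theorem hd_cn {g : ℕ → Pt} (h : St g) (T : Set Pt) : Cn (hd g T) :=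
  h.cn _ (fun _ _ _ _ hk _ hjk l hl => hk l (hl.trans hjk))

theorem hd_start {g : ℕ → Pt} {T : Set Pt} (h : (hd g T).Nonempty) : g 0 ∈ hd g T := by
  obtain ⟨x, i, hi, _⟩ := h
  exact ⟨0, fun j hj => hi j (by omega), rfl⟩

/-- reparametrized head -/
theorem hd_rep {g : ℕ → Pt} (h : St g) {T : Set Pt} (hne : (hd g T).Nonempty) (hT : ∃ i, g i ∈ T) :
    ∃ g', St g' ∧ Set.range g' = hd g T ∧ ∃ v ∈ T, BW.Adj v (g' 0) := by
  classical
  obtain ⟨x, i, hi, _⟩ := hne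
  set m := Nat.find hT with hm
  have hm1 : g m ∈ T := Nat.find_spec hT
  have hm2 : ∀ j < m, g j ∉ T := fun j hj => Nat.find_min hT hj
  have hm0 : 0 < m := by
    rw [Nat.pos_iff_ne_zero]
    intro e
    rw [e] at hm1
    exact hi 0 (by omega) hm1
  refine ⟨fun i => g (m - 1 - i), ?_, ?_, g m, hm1, ?_⟩
  · intro i
    by_cases hlt : i + 1 ≤ m - 1
    · have e : m - 1 - i = (m - 1 - (i + 1)) + 1 := by omega
      rcases h (m - 1 - (i + 1)) with h' | h'
      · left; simp only; rw [e, ← h']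
      · right; simp only; rw [e]; exact h'.symm
    · left
      have e1 : m - 1 - i = 0 := by omega
      have e2 : m - 1 - (i + 1) = 0 := by omega
      simp only; rw [e1, e2]
  · ext x
    constructor
    · rintro ⟨i, rfl⟩
      exact ⟨m - 1 - i, fun j hj => hm2 j (by omega), rfl⟩
    · rintro ⟨k, hk, rfl⟩
      have : k < m := by
        by_contra hc
        exact hk m (by omega) hm1
      exact ⟨m - 1 - k, by simp only; congr 1; omega⟩
  · simp only [Nat.sub_zero]
    rcases h (m - 1) with h' | h'
    · exfalso
      rw [Nat.sub_add_cancel hm0] at h'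
      exact hm2 (m - 1) (by omega) (h' ▸ hm1)
    · rw [Nat.sub_add_cancel hm0] at h'
      exact h'.symm

theorem hd_adj {g : ℕ → Pt} (h : St g) {T : Set Pt} (hne : (hd g T).Nonempty) (hT : ∃ i, g i ∈ T) :
    ∃ v ∈ T, ∃ u ∈ hd g T, BW.Adj u v := by
  obtain ⟨g', _, h2, v, hv, a⟩ := hd_rep h hne hT
  exact ⟨v, hv, g' 0, h2 ▸ ⟨0, rfl⟩, a.symm⟩

def jc (g : ℕ → Pt) (X Y : Set Pt) (s t : ℕ) : Prop :=
  g s ∈ X ∧ g t ∈ Y ∧ (∀ j < t, g j ∉ Y) ∧ (∀ j, s < j → j < t → g j ∉ X)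

def jn (g : ℕ → Pt) (X Y : Set Pt) : Set Pt :=
  {x | ∃ k, (∃ s t, s < k ∧ k < t ∧ jc g X Y s t) ∧ g k = x}

theorem jc_uniq {g : ℕ → Pt} {X Y : Set Pt} {s t s' t' k k' : ℕ} (h : jc g X Y s t)
    (h' : jc g X Y s' t') (hk : s < k ∧ k < t) (hk' : s' < k' ∧ k' < t') : s = s' ∧ t = t' := by
  have ht : t = t' := by
    rcases lt_trichotomy t t' with e | e | e
    · exact absurd h.2.1 (h'.2.2.1 t e)
    · exact e
    · exact absurd h'.2.1 (h.2.2.1 t' e)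
  subst ht
  refine ⟨?_, rfl⟩
  rcases lt_trichotomy s s' with e | e | e
  · exact absurd h'.1 (h.2.2.2 s' e (by omega))
  · exact e
  · exact absurd h.1 (h'.2.2.2 s e (by omega))

theorem jn_eq {g : ℕ → Pt} {X Y : Set Pt} (hne : (jn g X Y).Nonempty) :
    ∃ s t, s + 1 < t ∧ jc g X Y s t ∧ jn g X Y = {x | ∃ k, (s < k ∧ k < t) ∧ g k = x} := by
  obtain ⟨x, k, ⟨s, t, h1, h2, h3⟩, _⟩ := hne
  refine ⟨s, t, by omega, h3, ?_⟩
  ext y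
  constructor
  · rintro ⟨k', ⟨s', t', h1', h2', h3'⟩, e⟩
    obtain ⟨rfl, rfl⟩ := jc_uniq h3 h3' ⟨h1, h2⟩ ⟨h1', h2'⟩
    exact ⟨k', ⟨h1', h2'⟩, e⟩
  · rintro ⟨k', h', e⟩
    exact ⟨k', ⟨s, t, h'.1, h'.2, h3⟩, e⟩

theorem jn_sub (g : ℕ → Pt) (X Y : Set Pt) : jn g X Y ⊆ Set.range g := by
  rintro x ⟨i, _, rfl⟩; exact ⟨i, rfl⟩

theorem jn_disX {g : ℕ → Pt} {X Y : Set Pt} : ∀ x ∈ jn g X Y, x ∉ X := by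
  rintro x ⟨k, ⟨s, t, h1, h2, h3⟩, rfl⟩; exact h3.2.2.2 k h1 h2

theorem jn_disY {g : ℕ → Pt} {X Y : Set Pt} : ∀ x ∈ jn g X Y, x ∉ Y := by
  rintro x ⟨k, ⟨s, t, h1, h2, h3⟩, rfl⟩; exact h3.2.2.1 k h2

theorem jn_rep {g : ℕ → Pt} (h : St g) {X Y : Set Pt} (hne : (jn g X Y).Nonempty) :
    ∃ g', St g' ∧ Set.range g' = jn g X Y ∧ ∃ v ∈ X, BW.Adj v (g' 0) := by
  obtain ⟨s, t, hst, hj, e⟩ := jn_eq hne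
  refine ⟨fun i => g (min (s + 1 + i) (t - 1)), ?_, ?_, g s, hj.1, ?_⟩
  · intro i
    by_cases hlt : s + 1 + i < t - 1
    · simp only
      rw [min_eq_left (by omega), min_eq_left (by omega)]
      exact h _
    · left
      simp only
      rw [min_eq_right (by omega), min_eq_right (by omega)]
  · rw [e]
    ext x
    constructor
    · rintro ⟨i, rfl⟩
      exact ⟨min (s + 1 + i) (t - 1), by omega, rfl⟩
    · rintro ⟨k, hk, rfl⟩
      exact ⟨k - (s + 1), by simp only; congr 1; omega⟩
  · simp only [add_zero]
    rw [min_eq_left (by omega)]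
    rcases h s with h' | h'
    · exact absurd (h' ▸ hj.1) (hj.2.2.2 (s + 1) (by omega) hst)
    · exact h'

theorem jn_ch {g : ℕ → Pt} (h : St g) {X Y : Set Pt} (hne : (jn g X Y).Nonempty) :
    IsCh X Y (jn g X Y) := by
  have hr := jn_rep h hne
  obtain ⟨s, t, hst, hj, e⟩ := jn_eq hne
  refine ⟨?_, jn_disX, jn_disY, ?_, ?_⟩
  · rw [e]
    exact h.cn _ (fun i j k hi hk h1 h2 => by omega)
  · obtain ⟨g', _, h2, v, hv, a⟩ := hr
    exact ⟨v, hv, g' 0, h2 ▸ ⟨0, rfl⟩, a.symm⟩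
  · refine ⟨g t, hj.2.1, g (t - 1), ?_, ?_⟩
    · rw [e]; exact ⟨t - 1, by omega, rfl⟩
    · have e' : t - 1 + 1 = t := by omega
      rcases h (t - 1) with h' | h'
      · rw [e'] at h'
        exact absurd (h' ▸ hj.2.1) (hj.2.2.1 (t - 1) (by omega))
      · rwa [e'] at h'

theorem triple_aux {g : ℕ → Pt} {X Y Z : Set Pt} (hXZ : X ∩ Z = ∅)
    {t : ℕ} (ht : g t ∈ Y) (ht' : ∀ j < t, g j ∉ Y)
    (hX : ∃ i < t, g i ∈ X) (hZ : ∃ i < t, g i ∈ Z) :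
    (jn g X Y ∩ Z).Nonempty ∨ (jn g Z Y ∩ X).Nonempty := by
  classical
  have last : ∀ S : Set Pt, (∃ i < t, g i ∈ S) → ∃ s < t, g s ∈ S ∧ ∀ j, s < j → j < t → g j ∉ S := by
    intro S hS
    obtain ⟨i, hi, hiS⟩ := hS
    let F := (Finset.range t).filter (fun i => g i ∈ S)
    have hF : F.Nonempty := ⟨i, by simp [F, hi, hiS]⟩
    have hm := F.max'_mem hF
    simp only [F, Finset.mem_filter, Finset.mem_range] at hm
    refine ⟨_, hm.1, hm.2, ?_⟩
    intro j hj hjt hjS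
    have := F.le_max' j (by simp [F, hjt, hjS])
    exact absurd hj (not_lt.2 this)
  obtain ⟨sx, h1, h2, h3⟩ := last X hX
  obtain ⟨sz, k1, k2, k3⟩ := last Z hZ
  rcases lt_trichotomy sx sz with e | e | e
  · left
    exact ⟨g sz, ⟨sz, ⟨sx, t, e, k1, h2, ht, ht', h3⟩, rfl⟩, k2⟩
  · exfalso
    subst e
    have hh : g sx ∈ X ∩ Z := ⟨h2, k2⟩
    rw [hXZ] at hh
    exact hh
  · right
    exact ⟨g sx, ⟨sx, ⟨sz, t, e, h1, k2, ht, ht', k3⟩, rfl⟩, h2⟩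

theorem triple {g : ℕ → Pt} {H1 H2 H3 : Set Pt} (h12 : H1 ∩ H2 = ∅) (h13 : H1 ∩ H3 = ∅)
    (h23 : H2 ∩ H3 = ∅) (v1 : ∃ i, g i ∈ H1) (v2 : ∃ i, g i ∈ H2) (v3 : ∃ i, g i ∈ H3) :
    ((jn g H1 H2 ∩ H3).Nonempty ∨ (jn g H1 H3 ∩ H2).Nonempty) ∨
    ((jn g H2 H1 ∩ H3).Nonempty ∨ (jn g H2 H3 ∩ H1).Nonempty) ∨
    ((jn g H3 H1 ∩ H2).Nonempty ∨ (jn g H3 H2 ∩ H1).Nonempty) := by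
  classical
  have s1 := Nat.find_spec v1
  have s2 := Nat.find_spec v2
  have s3 := Nat.find_spec v3
  have m1 := fun j => Nat.find_min v1 (m := j)
  have m2 := fun j => Nat.find_min v2 (m := j)
  have m3 := fun j => Nat.find_min v3 (m := j)
  set t1 := Nat.find v1
  set t2 := Nat.find v2
  set t3 := Nat.find v3
  have n12 : t1 ≠ t2 := by
    intro e
    have hh : g t1 ∈ H1 ∩ H2 := ⟨s1, by rw [e]; exact s2⟩
    rw [h12] at hh
    exact hh
  have n13 : t1 ≠ t3 := by
    intro e
    have hh : g t1 ∈ H1 ∩ H3 := ⟨s1, by rw [e]; exact s3⟩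
    rw [h13] at hh
    exact hh
  have n23 : t2 ≠ t3 := by
    intro e
    have hh : g t2 ∈ H2 ∩ H3 := ⟨s2, by rw [e]; exact s3⟩
    rw [h23] at hh
    exact hh
  have h31 : H3 ∩ H1 = ∅ := by rw [Set.inter_comm]; exact h13
  by_cases c1 : t2 < t1 ∧ t3 < t1
  · rcases triple_aux h23 s1 m1 ⟨t2, c1.1, s2⟩ ⟨t3, c1.2, s3⟩ with h | h <;> tauto
  by_cases c2 : t1 < t2 ∧ t3 < t2
  · rcases triple_aux h13 s2 m2 ⟨t1, c2.1, s1⟩ ⟨t3, c2.2, s3⟩ with h | h <;> tauto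
  have c3 : t1 < t3 ∧ t2 < t3 := by omega
  rcases triple_aux h12 s3 m3 ⟨t1, c3.1, s1⟩ ⟨t2, c3.2, s2⟩ with h | h <;> tauto

end SG

namespace SG
open Finset

section MM
open scoped Classical

variable {V : Type*}

theorem CR_sum (c : V → Set Pt) (B : Finset V) :
    CR c B = ∑ x ∈ B, (B.filter (fun y => x ≠ y ∧ (c x ∩ c y).Nonempty)).card := by
  unfold CR
  rw [Finset.card_filter, Finset.sum_product]
  apply Finset.sum_congr rfl
  intro x _
  rw [Finset.card_filter]

/-- `b` crosses `α`, and its head before `α` meets `a` -/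
def Qp (g : V → ℕ → Pt) (α a b : V) : Prop :=
  b ≠ α ∧ (Set.range (g b) ∩ Set.range (g α)).Nonempty ∧ b ≠ a ∧
    (hd (g b) (Set.range (g α)) ∩ Set.range (g a)).Nonempty

theorem Q_one (g : V → ℕ → Pt) (U : Finset V) {s : ℕ}
    (hNB : NB (fun b => Set.range (g b)) U s) (b : V) :
    ((U.filter (fun y => b ≠ y ∧ (Set.range (g b) ∩ Set.range (g y)).Nonempty)).card) ^ 2 ≤
      2 * (∑ α ∈ U, ∑ a ∈ U, if Qp g α a b then 1 else 0) +
      s * (U.filter (fun y => b ≠ y ∧ (Set.range (g b) ∩ Set.range (g y)).Nonempty)).card := by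
  set D := U.filter (fun y => b ≠ y ∧ (Set.range (g b) ∩ Set.range (g y)).Nonempty) with hD
  have hDU : D ⊆ U := Finset.filter_subset _ _
  have hDm : ∀ y ∈ D, b ≠ y ∧ (Set.range (g b) ∩ Set.range (g y)).Nonempty :=
    fun y hy => (Finset.mem_filter.1 hy).2
  have hex : ∀ y ∈ D, ∃ i, g b i ∈ Set.range (g y) := by
    intro y hy
    obtain ⟨x, ⟨i, rfl⟩, h⟩ := (hDm y hy).2
    exact ⟨i, h⟩
  let T : V → ℕ := fun y => if h : ∃ i, g b i ∈ Set.range (g y) then Nat.find h else 0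
  have hT : ∀ y ∈ D, g b (T y) ∈ Set.range (g y) ∧ ∀ j < T y, g b j ∉ Set.range (g y) := by
    intro y hy
    have h := hex y hy
    have e : T y = Nat.find h := dif_pos h
    rw [e]
    exact ⟨Nat.find_spec h, fun j hj => Nat.find_min h hj⟩
  have hQ : ∀ α ∈ D, ∀ a ∈ D, T a < T α → Qp g α a b := by
    intro α hα a ha hlt
    refine ⟨(hDm α hα).1, (hDm α hα).2, (hDm a ha).1, g b (T a), ⟨T a, ?_, rfl⟩, (hT a ha).1⟩
    intro j hj
    exact (hT α hα).2 j (by omega)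
  have tie : ∀ α ∈ D, (D.filter (fun a => T a = T α)).card ≤ s := by
    intro α hα
    by_contra hc
    push Not at hc
    obtain ⟨x, hx, y, hy, _, e⟩ := hNB (D.filter (fun a => T a = T α))
      ((Finset.filter_subset _ _).trans hDU) (D.filter (fun a => T a = T α))
      ((Finset.filter_subset _ _).trans hDU) hc.le hc.le
    rw [Finset.mem_filter] at hx hy
    have h1 := (hT x hx.1).1
    have h2 := (hT y hy.1).1
    rw [hx.2] at h1
    rw [hy.2] at h2
    have h3 : g b (T α) ∈ Set.range (g x) ∩ Set.range (g y) := ⟨h1, h2⟩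
    simp only at e
    rw [e] at h3
    exact h3
  calc D.card ^ 2 = ∑ α ∈ D, ∑ a ∈ D, 1 := by simp [sq]
    _ ≤ ∑ α ∈ D, ∑ a ∈ D, ((if Qp g α a b then 1 else 0) + (if Qp g a α b then 1 else 0) +
          (if T a = T α then 1 else 0)) := by
        apply Finset.sum_le_sum; intro α hα
        apply Finset.sum_le_sum; intro a ha
        rcases lt_trichotomy (T a) (T α) with h | h | h
        · rw [if_pos (hQ α hα a ha h)]; omega
        · rw [if_pos h]; omega
        · rw [if_pos (hQ a ha α hα h)]; omega
    _ = (∑ α ∈ D, ∑ a ∈ D, (if Qp g α a b then 1 else 0)) +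
        (∑ α ∈ D, ∑ a ∈ D, (if Qp g a α b then 1 else 0)) +
        ∑ α ∈ D, ∑ a ∈ D, (if T a = T α then 1 else 0) := by
        simp only [Finset.sum_add_distrib]
    _ = 2 * (∑ α ∈ D, ∑ a ∈ D, (if Qp g α a b then 1 else 0)) +
        ∑ α ∈ D, ∑ a ∈ D, (if T a = T α then 1 else 0) := by
        rw [Finset.sum_comm (s := D) (t := D) (f := fun α a => if Qp g a α b then 1 else 0)]
        ring
    _ ≤ 2 * (∑ α ∈ U, ∑ a ∈ U, (if Qp g α a b then 1 else 0)) + s * D.card := by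
        gcongr
        · refine (Finset.sum_le_sum_of_subset hDU).trans ?_
          apply Finset.sum_le_sum; intro α _
          exact Finset.sum_le_sum_of_subset hDU
        · calc _ ≤ ∑ α ∈ D, s := by
                apply Finset.sum_le_sum; intro α hα
                rw [← Finset.card_filter]
                exact tie α hα
            _ = _ := by rw [Finset.sum_const, smul_eq_mul, mul_comm]

theorem Q_total (g : V → ℕ → Pt) (U : Finset V) {s : ℕ}
    (hNB : NB (fun b => Set.range (g b)) U s) :
    (CR (fun b => Set.range (g b)) U) ^ 2 ≤
      U.card * (2 * (∑ α ∈ U, ∑ a ∈ U, ∑ b ∈ U, if Qp g α a b then 1 else 0) +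
        s * CR (fun b => Set.range (g b)) U) := by
  rw [CR_sum]
  refine sq_sum_le_card_mul_sum_sq.trans ?_
  simp only [Nat.cast_id]
  refine Nat.mul_le_mul_left _ ?_
  refine (Finset.sum_le_sum (fun b _ => Q_one g U hNB b)).trans ?_
  rw [Finset.sum_add_distrib, ← Finset.mul_sum, ← Finset.mul_sum]
  have e : (∑ b ∈ U, ∑ α ∈ U, ∑ a ∈ U, if Qp g α a b then 1 else 0) =
    ∑ α ∈ U, ∑ a ∈ U, ∑ b ∈ U, if Qp g α a b then 1 else 0 := by
    rw [Finset.sum_comm]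
    apply Finset.sum_congr rfl; intro α _
    rw [Finset.sum_comm]
  rw [e]

/-- head of `b` before `α` -/
def Hd (g : V → ℕ → Pt) (α b : V) : Set Pt := hd (g b) (Set.range (g α))

def Cr (g : V → ℕ → Pt) (α b : V) : Prop :=
  b ≠ α ∧ (Set.range (g b) ∩ Set.range (g α)).Nonempty

def Ep (g : V → ℕ → Pt) (α b b' : V) : Prop :=
  Cr g α b ∧ Cr g α b' ∧ (Hd g α b ∩ Hd g α b').Nonempty

def Jp (g : V → ℕ → Pt) (α a b1 b2 b3 : V) : Prop :=
  Cr g α b1 ∧ Cr g α b2 ∧ Cr g α b3 ∧ (Hd g α b1).Nonempty ∧ (Hd g α b2).Nonempty ∧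
  Hd g α b1 ∩ Hd g α b2 = ∅ ∧ Hd g α b1 ∩ Hd g α b3 = ∅ ∧ Hd g α b2 ∩ Hd g α b3 = ∅ ∧
  (jn (g a) (Hd g α b1) (Hd g α b2) ∩ Hd g α b3).Nonempty

noncomputable def i01 (p : Prop) : ℕ := if p then 1 else 0

theorem i01_le {p : Prop} {n : ℕ} (h : p → 1 ≤ n) : i01 p ≤ n := by
  unfold i01; split_ifs with hp
  · exact h hp
  · omega

theorem i01_pos {p : Prop} (h : p) : i01 p = 1 := if_pos h

theorem QQQ (g : V → ℕ → Pt) (α a b1 b2 b3 : V) :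
    i01 (Qp g α a b1) * i01 (Qp g α a b2) * i01 (Qp g α a b3) ≤
      i01 (Ep g α b1 b2) + i01 (Ep g α b1 b3) + i01 (Ep g α b2 b3) +
      (i01 (Jp g α a b1 b2 b3) + i01 (Jp g α a b1 b3 b2) + i01 (Jp g α a b2 b1 b3) +
       i01 (Jp g α a b2 b3 b1) + i01 (Jp g α a b3 b1 b2) + i01 (Jp g α a b3 b2 b1)) := by
  by_cases q1 : Qp g α a b1
  swap
  · simp [i01, q1]
  by_cases q2 : Qp g α a b2
  swap
  · simp [i01, q2]
  by_cases q3 : Qp g α a b3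
  swap
  · simp [i01, q3]
  rw [i01_pos q1, i01_pos q2, i01_pos q3]
  have C1 : Cr g α b1 := ⟨q1.1, q1.2.1⟩
  have C2 : Cr g α b2 := ⟨q2.1, q2.2.1⟩
  have C3 : Cr g α b3 := ⟨q3.1, q3.2.1⟩
  by_cases e12 : (Hd g α b1 ∩ Hd g α b2).Nonempty
  · rw [i01_pos (p := Ep g α b1 b2) ⟨C1, C2, e12⟩]; omega
  by_cases e13 : (Hd g α b1 ∩ Hd g α b3).Nonempty
  · rw [i01_pos (p := Ep g α b1 b3) ⟨C1, C3, e13⟩]; omega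
  by_cases e23 : (Hd g α b2 ∩ Hd g α b3).Nonempty
  · rw [i01_pos (p := Ep g α b2 b3) ⟨C2, C3, e23⟩]; omega
  rw [Set.not_nonempty_iff_eq_empty] at e12 e13 e23
  have e21 := e12
  have e31 := e13
  have e32 := e23
  rw [Set.inter_comm] at e21 e31 e32
  have vis : ∀ b, Qp g α a b → (Hd g α b).Nonempty ∧ ∃ i, g a i ∈ Hd g α b := by
    rintro b ⟨_, _, _, x, hx, i, rfl⟩
    exact ⟨⟨_, hx⟩, i, hx⟩
  obtain ⟨n1, v1⟩ := vis b1 q1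
  obtain ⟨n2, v2⟩ := vis b2 q2
  obtain ⟨n3, v3⟩ := vis b3 q3
  rcases triple e12 e13 e23 v1 v2 v3 with (h | h) | (h | h) | (h | h)
  · rw [i01_pos (p := Jp g α a b1 b2 b3) ⟨C1, C2, C3, n1, n2, e12, e13, e23, h⟩]; omega
  · rw [i01_pos (p := Jp g α a b1 b3 b2) ⟨C1, C3, C2, n1, n3, e13, e12, e32, h⟩]; omega
  · rw [i01_pos (p := Jp g α a b2 b1 b3) ⟨C2, C1, C3, n2, n1, e21, e23, e13, h⟩]; omega
  · rw [i01_pos (p := Jp g α a b2 b3 b1) ⟨C2, C3, C1, n2, n3, e23, e21, e31, h⟩]; omega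
  · rw [i01_pos (p := Jp g α a b3 b1 b2) ⟨C3, C1, C2, n3, n1, e31, e32, e12, h⟩]; omega
  · rw [i01_pos (p := Jp g α a b3 b2 b1) ⟨C3, C2, C1, n3, n2, e32, e31, e21, h⟩]; omega

theorem cube_sum (U : Finset V) (f : V → ℕ) :
    (∑ b ∈ U, f b) ^ 3 = ∑ b1 ∈ U, ∑ b2 ∈ U, ∑ b3 ∈ U, f b1 * f b2 * f b3 := by
  rw [pow_succ, sq, Finset.sum_mul_sum, Finset.sum_mul]
  apply Finset.sum_congr rfl; intro b1 _
  rw [Finset.sum_mul]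
  apply Finset.sum_congr rfl; intro b2 _
  rw [Finset.mul_sum]

theorem perm_sums (U : Finset V) (F : V → V → V → ℕ) :
    (∑ b1 ∈ U, ∑ b2 ∈ U, ∑ b3 ∈ U, (F b1 b2 b3 + F b1 b3 b2 + F b2 b1 b3 + F b2 b3 b1 +
      F b3 b1 b2 + F b3 b2 b1)) = 6 * ∑ b1 ∈ U, ∑ b2 ∈ U, ∑ b3 ∈ U, F b1 b2 b3 := by
  have h1 : ∀ G : V → V → V → ℕ, (∑ b1 ∈ U, ∑ b2 ∈ U, ∑ b3 ∈ U, G b1 b3 b2) =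
      ∑ b1 ∈ U, ∑ b2 ∈ U, ∑ b3 ∈ U, G b1 b2 b3 := by
    intro G
    apply Finset.sum_congr rfl; intro b1 _
    rw [Finset.sum_comm]
  have h2 : ∀ G : V → V → V → ℕ, (∑ b1 ∈ U, ∑ b2 ∈ U, ∑ b3 ∈ U, G b2 b1 b3) =
      ∑ b1 ∈ U, ∑ b2 ∈ U, ∑ b3 ∈ U, G b1 b2 b3 := by
    intro G
    rw [Finset.sum_comm]
  simp only [Finset.sum_add_distrib]
  rw [h1 F, h2 F]
  have e4 := h2 (fun x y z => F x z y)
  have e5 := h1 (fun x y z => F y x z)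
  have e6 := h1 (fun x y z => F y z x)
  rw [e4, e5, e6, e4, h2 F, h1 F]
  ring

theorem E_sum (g : V → ℕ → Pt) (U : Finset V) (α : V) :
    ∑ b ∈ U, ∑ b' ∈ U, i01 (Ep g α b b') ≤
      CR (Hd g α) (U.filter (fun b => Cr g α b ∧ (Hd g α b).Nonempty)) + U.card := by
  set D := U.filter (fun b => Cr g α b ∧ (Hd g α b).Nonempty) with hD
  calc ∑ b ∈ U, ∑ b' ∈ U, i01 (Ep g α b b')
      ≤ ∑ b ∈ U, ∑ b' ∈ U, (i01 ((b ∈ D ∧ b' ∈ D) ∧ (b ≠ b' ∧ (Hd g α b ∩ Hd g α b').Nonempty)) +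
          i01 (b = b')) := by
        apply Finset.sum_le_sum; intro b hb
        apply Finset.sum_le_sum; intro b' hb'
        apply i01_le
        rintro ⟨c1, c2, x, h1, h2⟩
        by_cases e : b = b'
        · rw [i01_pos e]; omega
        · rw [i01_pos (p := (b ∈ D ∧ b' ∈ D) ∧ _)]
          · omega
          · exact ⟨⟨by rw [hD, Finset.mem_filter]; exact ⟨hb, c1, x, h1⟩,
              by rw [hD, Finset.mem_filter]; exact ⟨hb', c2, x, h2⟩⟩, e, x, h1, h2⟩
    _ = (∑ b ∈ U, ∑ b' ∈ U, i01 ((b ∈ D ∧ b' ∈ D) ∧ (b ≠ b' ∧ (Hd g α b ∩ Hd g α b').Nonempty))) +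
        ∑ b ∈ U, ∑ b' ∈ U, i01 (b = b') := by simp only [Finset.sum_add_distrib]
    _ ≤ _ := by
        gcongr
        · unfold CR i01
          rw [Finset.card_filter, Finset.sum_product]
          have hDU : D ⊆ U := Finset.filter_subset _ _
          rw [← Finset.sum_subset hDU]
          · apply Finset.sum_le_sum; intro b hb
            rw [← Finset.sum_subset hDU]
            · apply Finset.sum_le_sum; intro b' hb'
              simp [hb, hb']
            · intro x _ hx; simp [hx]
          · intro x _ hx; simp [hx]
        · rw [Finset.card_eq_sum_ones]
          apply Finset.sum_le_sum; intro b hb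
          unfold i01
          simp [hb]

theorem Q_cube (g : V → ℕ → Pt) (U : Finset V) :
    (∑ α ∈ U, ∑ a ∈ U, ∑ b ∈ U, i01 (Qp g α a b)) ^ 3 ≤
      U.card ^ 4 * (3 * (U.card ^ 2 * ∑ α ∈ U, ∑ b ∈ U, ∑ b' ∈ U, i01 (Ep g α b b')) +
        6 * ∑ α ∈ U, ∑ a ∈ U, ∑ b1 ∈ U, ∑ b2 ∈ U, ∑ b3 ∈ U, i01 (Jp g α a b1 b2 b3)) := by
  have h0 : (∑ p ∈ U ×ˢ U, ∑ b ∈ U, i01 (Qp g p.1 p.2 b)) ^ 3 ≤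
      (U ×ˢ U).card ^ 2 * ∑ p ∈ U ×ˢ U, (∑ b ∈ U, i01 (Qp g p.1 p.2 b)) ^ 3 :=
    pow_sum_le_card_mul_sum_pow (fun _ _ => Nat.zero_le _) 2
  rw [Finset.sum_product, Finset.sum_product, Finset.card_product] at h0
  refine h0.trans ?_
  rw [show (U.card * U.card) ^ 2 = U.card ^ 4 by ring]
  refine Nat.mul_le_mul_left _ ?_
  calc ∑ α ∈ U, ∑ a ∈ U, (∑ b ∈ U, i01 (Qp g α a b)) ^ 3
      ≤ ∑ α ∈ U, ∑ a ∈ U, ∑ b1 ∈ U, ∑ b2 ∈ U, ∑ b3 ∈ U, (i01 (Ep g α b1 b2) + i01 (Ep g α b1 b3) +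
       i01 (Ep g α b2 b3) +
      (i01 (Jp g α a b1 b2 b3) + i01 (Jp g α a b1 b3 b2) + i01 (Jp g α a b2 b1 b3) +
       i01 (Jp g α a b2 b3 b1) + i01 (Jp g α a b3 b1 b2) + i01 (Jp g α a b3 b2 b1))) := by
        apply Finset.sum_le_sum; intro α _
        apply Finset.sum_le_sum; intro a _
        rw [cube_sum]
        apply Finset.sum_le_sum; intro b1 _
        apply Finset.sum_le_sum; intro b2 _
        apply Finset.sum_le_sum; intro b3 _
        exact QQQ g α a b1 b2 b3
    _ = ∑ α ∈ U, ∑ a ∈ U, (3 * (U.card * ∑ b ∈ U, ∑ b' ∈ U, i01 (Ep g α b b')) +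
          6 * ∑ b1 ∈ U, ∑ b2 ∈ U, ∑ b3 ∈ U, i01 (Jp g α a b1 b2 b3)) := by
        apply Finset.sum_congr rfl; intro α _
        apply Finset.sum_congr rfl; intro a _
        rw [← perm_sums U (fun x y z => i01 (Jp g α a x y z))]
        have e1 : ∑ b1 ∈ U, ∑ b2 ∈ U, ∑ b3 ∈ U, i01 (Ep g α b1 b2) =
            U.card * ∑ b ∈ U, ∑ b' ∈ U, i01 (Ep g α b b') := by
          simp only [Finset.sum_const, smul_eq_mul, Finset.mul_sum]
        have e2 : ∑ b1 ∈ U, ∑ b2 ∈ U, ∑ b3 ∈ U, i01 (Ep g α b1 b3) =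
            U.card * ∑ b ∈ U, ∑ b' ∈ U, i01 (Ep g α b b') := by
          simp only [Finset.sum_const, smul_eq_mul, Finset.mul_sum]
        have e3 : ∑ b1 ∈ U, ∑ b2 ∈ U, ∑ b3 ∈ U, i01 (Ep g α b2 b3) =
            U.card * ∑ b ∈ U, ∑ b' ∈ U, i01 (Ep g α b b') := by
          simp only [Finset.sum_const, smul_eq_mul]
        simp only [Finset.sum_add_distrib]
        rw [e1, e2, e3]
        ring
    _ = _ := by
        simp only [Finset.sum_add_distrib, Finset.sum_const, smul_eq_mul, Finset.mul_sum]
        congr 1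
        apply Finset.sum_congr rfl; intro α _
        apply Finset.sum_congr rfl; intro a _
        apply Finset.sum_congr rfl; intro b1 _
        ring

theorem J_pair (g : V → ℕ → Pt) (U : Finset V) (hg : ∀ v ∈ U, St (g v)) {s N : ℕ} (hN : U.card ≤ N)
    (hNB : NB (fun b => Set.range (g b)) U s) {α b1 b2 : V} (h1 : b1 ∈ U) (h2 : b2 ∈ U) :
    (∑ a ∈ U, ∑ b3 ∈ U, i01 (Jp g α a b1 b2 b3)) ^ 4 ≤ N ^ 3 * (12 * s * N ^ 4 +
      6 * (CR (fun a => jn (g a) (Hd g α b1) (Hd g α b2))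
        (U.filter (fun a => (jn (g a) (Hd g α b1) (Hd g α b2)).Nonempty)) + N) * N ^ 3) := by
  by_cases hd12 : Hd g α b1 ∩ Hd g α b2 = ∅
  swap
  · have : ∀ a b3, i01 (Jp g α a b1 b2 b3) = 0 := by
      intro a b3
      unfold i01; rw [if_neg]
      intro h
      exact hd12 h.2.2.2.2.2.1
    simp [this]
  have dis : ∀ {P Q : Set Pt}, P ∩ Q = ∅ → ∀ x ∈ Q, x ∉ P := by
    intro P Q h x hx hx'
    have : x ∈ P ∩ Q := ⟨hx', hx⟩
    rw [h] at this
    exact this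
  set A := U.filter (fun a => (jn (g a) (Hd g α b1) (Hd g α b2)).Nonempty) with hA
  set B := U.filter (fun b => Hd g α b1 ∩ Hd g α b = ∅ ∧ Hd g α b2 ∩ Hd g α b = ∅) with hB
  have hAU : A ⊆ U := Finset.filter_subset _ _
  have hBU : B ⊆ U := Finset.filter_subset _ _
  have key := lemS (X := Hd g α b1) (Y := Hd g α b2) (hd_cn (hg _ h1) _) (hd_cn (hg _ h2) _)
    (dis (by rw [Set.inter_comm]; exact hd12)) (fun a => jn (g a) (Hd g α b1) (Hd g α b2)) (Hd g α) A B
    (fun a ha => jn_ch (hg a (hAU ha)) (Finset.mem_filter.1 ha).2)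
    (fun b hb => hd_cn (hg b (hBU hb)) _)
    (fun b hb => dis (Finset.mem_filter.1 hb).2.1)
    (fun b hb => dis (Finset.mem_filter.1 hb).2.2)
    (t := s) (N := N) ((Finset.card_le_card hAU).trans hN) ((Finset.card_le_card hBU).trans hN)
    (by
      intro A' hA' B' hB' h1 h2
      obtain ⟨a, ha, b, hb, _, e⟩ := hNB A' (hA'.trans hAU) B' (hB'.trans hBU) h1 h2
      refine ⟨a, ha, b, hb, ?_⟩
      apply Set.eq_empty_of_subset_empty
      rw [← e, Set.inter_comm]
      exact Set.inter_subset_inter (jn_sub _ _ _) (hd_sub _ _))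
  refine le_trans ?_ key
  apply Nat.pow_le_pow_left
  calc ∑ a ∈ U, ∑ b3 ∈ U, i01 (Jp g α a b1 b2 b3)
      = ∑ b3 ∈ U, ∑ a ∈ U, i01 (Jp g α a b1 b2 b3) := Finset.sum_comm
    _ = ∑ b3 ∈ B, ∑ a ∈ A, i01 (Jp g α a b1 b2 b3) := by
        rw [← Finset.sum_subset hBU]
        · apply Finset.sum_congr rfl; intro b3 hb3
          rw [← Finset.sum_subset hAU]
          intro a ha ha'
          unfold i01; rw [if_neg]
          intro h
          apply ha'
          rw [hA, Finset.mem_filter]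
          exact ⟨ha, h.2.2.2.2.2.2.2.2.left⟩
        · intro b hb hb'
          apply Finset.sum_eq_zero
          intro a _
          unfold i01; rw [if_neg]
          intro h
          apply hb'
          rw [hB, Finset.mem_filter]
          exact ⟨hb, h.2.2.2.2.2.2.1, h.2.2.2.2.2.2.2.1⟩
    _ ≤ _ := by
        apply Finset.sum_le_sum; intro b _
        apply Finset.sum_le_sum; intro a _
        apply i01_le
        intro h
        rw [if_pos]
        rw [Set.inter_comm]
        exact h.2.2.2.2.2.2.2.2

end MM
end SG

namespace SG
open Finset

section MM
open scoped Classical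

variable {V : Type*}

theorem arith1 {ε N C Q s : ℝ} (hε : 0 < ε) (hN : 0 < N) (hC : ε * N ^ 2 ≤ C) (hs : 2 * s ≤ ε * N)
    (h : C ^ 2 ≤ N * (2 * Q + s * C)) : ε ^ 2 * N ^ 3 / 4 ≤ Q := by
  have h1 : s * N ≤ ε * N ^ 2 / 2 := by nlinarith
  have h2 : ε * N ^ 2 * (ε * N ^ 2 / 2) ≤ C * (C - s * N) := by
    apply mul_le_mul hC (by linarith) (by positivity)
    have : 0 < ε * N ^ 2 := by positivity
    linarith
  have h3 : N * (ε ^ 2 * N ^ 3 / 4) ≤ N * Q := by nlinarith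
  exact le_of_mul_le_mul_left h3 hN

theorem arith2 {ε η N Q E J : ℝ} (hε : 0 < ε) (hN : 0 < N) (hη : 768 * η ≤ ε ^ 6)
    (hQ : ε ^ 2 * N ^ 3 / 4 ≤ Q) (hE : E ≤ 2 * η * N ^ 3)
    (h : Q ^ 3 ≤ N ^ 4 * (3 * (N ^ 2 * E) + 6 * J)) : ε ^ 6 / 768 * N ^ 5 ≤ J := by
  have h1 : (ε ^ 2 * N ^ 3 / 4) ^ 3 ≤ N ^ 4 * (3 * (N ^ 2 * (2 * η * N ^ 3)) + 6 * J) := by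
    refine (pow_le_pow_left₀ (by positivity) hQ 3).trans (h.trans ?_)
    gcongr
  have h2 : N ^ 4 * (ε ^ 6 * N ^ 5 / 64) ≤ N ^ 4 * (6 * η * N ^ 5 + 6 * J) := by
    calc _ = (ε ^ 2 * N ^ 3 / 4) ^ 3 := by ring
      _ ≤ _ := h1
      _ = _ := by ring
  have h3 := le_of_mul_le_mul_left h2 (by positivity)
  have h4 : 768 * η * N ^ 5 ≤ ε ^ 6 * N ^ 5 := by gcongr
  linarith

theorem arith3 {ε η N j c s : ℝ} (hε : 0 < ε) (hN : 0 < N) (hη : 10 ^ 14 * η = ε ^ 24)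
    (hs1 : 1 ≤ s) (hs : s ≤ η * N) (hj : ε ^ 6 / 768 * N ^ 2 ≤ j)
    (h : j ^ 4 ≤ N ^ 3 * (12 * s * N ^ 4 + 6 * (c + N) * N ^ 3)) : η * N ^ 2 ≤ c := by
  have h1 : (ε ^ 6 / 768 * N ^ 2) ^ 4 ≤ N ^ 3 * (12 * s * N ^ 4 + 6 * (c + N) * N ^ 3) :=
    (pow_le_pow_left₀ (by positivity) hj 4).trans h
  have h2 : N ^ 6 * (ε ^ 24 / 768 ^ 4 * N ^ 2) ≤ N ^ 6 * (12 * s * N + 6 * c + 6 * N) := by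
    calc _ = (ε ^ 6 / 768 * N ^ 2) ^ 4 := by ring
      _ ≤ _ := h1
      _ = _ := by ring
  have h3 := le_of_mul_le_mul_left h2 (by positivity)
  have h4 : s * N ≤ η * N * N := by gcongr
  have h5 : N ≤ s * N := by nlinarith
  rw [← hη] at h3
  have h6 : 0 ≤ η * N ^ 2 := by
    have : 0 < η := by
      have : 0 < ε ^ 24 := by positivity
      linarith
    positivity
  have h7 : 200 * (η * N ^ 2) ≤ 10 ^ 14 * η / 768 ^ 4 * N ^ 2 := by
    have : 10 ^ 14 * η / 768 ^ 4 * N ^ 2 = (10 ^ 14 / 768 ^ 4) * (η * N ^ 2) := by ring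
    rw [this]
    gcongr
    norm_num
  nlinarith

theorem lemM (g : V → ℕ → Pt) (U : Finset V) (hg : ∀ v ∈ U, St (g v)) {s N : ℕ} (hN : U.card ≤ N)
    (hNB : NB (fun b => Set.range (g b)) U s) (hs : 1 ≤ s) {ε : ℝ} (hε : 0 < ε) (hε1 : ε ≤ 1)
    (hCR : ε * N ^ 2 ≤ CR (fun b => Set.range (g b)) U) (hsm : 10 ^ 14 * (s : ℝ) ≤ ε ^ 24 * N) :
    (∃ α ∈ U, ∃ D ⊆ U, (∀ b ∈ D, Cr g α b ∧ (Hd g α b).Nonempty) ∧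
      ε ^ 24 / 10 ^ 14 * N ^ 2 ≤ CR (Hd g α) D) ∨
    (∃ α ∈ U, ∃ b1 ∈ U, ∃ b2 ∈ U, Cr g α b1 ∧ Cr g α b2 ∧ (Hd g α b1).Nonempty ∧
      (Hd g α b2).Nonempty ∧ Hd g α b1 ∩ Hd g α b2 = ∅ ∧ ∃ A ⊆ U,
      (∀ a ∈ A, (jn (g a) (Hd g α b1) (Hd g α b2)).Nonempty) ∧
      ε ^ 24 / 10 ^ 14 * N ^ 2 ≤ CR (fun a => jn (g a) (Hd g α b1) (Hd g α b2)) A) := by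
  set η := ε ^ 24 / 10 ^ 14 with hη
  have hη0 : 0 < η := by positivity
  have hs1 : (1 : ℝ) ≤ s := by exact_mod_cast hs
  have hN0 : (0 : ℝ) < N := by
    have : 0 < ε ^ 24 * N := by linarith
    exact pos_of_mul_pos_right this (by positivity)
  have hnN : (U.card : ℝ) ≤ N := by exact_mod_cast hN
  have hsη : (s : ℝ) ≤ η * N := by
    rw [hη]; rw [div_mul_eq_mul_div, le_div_iff₀ (by positivity)]; linarith
  by_contra hcon
  push Not at hcon
  obtain ⟨hM1, hM2⟩ := hcon
  have q0 := Q_total g U hNB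
  change _ ≤ U.card * (2 * (∑ α ∈ U, ∑ a ∈ U, ∑ b ∈ U, i01 (Qp g α a b)) + _) at q0
  have q1 := Q_cube g U
  set Q := ∑ α ∈ U, ∑ a ∈ U, ∑ b ∈ U, i01 (Qp g α a b) with hQ
  set E := ∑ α ∈ U, ∑ b ∈ U, ∑ b' ∈ U, i01 (Ep g α b b') with hE
  set J := ∑ α ∈ U, ∑ a ∈ U, ∑ b1 ∈ U, ∑ b2 ∈ U, ∑ b3 ∈ U, i01 (Jp g α a b1 b2 b3) with hJ
  set C := CR (fun b => Set.range (g b)) U with hC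
  have r0 : (C : ℝ) ^ 2 ≤ N * (2 * Q + s * C) := by
    have : C ^ 2 ≤ N * (2 * Q + s * C) := q0.trans (Nat.mul_le_mul_right _ hN)
    exact_mod_cast this
  have r1 : (Q : ℝ) ^ 3 ≤ N ^ 4 * (3 * (N ^ 2 * E) + 6 * J) := by
    have : Q ^ 3 ≤ N ^ 4 * (3 * (N ^ 2 * E) + 6 * J) := q1.trans (by gcongr)
    exact_mod_cast this
  have hp1 : ε ^ 24 ≤ ε := by
    calc ε ^ 24 ≤ ε ^ 1 := pow_le_pow_of_le_one hε.le hε1 (by norm_num)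
      _ = ε := pow_one _
  have hp6 : ε ^ 24 ≤ ε ^ 6 := pow_le_pow_of_le_one hε.le hε1 (by norm_num)
  have r2 : ε ^ 2 * (N : ℝ) ^ 3 / 4 ≤ Q := by
    refine arith1 hε hN0 hCR ?_ r0
    have : ε ^ 24 * N ≤ ε * N := by gcongr
    linarith
  have hE2 : (E : ℝ) ≤ 2 * η * N ^ 3 := by
    have h1 : (E : ℝ) ≤ ∑ α ∈ U, (η * N ^ 2 + N) := by
      rw [hE, Nat.cast_sum]
      apply Finset.sum_le_sum
      intro α hα
      have h2 := E_sum g U α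
      have h3 := hM1 α hα (U.filter (fun b => Cr g α b ∧ (Hd g α b).Nonempty))
        (Finset.filter_subset _ _) (fun b hb => (Finset.mem_filter.1 hb).2)
      have h4 : ((∑ b ∈ U, ∑ b' ∈ U, i01 (Ep g α b b') : ℕ) : ℝ) ≤
        (CR (Hd g α) (U.filter (fun b => Cr g α b ∧ (Hd g α b).Nonempty)) : ℝ) + U.card := by
        exact_mod_cast h2
      linarith
    rw [Finset.sum_const, nsmul_eq_mul] at h1
    have h5 : (N : ℝ) ≤ η * N ^ 2 := by nlinarith
    calc (E : ℝ) ≤ U.card * (η * N ^ 2 + N) := h1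
      _ ≤ N * (η * N ^ 2 + η * N ^ 2) := by gcongr
      _ = _ := by ring
  have r3 : ε ^ 6 / 768 * (N : ℝ) ^ 5 ≤ J := by
    refine arith2 hε hN0 ?_ r2 hE2 r1
    rw [hη]
    have : 0 < ε ^ 24 := by positivity
    linarith
  -- pigeonhole
  have hJ' : J = ∑ p ∈ U ×ˢ U ×ˢ U, ∑ a ∈ U, ∑ b3 ∈ U, i01 (Jp g p.1 a p.2.1 p.2.2 b3) := by
    rw [hJ, Finset.sum_product]
    apply Finset.sum_congr rfl; intro α _
    rw [Finset.sum_product, Finset.sum_comm]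
    apply Finset.sum_congr rfl; intro b1 _
    rw [Finset.sum_comm]
  have hUne : U.Nonempty := by
    by_contra hne
    rw [Finset.not_nonempty_iff_eq_empty] at hne
    rw [hJ, hne] at r3
    simp only [Finset.sum_empty, Nat.cast_zero] at r3
    have : 0 < ε ^ 6 / 768 * (N : ℝ) ^ 5 := by positivity
    linarith
  have pg : ∃ p ∈ U ×ˢ U ×ˢ U, ε ^ 6 / 768 * (N : ℝ) ^ 2 ≤
      ((∑ a ∈ U, ∑ b3 ∈ U, i01 (Jp g p.1 a p.2.1 p.2.2 b3) : ℕ) : ℝ) := by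
    by_contra hc
    push Not at hc
    have h1 : (J : ℝ) < ∑ p ∈ U ×ˢ U ×ˢ U, ε ^ 6 / 768 * (N : ℝ) ^ 2 := by
      rw [hJ', Nat.cast_sum]
      exact Finset.sum_lt_sum_of_nonempty (hUne.product (hUne.product hUne)) hc
    rw [Finset.sum_const, nsmul_eq_mul, Finset.card_product, Finset.card_product] at h1
    push_cast at h1
    have h2 : (U.card : ℝ) * (U.card * U.card) * (ε ^ 6 / 768 * (N : ℝ) ^ 2) ≤
      N * (N * N) * (ε ^ 6 / 768 * (N : ℝ) ^ 2) := by gcongr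
    have h3 : (N : ℝ) * (N * N) * (ε ^ 6 / 768 * (N : ℝ) ^ 2) = ε ^ 6 / 768 * (N : ℝ) ^ 5 := by ring
    linarith
  obtain ⟨⟨α, b1, b2⟩, hp, hj⟩ := pg
  simp only [Finset.mem_product] at hp
  obtain ⟨hα, h1, h2⟩ := hp
  simp only at hj
  have jp := J_pair g U hg hN hNB (α := α) h1 h2
  have pos : (0 : ℝ) < ((∑ a ∈ U, ∑ b3 ∈ U, i01 (Jp g α a b1 b2 b3) : ℕ) : ℝ) := by
    refine lt_of_lt_of_le ?_ hj
    positivity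
  have exJ : ∃ a b3, Jp g α a b1 b2 b3 := by
    by_contra hc
    push Not at hc
    have : ∀ a b3, i01 (Jp g α a b1 b2 b3) = 0 := fun a b3 => if_neg (hc a b3)
    simp [this] at pos
  obtain ⟨_, _, c1, c2, _, n1, n2, d12, _⟩ := exJ
  have fin := hM2 α hα b1 h1 b2 h2 c1 c2 n1 n2 d12 _ (Finset.filter_subset _ _)
    (fun a ha => (Finset.mem_filter.1 ha).2)
  have := arith3 (η := η) hε hN0 (by rw [hη]; field_simp) hs1 hsη hj
    (c := (CR (fun a => jn (g a) (Hd g α b1) (Hd g α b2))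
        (U.filter (fun a => (jn (g a) (Hd g α b1) (Hd g α b2)).Nonempty)) : ℕ)) (by exact_mod_cast jp)
  linarith

end MM
end SG

namespace SG
open Finset SimpleGraph

section DD
open scoped Classical

variable {V : Type*}

theorem dens_strip {X Y : Set Pt} {x0 y0 w0 : Pt} (T : Strip X Y x0 y0 w0) (c : V → Set Pt)
    (B : Finset V) (hc : ∀ i ∈ B, IsCh X Y (c i)) (hK : ∀ i ∈ B, ∀ x ∈ T.K.support, x ∉ c i)
    {s L N : ℕ} (hs : 1 ≤ s) (hBN : B.card ≤ N) (hL : N ≤ 2 ^ L) (hNB : NB c B s)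
    {η : ℝ} (hη : 0 < η) (hη1 : η ≤ 1) (hCR : η * N ^ 2 ≤ CR c B)
    (hsm : 256 * (s * (L + 1)) ≤ η ^ 2 * N) : False := by
  have hs1 : (1 : ℝ) ≤ s := by exact_mod_cast hs
  have hL1 : (1 : ℝ) ≤ (L : ℝ) + 1 := by
    have : (0 : ℝ) ≤ L := Nat.cast_nonneg _
    linarith
  have hsL : (s : ℝ) ≤ s * (L + 1) := by nlinarith
  have hη2 : η ^ 2 ≤ η := by nlinarith
  have hN0 : (0 : ℝ) < N := by
    have : 0 < η ^ 2 * N := by linarith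
    exact pos_of_mul_pos_right this (by positivity)
  have hsm' : 256 * ((s : ℝ) * (L + 1)) ≤ η * N := by
    have : η ^ 2 * N ≤ η * N := by gcongr
    linarith
  set β := ⌊η * N / 16⌋₊ with hβ
  have b1 : (β : ℝ) ≤ η * N / 16 := Nat.floor_le (by positivity)
  have b2 : η * N / 16 < β + 1 := Nat.lt_floor_add_one _
  have b3 : η * N / 32 ≤ β := by linarith
  have b0 : (0 : ℝ) < β := lt_of_lt_of_le (by positivity) b3
  have hβ3 : 3 * s * (L + 1) ≤ β := by
    rw [hβ]
    apply Nat.le_floor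
    push_cast
    linarith
  have key := lemI T c B hc hK hs (hBN.trans hL) hβ3 hNB
  have kr : (CR c B : ℝ) ≤ 2 * (B.card * (((B.card / β : ℕ) + 1) * s + 2 * β + s)) := by
    exact_mod_cast key
  have d1 : ((B.card / β : ℕ) : ℝ) ≤ 32 / η := by
    calc ((B.card / β : ℕ) : ℝ) ≤ (B.card : ℝ) / β := Nat.cast_div_le
      _ ≤ N / (η * N / 32) := by
          have : (B.card : ℝ) ≤ N := by exact_mod_cast hBN
          gcongr
      _ = 32 / η := by field_simp
  have d2 : 32 / η * s ≤ η * N / 8 := by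
    rw [div_mul_eq_mul_div, div_le_iff₀ hη]
    nlinarith
  have d3 : ((B.card / β : ℕ) : ℝ) * s ≤ η * N / 8 :=
    (mul_le_mul_of_nonneg_right d1 (by linarith)).trans d2
  have d4 : (((B.card / β : ℕ) : ℝ) + 1) * s + 2 * β + s ≤ 3 * (η * N / 8) := by
    nlinarith
  have d5 : (CR c B : ℝ) ≤ 2 * (N * (3 * (η * N / 8))) := by
    refine kr.trans ?_
    have : (B.card : ℝ) ≤ N := by exact_mod_cast hBN
    gcongr
  have : 0 < η * (N : ℝ) ^ 2 := by positivity
  nlinarith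

theorem inter_dis {P Q : Set Pt} (h : P ∩ Q = ∅) : ∀ x ∈ P, x ∉ Q := by
  intro x hx hx'
  have : x ∈ P ∩ Q := ⟨hx, hx'⟩
  rw [h] at this
  exact this

theorem grounded {S0 : Set Pt} (hS0 : Cn S0) (g : V → ℕ → Pt) (U : Finset V)
    (hg : ∀ v ∈ U, St (g v)) (hav : ∀ v ∈ U, ∀ x ∈ Set.range (g v), x ∉ S0)
    (hgr : ∀ v ∈ U, ∃ u ∈ S0, BW.Adj u (g v 0)) {s N L : ℕ} (hN : U.card ≤ N) (hL : N ≤ 2 ^ L)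
    (hNB : NB (fun b => Set.range (g b)) U s) (hs : 1 ≤ s) {ε : ℝ} (hε : 0 < ε) (hε1 : ε ≤ 1)
    (hCR : ε * N ^ 2 ≤ CR (fun b => Set.range (g b)) U)
    (hsm : 256 * 10 ^ 28 * ((s : ℝ) * (L + 1)) ≤ ε ^ 48 * N) : False := by
  have hsL : (s : ℝ) ≤ s * (L + 1) := by
    have h1 : (0 : ℝ) ≤ L := Nat.cast_nonneg _
    have h2 : (0 : ℝ) ≤ s := Nat.cast_nonneg _
    nlinarith
  have hs0 : (0 : ℝ) ≤ s := Nat.cast_nonneg _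
  have hp : ε ^ 48 ≤ ε ^ 24 := pow_le_pow_of_le_one hε.le hε1 (by norm_num)
  have hη1 : ε ^ 24 / 10 ^ 14 ≤ 1 := by
    rw [div_le_one (by positivity)]
    have : ε ^ 24 ≤ 1 := pow_le_one₀ hε.le hε1
    linarith
  have hη2 : 256 * ((s : ℝ) * (L + 1)) ≤ (ε ^ 24 / 10 ^ 14) ^ 2 * N := by
    have : (ε ^ 24 / 10 ^ 14) ^ 2 * (N : ℝ) = ε ^ 48 * N / 10 ^ 28 := by ring
    rw [this, le_div_iff₀ (by positivity)]
    linarith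
  have hM := lemM g U hg hN hNB hs hε hε1 hCR (by
    have : ε ^ 48 * (N : ℝ) ≤ ε ^ 24 * N := by gcongr
    linarith)
  rcases hM with ⟨α, hα, D, hD, hDp, hcr⟩ | ⟨α, hα, b1, h1, b2, h2, c1, c2, n1, n2, d12, A, hA, hAp, hcr⟩
  · obtain ⟨u, hu, hua⟩ := hgr α hα
    have T : Strip S0 (Set.range (g α)) u (g α 0) (g α 0) := by
      refine ⟨hS0, (hg α hα).cn_range, ?_, hu, ⟨0, rfl⟩, hua, .nil, ?_⟩
      · intro x hx hx'
        exact hav α hα x hx' hx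
      · intro x hx
        simp only [Walk.support_nil, List.mem_cons, List.not_mem_nil, or_false] at hx
        subst hx
        exact hav α hα _ ⟨0, rfl⟩
    have T' : ∃ T : Strip S0 (Set.range (g α)) u (g α 0) (g α 0), ∀ x ∈ T.K.support, x = g α 0 := by
      refine ⟨⟨hS0, (hg α hα).cn_range, ?_, hu, ⟨0, rfl⟩, hua, .nil, ?_⟩, ?_⟩
      · intro x hx hx'
        exact hav α hα x hx' hx
      · intro x hx
        simp only [Walk.support_nil, List.mem_cons, List.not_mem_nil, or_false] at hx
        subst hx
        exact hav α hα _ ⟨0, rfl⟩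
      · intro x hx
        simpa using hx
    obtain ⟨T, hT⟩ := T'
    refine dens_strip T (Hd g α) D ?_ ?_ hs ((Finset.card_le_card hD).trans hN) hL
      (hNB.mono hD (fun b _ => hd_sub _ _)) (by positivity) hη1 hcr hη2
    · intro b hb
      obtain ⟨cr, hne⟩ := hDp b hb
      have hbU := hD hb
      refine ⟨hd_cn (hg b hbU) _, ?_, hd_dis, ?_, ?_⟩
      · intro x hx
        exact hav b hbU x (hd_sub _ _ hx)
      · obtain ⟨v, hv, hva⟩ := hgr b hbU
        exact ⟨v, hv, g b 0, hd_start hne, hva.symm⟩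
      · refine hd_adj (hg b hbU) hne ?_
        obtain ⟨x, ⟨i, rfl⟩, hi⟩ := cr.2
        exact ⟨i, hi⟩
    · intro b hb x hx hx'
      rw [hT x hx] at hx'
      exact hd_dis _ hx' ⟨0, rfl⟩
  · obtain ⟨u1, hu1, ha1⟩ := hgr b1 h1
    obtain ⟨u2, hu2, ha2⟩ := hgr b2 h2
    obtain ⟨w, hw⟩ := hS0 u1 hu1 u2 hu2
    have T' : ∃ T : Strip (Hd g α b1) (Hd g α b2) (g b1 0) (g b2 0) u1,
        ∀ x ∈ T.K.support, x ∈ S0 ∨ x = g b2 0 := by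
      have hKs : ∀ x ∈ (w.append (Walk.cons ha2 Walk.nil)).support, x ∈ S0 ∨ x = g b2 0 := by
        intro x hx
        rw [Walk.mem_support_append_iff] at hx
        rcases hx with hx | hx
        · exact Or.inl (hw x hx)
        · simp only [Walk.support_cons, Walk.support_nil, List.mem_cons, List.not_mem_nil, or_false] at hx
          rcases hx with rfl | rfl
          · exact Or.inl hu2
          · exact Or.inr rfl
      refine ⟨⟨hd_cn (hg b1 h1) _, hd_cn (hg b2 h2) _, inter_dis d12, hd_start n1, hd_start n2,
        ha1.symm, w.append (Walk.cons ha2 Walk.nil), ?_⟩, hKs⟩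
      intro x hx hx'
      rcases hKs x hx with h | h
      · exact hav b1 h1 x (hd_sub _ _ hx') h
      · subst h
        exact inter_dis d12 _ hx' (hd_start n2)
    obtain ⟨T, hT⟩ := T'
    refine dens_strip T (fun a => jn (g a) (Hd g α b1) (Hd g α b2)) A ?_ ?_ hs
      ((Finset.card_le_card hA).trans hN) hL
      (hNB.mono hA (fun b _ => jn_sub _ _ _)) (by positivity) hη1 hcr hη2
    · intro a ha
      exact jn_ch (hg a (hA ha)) (hAp a ha)
    · intro a ha x hx hx'
      rcases hT x hx with h | h
      · exact hav a (hA ha) x (jn_sub _ _ _ hx') h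
      · subst h
        exact jn_disY _ hx' (hd_start n2)

theorem dense (g : V → ℕ → Pt) (U : Finset V)
    (hg : ∀ v ∈ U, St (g v)) {s N L : ℕ} (hN : U.card ≤ N) (hL : N ≤ 2 ^ L)
    (hNB : NB (fun b => Set.range (g b)) U s) (hs : 1 ≤ s) {ε : ℝ} (hε : 0 < ε) (hε1 : ε ≤ 1)
    (hCR : ε * N ^ 2 ≤ CR (fun b => Set.range (g b)) U)
    (hsm : 256 * 10 ^ 28 * ((s : ℝ) * (L + 1)) ≤ (ε ^ 24 / 10 ^ 14) ^ 48 * N) : False := by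
  have hsL : (s : ℝ) ≤ s * (L + 1) := by
    have h1 : (0 : ℝ) ≤ L := Nat.cast_nonneg _
    have h2 : (0 : ℝ) ≤ s := Nat.cast_nonneg _
    nlinarith
  have hs0 : (0 : ℝ) ≤ s := Nat.cast_nonneg _
  have hN0 : (0 : ℝ) ≤ N := Nat.cast_nonneg _
  have he24 : ε ^ 24 ≤ 1 := pow_le_one₀ hε.le hε1
  have he0 : 0 < ε ^ 24 := by positivity
  have hη1 : ε ^ 24 / 10 ^ 14 ≤ 1 := by
    rw [div_le_one (by positivity)]
    linarith
  have hη0 : 0 < ε ^ 24 / 10 ^ 14 := by positivity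
  have hM := lemM g U hg hN hNB hs hε hε1 hCR (by
    have h1 : (ε ^ 24 / 10 ^ 14) ^ 48 ≤ (ε ^ 24 / 10 ^ 14) ^ 1 :=
      pow_le_pow_of_le_one hη0.le hη1 (by norm_num)
    have h2 : (ε ^ 24 / 10 ^ 14) ^ 48 * (N : ℝ) ≤ (ε ^ 24 / 10 ^ 14) ^ 1 * N := by gcongr
    have h3 : (ε ^ 24 / 10 ^ 14) ^ 1 * (N : ℝ) ≤ ε ^ 24 * N := by
      rw [pow_one]
      gcongr
      apply div_le_self he0.le
      norm_num
    linarith)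
  rcases hM with ⟨α, hα, D, hD, hDp, hcr⟩ | ⟨α, hα, b1, h1, b2, h2, c1, c2, n1, n2, d12, A, hA, hAp, hcr⟩
  · have hrep : ∀ b, ∃ g', b ∈ D → (St g' ∧ Set.range g' = Hd g α b ∧
        ∃ v ∈ Set.range (g α), BW.Adj v (g' 0)) := by
      intro b
      by_cases hb : b ∈ D
      · obtain ⟨cr, hne⟩ := hDp b hb
        have hT : ∃ i, g b i ∈ Set.range (g α) := by
          obtain ⟨x, ⟨i, rfl⟩, hi⟩ := cr.2
          exact ⟨i, hi⟩
        obtain ⟨g', h'⟩ := hd_rep (hg b (hD hb)) hne hT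
        exact ⟨g', fun _ => h'⟩
      · exact ⟨g b, fun h => absurd h hb⟩
    choose g' hg' using hrep
    refine grounded (hg α hα).cn_range g' D (fun b hb => (hg' b hb).1) ?_ (fun b hb => (hg' b hb).2.2)
      ((Finset.card_le_card hD).trans hN) hL (hNB.mono hD ?_) hs hη0 hη1 ?_ hsm
    · intro b hb x hx
      rw [(hg' b hb).2.1] at hx
      exact hd_dis _ hx
    · intro b hb
      rw [(hg' b hb).2.1]
      exact hd_sub _ _
    · rw [CR_congr (c' := Hd g α) (fun b hb => (hg' b hb).2.1)]
      exact hcr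
  · have hrep : ∀ b, ∃ g', b ∈ A → (St g' ∧ Set.range g' = jn (g b) (Hd g α b1) (Hd g α b2) ∧
        ∃ v ∈ Hd g α b1, BW.Adj v (g' 0)) := by
      intro b
      by_cases hb : b ∈ A
      · obtain ⟨g', h'⟩ := jn_rep (hg b (hA hb)) (hAp b hb)
        exact ⟨g', fun _ => h'⟩
      · exact ⟨g b, fun h => absurd h hb⟩
    choose g' hg' using hrep
    refine grounded (hd_cn (hg b1 h1) _) g' A (fun b hb => (hg' b hb).1) ?_
      (fun b hb => (hg' b hb).2.2)
      ((Finset.card_le_card hA).trans hN) hL (hNB.mono hA ?_) hs hη0 hη1 ?_ hsm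
    · intro b hb x hx
      rw [(hg' b hb).2.1] at hx
      exact jn_disX _ hx
    · intro b hb
      rw [(hg' b hb).2.1]
      exact jn_sub _ _ _
    · rw [CR_congr (c' := fun a => jn (g a) (Hd g α b1) (Hd g α b2)) (fun b hb => (hg' b hb).2.1)]
      exact hcr

end DD
end SG

namespace SG
open Finset SimpleGraph

section SS
open scoped Classical

variable {V : Type*}

/-- union of the sets over a finset of vertices -/
def un (R : V → Set Pt) (P : Finset V) : Set Pt := {x | ∃ v ∈ P, x ∈ R v}

theorem fin5_rest : ∀ i j k l : Fin 5, i ≠ j → k ≠ l → i ≠ k → i ≠ l → j ≠ k → j ≠ l →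
    ∃ m : Fin 5, ∀ t, t = i ∨ t = j ∨ t = k ∨ t = l ∨ t = m := by
  decide

def Bd (R : V → Set Pt) (P : V → V → Finset V) (x y z w : V) : Prop :=
  (un R (P x y) ∩ un R (P z w)).Nonempty

theorem bad_count (R : V → Set Pt) (U W : Finset V) (P : V → V → Finset V) {n l M d : ℕ}
    (hW : W.card ≤ n)
    (hP : ∀ x ∈ W, ∀ y ∈ W, P x y ⊆ U) (hl : ∀ x ∈ W, ∀ y ∈ W, (P x y).card ≤ l)
    (hd : ∀ u ∈ U, (U.filter (fun v => (R u ∩ R v).Nonempty)).card ≤ d)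
    (hM : ∀ v ∈ U, ((W ×ˢ W).filter (fun p => v ∈ P p.1 p.2)).card ≤ M) :
    (((W ×ˢ W) ×ˢ (W ×ˢ W)).filter (fun p => Bd R P p.1.1 p.1.2 p.2.1 p.2.2)).card ≤
      n ^ 2 * (l * (d * M)) := by
  have hsub : (((W ×ˢ W) ×ˢ (W ×ˢ W)).filter (fun p => Bd R P p.1.1 p.1.2 p.2.1 p.2.2)) ⊆
      (W ×ˢ W).biUnion (fun q => (P q.1 q.2).biUnion (fun u =>
        (U.filter (fun v => (R u ∩ R v).Nonempty)).biUnion (fun v =>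
          ((W ×ˢ W).filter (fun p => v ∈ P p.1 p.2)).image (fun p => (q, p))))) := by
    rintro ⟨⟨x, y⟩, z, w⟩ hp
    simp only [Finset.mem_filter, Finset.mem_product] at hp
    obtain ⟨⟨⟨hx, hy⟩, hz, hw⟩, t, ⟨u, hu, htu⟩, v, hv, htv⟩ := hp
    simp only [Finset.mem_biUnion, Finset.mem_product, Finset.mem_filter, Finset.mem_image]
    exact ⟨(x, y), ⟨hx, hy⟩, u, hu, v, ⟨hP z hz w hw hv, t, htu, htv⟩, (z, w), ⟨⟨hz, hw⟩, hv⟩, rfl⟩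
  refine (Finset.card_le_card hsub).trans ?_
  have h1 : (W ×ˢ W).card ≤ n ^ 2 := by
    rw [Finset.card_product, sq]; gcongr
  refine (Finset.card_biUnion_le_card_mul _ _ (l * (d * M)) ?_).trans (Nat.mul_le_mul_right _ h1)
  rintro ⟨x, y⟩ hxy
  rw [Finset.mem_product] at hxy
  refine (Finset.card_biUnion_le_card_mul _ _ (d * M) ?_).trans
    (Nat.mul_le_mul_right _ (hl x hxy.1 y hxy.2))
  intro u hu
  refine (Finset.card_biUnion_le_card_mul _ _ M ?_).trans
    (Nat.mul_le_mul_right _ (hd u (hP x hxy.1 y hxy.2 hu)))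
  intro v hv
  refine Finset.card_image_le.trans (hM v (Finset.mem_filter.1 hv).1)

theorem un_mem {R : V → Set Pt} {P : Finset V} {v : V} (hv : v ∈ P) : R v ⊆ un R P :=
  fun _ hx => ⟨v, hv, hx⟩

theorem k5_count (R : V → Set Pt) (U W : Finset V) (hWU : W ⊆ U) (P : V → V → Finset V) {n l M d : ℕ}
    (hne : ∀ v ∈ U, (R v).Nonempty) (hW : W.card ≤ n)
    (hP : ∀ x ∈ W, ∀ y ∈ W, P x y ⊆ U) (hl : ∀ x ∈ W, ∀ y ∈ W, (P x y).card ≤ l)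
    (hPx : ∀ x ∈ W, ∀ y ∈ W, x ∈ P x y) (hPy : ∀ x ∈ W, ∀ y ∈ W, y ∈ P x y)
    (hPc : ∀ x ∈ W, ∀ y ∈ W, Cn (un R (P x y)))
    (hd : ∀ u ∈ U, (U.filter (fun v => (R u ∩ R v).Nonempty)).card ≤ d)
    (hM : ∀ v ∈ U, ((W ×ˢ W).filter (fun p => v ∈ P p.1 p.2)).card ≤ M) :
    W.card ^ 5 ≤ 625 * (n ^ 3 * (l * (d * M))) := by
  let F := Fintype.piFinset (fun _ : Fin 5 => W)
  have hF : F.card = W.card ^ 5 := by simp [F]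
  let I := (Finset.univ : Finset (Fin 5 × Fin 5 × Fin 5 × Fin 5)).filter (fun t =>
    t.1 ≠ t.2.1 ∧ t.2.2.1 ≠ t.2.2.2 ∧ t.1 ≠ t.2.2.1 ∧ t.1 ≠ t.2.2.2 ∧ t.2.1 ≠ t.2.2.1 ∧ t.2.1 ≠ t.2.2.2)
  have hI : I.card ≤ 625 := by
    refine (Finset.card_filter_le _ _).trans ?_
    simp [Finset.card_univ]
  have hsub : F ⊆ I.biUnion (fun t => F.filter (fun f => Bd R P (f t.1) (f t.2.1) (f t.2.2.1) (f t.2.2.2))) := by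
    intro f hf
    have hfW : ∀ i, f i ∈ W := fun i => by
      have := hf
      simp only [F, Fintype.mem_piFinset] at this
      exact this i
    choose q hq using fun i => hne (f i) (hWU (hfW i))
    obtain ⟨i, j, k, l', h1, h2, h3, h4, h5, h6, h7⟩ := K5 q (fun i j => un R (P (f i) (f j)))
      (fun i j _ => hPc _ (hfW i) _ (hfW j))
      (fun i j _ => un_mem (hPx _ (hfW i) _ (hfW j)) (hq i))
      (fun i j _ => un_mem (hPy _ (hfW i) _ (hfW j)) (hq j))
    rw [Finset.mem_biUnion]
    refine ⟨(i, j, k, l'), ?_, ?_⟩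
    · simp only [I, Finset.mem_filter, Finset.mem_univ, true_and]
      exact ⟨h1.ne, h2.ne, h3, h4, h5, h6⟩
    · rw [Finset.mem_filter]
      exact ⟨hf, h7⟩
  rw [← hF]
  refine (Finset.card_le_card hsub).trans ?_
  refine (Finset.card_biUnion_le_card_mul _ _ (n ^ 3 * (l * (d * M))) ?_).trans
    (Nat.mul_le_mul_right _ hI)
  rintro ⟨i, j, k, l'⟩ ht
  simp only [I, Finset.mem_filter, Finset.mem_univ, true_and] at ht
  obtain ⟨h1, h2, h3, h4, h5, h6⟩ := ht
  obtain ⟨m, hm⟩ := fin5_rest i j k l' h1 h2 h3 h4 h5 h6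
  have bc := bad_count R U W P hW hP hl hd hM
  set BB := (((W ×ˢ W) ×ˢ (W ×ˢ W)).filter (fun p => Bd R P p.1.1 p.1.2 p.2.1 p.2.2)) with hBB
  calc _ ≤ (BB ×ˢ W).card := by
        apply Finset.card_le_card_of_injOn (fun f => (((f i, f j), (f k, f l')), f m))
        · intro f hf
          simp only [Finset.coe_filter, Set.mem_ofPred_eq, F, Fintype.mem_piFinset] at hf
          simp only [hBB, Finset.coe_product, Set.mem_prod, Finset.mem_coe, Finset.mem_filter,
            Finset.mem_product]
          exact ⟨⟨⟨⟨hf.1 i, hf.1 j⟩, hf.1 k, hf.1 l'⟩, hf.2⟩, hf.1 m⟩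
        · intro f _ f' _ e
          simp only [Prod.mk.injEq] at e
          obtain ⟨⟨⟨e1, e2⟩, e3, e4⟩, e5⟩ := e
          funext t
          rcases hm t with rfl | rfl | rfl | rfl | rfl <;> assumption
    _ = BB.card * W.card := Finset.card_product _ _
    _ ≤ (n ^ 2 * (l * (d * M))) * n := Nat.mul_le_mul bc hW
    _ = _ := by ring

end SS
end SG

namespace SG
open Finset SimpleGraph

section RR
open scoped Classical

variable {V : Type*}

/-- `P` is a short connecting set for `x`, `y` -/
structure Good (R : V → Set Pt) (U : Finset V) (l : ℕ) (x y : V) (P : Finset V) : Prop where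
  sub : P ⊆ U
  hx : x ∈ P
  hy : y ∈ P
  card : P.card ≤ l
  cn : Cn (un R P)

theorem un_union (R : V → Set Pt) (P Q : Finset V) : un R (P ∪ Q) = un R P ∪ un R Q := by
  ext x
  simp only [un, Finset.mem_union, Set.mem_ofPred_eq, Set.mem_union]
  constructor
  · rintro ⟨v, h | h, hx⟩
    · exact Or.inl ⟨v, h, hx⟩
    · exact Or.inr ⟨v, h, hx⟩
  · rintro (⟨v, h, hx⟩ | ⟨v, h, hx⟩)
    · exact ⟨v, Or.inl h, hx⟩
    · exact ⟨v, Or.inr h, hx⟩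

theorem routing (R : V → Set Pt) (U : Finset V) (l M : ℕ) :
    ∃ (P : V → V → Finset V) (H : Finset V), H ⊆ U ∧ H.card * M ≤ U.card ^ 2 * l ∧
      (∀ v ∈ U, ((U ×ˢ U).filter (fun p => v ∈ P p.1 p.2)).card ≤ M) ∧
      ∀ x ∈ U, ∀ y ∈ U, (∃ Q, Good R (U \ H) l x y Q) → Good R U l x y (P x y) := by
  let val : (V → V → Finset V) → Prop := fun P =>
    (∀ x ∈ U, ∀ y ∈ U, P x y ≠ ∅ → Good R U l x y (P x y)) ∧
    (∀ v ∈ U, ((U ×ˢ U).filter (fun p => v ∈ P p.1 p.2)).card ≤ M)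
  let cnt : (V → V → Finset V) → ℕ := fun P => ((U ×ˢ U).filter (fun p => P p.1 p.2 ≠ ∅)).card
  let T : Set ℕ := {k | ∃ P, val P ∧ cnt P = k}
  have hTne : T.Nonempty := ⟨_, fun _ _ => ∅, ⟨by simp, by simp⟩, rfl⟩
  have hTb : BddAbove T := by
    refine ⟨(U ×ˢ U).card, ?_⟩
    rintro k ⟨P, _, rfl⟩
    exact Finset.card_filter_le _ _
  obtain ⟨P, hP, hPk⟩ := Nat.sSup_mem hTne hTb
  have hmax : ∀ P', val P' → cnt P' ≤ cnt P := by
    intro P' h'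
    rw [hPk]
    exact le_csSup hTb ⟨P', h', rfl⟩
  let H := U.filter (fun v => M ≤ ((U ×ˢ U).filter (fun p => v ∈ P p.1 p.2)).card)
  refine ⟨P, H, Finset.filter_subset _ _, ?_, hP.2, ?_⟩
  · calc H.card * M = ∑ v ∈ H, M := by rw [Finset.sum_const, smul_eq_mul]
      _ ≤ ∑ v ∈ H, ((U ×ˢ U).filter (fun p => v ∈ P p.1 p.2)).card :=
          Finset.sum_le_sum (fun v hv => (Finset.mem_filter.1 hv).2)
      _ = ∑ p ∈ U ×ˢ U, (H.filter (fun v => v ∈ P p.1 p.2)).card := by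
          simp only [Finset.card_filter]
          rw [Finset.sum_comm]
      _ ≤ ∑ p ∈ U ×ˢ U, l := by
          apply Finset.sum_le_sum
          rintro ⟨x, y⟩ hxy
          rw [Finset.mem_product] at hxy
          by_cases he : P x y = ∅
          · simp [he]
          · refine le_trans (Finset.card_le_card ?_) (hP.1 x hxy.1 y hxy.2 he).card
            intro v hv
            exact (Finset.mem_filter.1 hv).2
      _ = _ := by rw [Finset.sum_const, smul_eq_mul, Finset.card_product, sq]
  · rintro x hx y hy ⟨Q, hQ⟩
    by_cases he : P x y = ∅
    swap
    · exact hP.1 x hx y hy he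
    exfalso
    let P' : V → V → Finset V := fun a b => if a = x ∧ b = y then Q else P a b
    have hP'v : val P' := by
      constructor
      · intro a ha b hb hne
        by_cases hc : a = x ∧ b = y
        · obtain ⟨rfl, rfl⟩ := hc
          have e : P' a b = Q := if_pos ⟨rfl, rfl⟩
          rw [e]
          exact ⟨hQ.sub.trans Finset.sdiff_subset, hQ.hx, hQ.hy, hQ.card, hQ.cn⟩
        · have e : P' a b = P a b := if_neg hc
          rw [e] at hne ⊢
          exact hP.1 a ha b hb hne
      · intro v hv
        by_cases hvQ : v ∈ Q
        · have hvH : v ∉ H := (Finset.mem_sdiff.1 (hQ.sub hvQ)).2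
          have hlt : ((U ×ˢ U).filter (fun p => v ∈ P p.1 p.2)).card < M := by
            by_contra hc
            exact hvH (Finset.mem_filter.2 ⟨hv, not_lt.1 hc⟩)
          have hsub : (U ×ˢ U).filter (fun p => v ∈ P' p.1 p.2) ⊆
              insert (x, y) ((U ×ˢ U).filter (fun p => v ∈ P p.1 p.2)) := by
            rintro ⟨a, b⟩ hab
            rw [Finset.mem_filter] at hab
            rw [Finset.mem_insert, Finset.mem_filter]
            by_cases hc : a = x ∧ b = y
            · left; rw [hc.1, hc.2]
            · right
              refine ⟨hab.1, ?_⟩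
              have e : P' a b = P a b := if_neg hc
              have := hab.2
              simp only at this
              rwa [e] at this
          refine (Finset.card_le_card hsub).trans ((Finset.card_insert_le _ _).trans ?_)
          omega
        · refine le_trans (Finset.card_le_card ?_) (hP.2 v hv)
          rintro ⟨a, b⟩ hab
          rw [Finset.mem_filter] at hab ⊢
          refine ⟨hab.1, ?_⟩
          have h2 := hab.2
          simp only at h2 ⊢
          by_cases hc : a = x ∧ b = y
          · have e : P' a b = Q := if_pos hc
            rw [e] at h2
            exact absurd h2 hvQ
          · have e : P' a b = P a b := if_neg hc
            rwa [e] at h2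
    have hlt : cnt P < cnt P' := by
      apply Finset.card_lt_card
      rw [Finset.ssubset_iff_of_subset]
      · refine ⟨(x, y), ?_, ?_⟩
        · rw [Finset.mem_filter, Finset.mem_product]
          refine ⟨⟨hx, hy⟩, ?_⟩
          have e : P' x y = Q := if_pos ⟨rfl, rfl⟩
          simp only
          rw [e]
          exact Finset.ne_empty_of_mem hQ.hx
        · rw [Finset.mem_filter]
          rintro ⟨_, h⟩
          exact h he
      · rintro ⟨a, b⟩ hab
        rw [Finset.mem_filter] at hab ⊢
        refine ⟨hab.1, ?_⟩
        have h2 := hab.2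
        simp only at h2 ⊢
        by_cases hc : a = x ∧ b = y
        · have e : P' a b = Q := if_pos hc
          rw [e]
          exact Finset.ne_empty_of_mem hQ.hx
        · have e : P' a b = P a b := if_neg hc
          rwa [e]
    exact absurd (hmax P' hP'v) (by omega)

/-- vertex boundary inside `W` -/
noncomputable def bdy (R : V → Set Pt) (W X : Finset V) : Finset V :=
  (W \ X).filter (fun v => ∃ x ∈ X, (R x ∩ R v).Nonempty)

noncomputable def ball (R : V → Set Pt) (W : Finset V) (x : V) : ℕ → Finset V
  | 0 => {x}
  | k + 1 => ball R W x k ∪ bdy R W (ball R W x k)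

theorem ball_sub (R : V → Set Pt) (W : Finset V) {x : V} (hx : x ∈ W) (k : ℕ) : ball R W x k ⊆ W := by
  induction k with
  | zero => simpa [ball] using hx
  | succ k ih =>
    simp only [ball]
    apply Finset.union_subset ih
    exact (Finset.filter_subset _ _).trans Finset.sdiff_subset

theorem ball_good (R : V → Set Pt) (W : Finset V) (hc : ∀ v ∈ W, Cn (R v)) {x : V} (hx : x ∈ W) (k : ℕ) :
    ∀ v ∈ ball R W x k, ∃ Q, Good R W (k + 1) x v Q := by
  induction k with
  | zero =>
    intro v hv
    simp only [ball, Finset.mem_singleton] at hv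
    subst hv
    refine ⟨{v}, by simpa using hx, by simp, by simp, by simp, ?_⟩
    have : un R {v} = R v := by ext y; simp [un]
    rw [this]
    exact hc v hx
  | succ k ih =>
    intro v hv
    simp only [ball, Finset.mem_union] at hv
    rcases hv with hv | hv
    · obtain ⟨Q, h⟩ := ih v hv
      exact ⟨Q, h.sub, h.hx, h.hy, h.card.trans (by omega), h.cn⟩
    · simp only [bdy, Finset.mem_filter, Finset.mem_sdiff] at hv
      obtain ⟨⟨hvW, _⟩, u, hu, t, htu, htv⟩ := hv
      obtain ⟨Q, h⟩ := ih u hu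
      refine ⟨Q ∪ {v}, ?_, ?_, ?_, ?_, ?_⟩
      · exact Finset.union_subset h.sub (by simpa using hvW)
      · exact Finset.mem_union_left _ h.hx
      · exact Finset.mem_union_right _ (by simp)
      · refine (Finset.card_union_le _ _).trans ?_
        have := h.card
        simp; exact this
      · rw [un_union]
        have e : un R {v} = R v := by ext y; simp [un]
        rw [e]
        exact Cn.union h.cn (hc v hvW) ⟨t, ⟨u, h.hy, htu⟩, htv⟩

theorem ball_grow (R : V → Set Pt) (W : Finset V) {x : V} (hx : x ∈ W) {D m : ℕ}
    (hexp : ∀ X ⊆ W, X.Nonempty → X.card ≤ m → X.card < D * (bdy R W X).card) (k : ℕ)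
    (hk : (ball R W x k).card ≤ m) : (D + 1) ^ k ≤ D ^ k * (ball R W x k).card := by
  induction k with
  | zero => simp [ball]
  | succ k ih =>
    have hsub : ball R W x k ⊆ ball R W x (k + 1) := by
      simp only [ball]; exact Finset.subset_union_left
    have hk' := (Finset.card_le_card hsub).trans hk
    have h1 := ih hk'
    have hne : (ball R W x k).Nonempty := by
      rw [← Finset.card_pos]
      by_contra hc
      have h0 : (ball R W x k).card = 0 := by omega
      rw [h0, mul_zero] at h1
      have : 0 < (D + 1) ^ k := by positivity
      omega
    have h2 := hexp _ (ball_sub R W hx k) hne hk'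
    have h3 : (ball R W x (k + 1)).card = (ball R W x k).card + (bdy R W (ball R W x k)).card := by
      simp only [ball]
      apply Finset.card_union_of_disjoint
      rw [Finset.disjoint_left]
      intro a ha hb
      simp only [bdy, Finset.mem_filter, Finset.mem_sdiff] at hb
      exact hb.1.2 ha
    rw [h3]
    calc (D + 1) ^ (k + 1) = (D + 1) ^ k * (D + 1) := pow_succ _ _
      _ ≤ (D ^ k * (ball R W x k).card) * (D + 1) := Nat.mul_le_mul_right _ h1
      _ = D ^ k * (D * (ball R W x k).card + (ball R W x k).card) := by ring
      _ ≤ D ^ k * (D * (ball R W x k).card + D * (bdy R W (ball R W x k)).card) := by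
          apply Nat.mul_le_mul_left; omega
      _ = _ := by ring

theorem ball_big (R : V → Set Pt) (W : Finset V) {x : V} (hx : x ∈ W) {D m L : ℕ} (hD : 1 ≤ D)
    (hm : m < 2 ^ L)
    (hexp : ∀ X ⊆ W, X.Nonempty → X.card ≤ m → X.card < D * (bdy R W X).card) :
    m < (ball R W x (D * L)).card := by
  by_contra hc
  push Not at hc
  have h1 := ball_grow R W hx hexp (D * L) hc
  have h2 : 2 * D ^ D ≤ (D + 1) ^ D := by
    have hb := one_add_mul_le_pow (a := (1 : ℝ) / D) (by
      have : (0 : ℝ) ≤ 1 / D := by positivity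
      linarith) D
    have hD0 : (0 : ℝ) < D := by exact_mod_cast hD
    have e : (1 : ℝ) + D * (1 / D) = 2 := by field_simp; norm_num
    rw [e] at hb
    have e2 : (1 + (1 : ℝ) / D) ^ D * (D : ℝ) ^ D = ((D : ℝ) + 1) ^ D := by
      rw [← mul_pow]; congr 1; field_simp
    have : (2 : ℝ) * (D : ℝ) ^ D ≤ ((D : ℝ) + 1) ^ D := by
      rw [← e2]
      gcongr
    exact_mod_cast this
  have h3 : 2 ^ L * D ^ (D * L) ≤ (D + 1) ^ (D * L) := by
    rw [pow_mul, pow_mul, ← mul_pow]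
    exact Nat.pow_le_pow_left h2 L
  have h4 : D ^ (D * L) * 2 ^ L ≤ D ^ (D * L) * (ball R W x (D * L)).card := by
    rw [mul_comm]; exact h3.trans h1
  have h5 := Nat.le_of_mul_le_mul_left h4 (by positivity)
  omega

end RR
end SG

namespace SG
open Finset SimpleGraph

section RR
open scoped Classical

variable {V : Type*}

theorem separator (R : V → Set Pt) (U : Finset V) (hc : ∀ v ∈ U, Cn (R v))
    (hne : ∀ v ∈ U, (R v).Nonempty) {D L d : ℕ} (hD : 20 ≤ D) (hL : 1 ≤ L) (hn : U.card ≤ 2 ^ L)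
    (hd : ∀ u ∈ U, (U.filter (fun v => (R u ∩ R v).Nonempty)).card ≤ d)
    (hbig : 320000 * D ^ 3 * L ^ 2 * d < U.card) :
    ∃ A ⊆ U, ∃ B ⊆ U, Disjoint A B ∧ (∀ a ∈ A, ∀ b ∈ B, R a ∩ R b = ∅) ∧
      10 * A.card ≤ 9 * U.card ∧ 10 * B.card ≤ 9 * U.card ∧
      D * U.card ≤ D * (A.card + B.card) + 2 * U.card := by
  set n := U.card with hndef
  have hn0 : 0 < n := by omega
  set l := 2 * (D * L) + 2 with hl
  obtain ⟨P, H, hHU, hHc, hPM, hPG⟩ := routing R U l (n * l * D)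
  have hH : H.card * D ≤ n := by
    have h1 : (n * l) * (H.card * D) ≤ (n * l) * n := by
      calc (n * l) * (H.card * D) = H.card * (n * l * D) := by ring
        _ ≤ n ^ 2 * l := hHc
        _ = _ := by ring
    exact Nat.le_of_mul_le_mul_left h1 (by positivity)
  set U' := U \ H with hU'
  have hU'U : U' ⊆ U := Finset.sdiff_subset
  have hU'c : U'.card + H.card = n := by
    rw [hU']; exact Finset.card_sdiff_add_card_eq_card hHU
  let Fm := U'.powerset.filter (fun X => 10 * X.card ≤ 9 * n ∧ D * (bdy R U' X).card ≤ X.card)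
  have hFm : Fm.Nonempty := by
    refine ⟨∅, ?_⟩
    simp only [Fm, Finset.mem_filter, Finset.mem_powerset]
    refine ⟨Finset.empty_subset _, by simp, ?_⟩
    simp [bdy]
  obtain ⟨U0, hU0, hmax⟩ := Finset.exists_max_image Fm Finset.card hFm
  simp only [Fm, Finset.mem_filter, Finset.mem_powerset] at hU0 hmax
  obtain ⟨h0U, h09, h0b⟩ := hU0
  have hbU : bdy R U' U0 ⊆ U' \ U0 := Finset.filter_subset _ _
  have hU0c : (U' \ U0).card + U0.card = U'.card := Finset.card_sdiff_add_card_eq_card h0U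
  by_cases hcase : n ≤ 4 * U0.card
  · -- a separator
    have hBc : ((U' \ U0) \ bdy R U' U0).card + (bdy R U' U0).card = (U' \ U0).card :=
      Finset.card_sdiff_add_card_eq_card hbU
    refine ⟨U0, h0U.trans hU'U, (U' \ U0) \ bdy R U' U0, ?_, ?_, ?_, h09, ?_, ?_⟩
    · exact (Finset.sdiff_subset.trans Finset.sdiff_subset).trans hU'U
    · rw [Finset.disjoint_left]
      intro a ha hb
      simp only [Finset.mem_sdiff] at hb
      exact hb.1.2 ha
    · intro a ha b hb
      by_contra hcon
      rw [← ne_eq, ← Set.nonempty_iff_ne_empty] at hcon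
      rw [Finset.mem_sdiff] at hb
      exact hb.2 (Finset.mem_filter.2 ⟨hb.1, a, ha, hcon⟩)
    · omega
    · have : D * n = D * H.card + D * U0.card + D * (bdy R U' U0).card +
          D * ((U' \ U0) \ bdy R U' U0).card := by
        rw [← hU'c, ← hU0c, ← hBc]; ring
      have e : D * H.card = H.card * D := mul_comm _ _
      rw [this, mul_add]
      have : U0.card ≤ n := by omega
      omega
  · exfalso
    push Not at hcase
    set W := U' \ U0 with hW
    have hWU : W ⊆ U := Finset.sdiff_subset.trans hU'U
    have h20 : 20 * H.card ≤ n := by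
      calc 20 * H.card = H.card * 20 := mul_comm _ _
        _ ≤ H.card * D := Nat.mul_le_mul_left _ hD
        _ ≤ n := hH
    have hWn : n ≤ 2 * W.card := by omega
    have hWle : W.card ≤ n := Finset.card_le_card hWU
    have hexp : ∀ X ⊆ W, X.Nonempty → X.card ≤ 6 * n / 10 → X.card < D * (bdy R W X).card := by
      intro X hX hXne hXm
      by_contra hcon
      push Not at hcon
      have hdisj : Disjoint U0 X := by
        rw [Finset.disjoint_left]
        intro a ha hb
        exact (Finset.mem_sdiff.1 (hX hb)).2 ha
      have hcu : (U0 ∪ X).card = U0.card + X.card := Finset.card_union_of_disjoint hdisj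
      have hbs : bdy R U' (U0 ∪ X) ⊆ bdy R U' U0 ∪ bdy R W X := by
        intro v hv
        simp only [bdy, Finset.mem_filter, Finset.mem_sdiff, Finset.mem_union, not_or] at hv ⊢
        obtain ⟨⟨hv1, hv2, hv3⟩, x, hx | hx, hxv⟩ := hv
        · left; exact ⟨⟨hv1, hv2⟩, x, hx, hxv⟩
        · right; exact ⟨⟨by rw [hW, Finset.mem_sdiff]; exact ⟨hv1, hv2⟩, hv3⟩, x, hx, hxv⟩
      have hbc := (Finset.card_le_card hbs).trans (Finset.card_union_le _ _)
      have hbc' := Nat.mul_le_mul_left D hbc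
      rw [mul_add] at hbc'
      have := hmax (U0 ∪ X) ⟨Finset.union_subset h0U (hX.trans Finset.sdiff_subset), by omega, by omega⟩
      have : 0 < X.card := hXne.card_pos
      omega
    have hm : 6 * n / 10 < 2 ^ L := by omega
    have hgood : ∀ x ∈ W, ∀ y ∈ W, Good R U l x y (P x y) := by
      intro x hx y hy
      apply hPG x (hWU hx) y (hWU hy)
      have b1 := ball_big R W hx (by omega) hm hexp
      have b2 := ball_big R W hy (by omega) hm hexp
      have hnd : ¬ Disjoint (ball R W x (D * L)) (ball R W y (D * L)) := by
        intro hdj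
        have h1 := Finset.card_union_of_disjoint hdj
        have h2 := Finset.card_le_card (Finset.union_subset (ball_sub R W hx (D * L)) (ball_sub R W hy (D * L)))
        omega
      rw [Finset.not_disjoint_iff] at hnd
      obtain ⟨z, hz1, hz2⟩ := hnd
      obtain ⟨Q1, g1⟩ := ball_good R W (fun v hv => hc v (hWU hv)) hx _ z hz1
      obtain ⟨Q2, g2⟩ := ball_good R W (fun v hv => hc v (hWU hv)) hy _ z hz2
      refine ⟨Q1 ∪ Q2, ?_, ?_, ?_, ?_, ?_⟩
      · exact (Finset.union_subset g1.sub g2.sub).trans Finset.sdiff_subset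
      · exact Finset.mem_union_left _ g1.hx
      · exact Finset.mem_union_right _ g2.hx
      · have := g1.card
        have := g2.card
        refine (Finset.card_union_le _ _).trans ?_
        omega
      · rw [un_union]
        have hzW : z ∈ U := hWU (g1.sub g1.hy)
        obtain ⟨t, ht⟩ := hne z hzW
        exact Cn.union g1.cn g2.cn ⟨t, ⟨z, g1.hy, ht⟩, ⟨z, g2.hy, ht⟩⟩
    have cnt := k5_count R U W hWU P (n := n) (l := l) (M := n * l * D) (d := d) hne hWle
      (fun x hx y hy => (hgood x hx y hy).sub) (fun x hx y hy => (hgood x hx y hy).card)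
      (fun x hx y hy => (hgood x hx y hy).hx) (fun x hx y hy => (hgood x hx y hy).hy)
      (fun x hx y hy => (hgood x hx y hy).cn) hd (by
        intro v hv
        refine le_trans (Finset.card_le_card ?_) (hPM v hv)
        apply Finset.filter_subset_filter
        exact Finset.product_subset_product hWU hWU)
    have f1 : n ^ 5 ≤ 32 * W.card ^ 5 := by
      calc n ^ 5 ≤ (2 * W.card) ^ 5 := Nat.pow_le_pow_left hWn 5
        _ = _ := by ring
    have f2 : n ^ 4 * n ≤ n ^ 4 * (20000 * (l ^ 2 * (d * D))) := by
      calc n ^ 4 * n = n ^ 5 := by ring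
        _ ≤ 32 * W.card ^ 5 := f1
        _ ≤ 32 * (625 * (n ^ 3 * (l * (d * (n * l * D))))) := Nat.mul_le_mul_left _ cnt
        _ = _ := by ring
    have f3 := Nat.le_of_mul_le_mul_left f2 (by positivity)
    have hDL : 1 ≤ D * L := by
      have : 1 ≤ D := by omega
      exact Nat.mul_pos (by omega) (by omega)
    have f4 : l ≤ 4 * (D * L) := by omega
    have f5 : n ≤ 320000 * D ^ 3 * L ^ 2 * d := by
      calc n ≤ 20000 * (l ^ 2 * (d * D)) := f3
        _ ≤ 20000 * ((4 * (D * L)) ^ 2 * (d * D)) := by gcongr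
        _ = _ := by ring
    omega

end RR
end SG

namespace SG
open Finset SimpleGraph

section RR
open scoped Classical

variable {V : Type*}

def eN (L : ℕ) : ℕ := 10 ^ 7 * (42 * L) ^ 4 * L ^ 2
def XN (L : ℕ) : ℕ := 256 * 10 ^ 28 * (L + 1) * (eN L ^ 24 * 10 ^ 14) ^ 48
def QN (L : ℕ) : ℕ := 4 * XN L

theorem eN_pos {L : ℕ} (hL : 1 ≤ L) : 1 ≤ eN L := by
  unfold eN
  have : 0 < 10 ^ 7 * (42 * L) ^ 4 * L ^ 2 := by positivity
  omega

theorem eN_le_XN {L : ℕ} (hL : 1 ≤ L) : eN L ≤ XN L := by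
  have h1 := eN_pos hL
  unfold XN
  have h2 : eN L ≤ (eN L ^ 24 * 10 ^ 14) ^ 48 := by
    calc eN L = (eN L ^ 1 * 1) ^ 1 := by ring
      _ ≤ (eN L ^ 24 * 10 ^ 14) ^ 1 := by gcongr <;> omega
      _ ≤ (eN L ^ 24 * 10 ^ 14) ^ 48 := by
          apply Nat.pow_le_pow_right _ (by norm_num)
          positivity
  calc eN L ≤ (eN L ^ 24 * 10 ^ 14) ^ 48 := h2
    _ = 1 * (eN L ^ 24 * 10 ^ 14) ^ 48 := (one_mul _).symm
    _ ≤ 256 * 10 ^ 28 * (L + 1) * (eN L ^ 24 * 10 ^ 14) ^ 48 := by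
        apply Nat.mul_le_mul_right
        have : 1 ≤ L + 1 := by omega
        nlinarith

theorem dense_complete (g : V → ℕ → Pt) (U : Finset V) (hg : ∀ v ∈ U, St (g v)) {L : ℕ} (hL : 1 ≤ L)
    (hn : U.card ≤ 2 ^ L) (hQ : QN L < U.card)
    (hCR : U.card ^ 2 ≤ eN L * CR (fun b => Set.range (g b)) U) :
    ∃ A ⊆ U, ∃ B ⊆ U, Disjoint A B ∧ (∀ a ∈ A, ∀ b ∈ B, (Set.range (g a) ∩ Set.range (g b)).Nonempty) ∧
      U.card ≤ QN L * A.card ∧ U.card ≤ QN L * B.card := by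
  set n := U.card with hndef
  have he := eN_pos hL
  have hX : 1 ≤ XN L := he.trans (eN_le_XN hL)
  set X := XN L with hXdef
  have hQX : QN L = 4 * X := rfl
  set s := n / X with hs
  have hs1 : X * s ≤ n := Nat.mul_div_le n X
  have hs2 : n < X * (s + 1) := Nat.lt_mul_div_succ n (by omega)
  have hs3 : 4 ≤ s := by
    rw [hs, Nat.le_div_iff_mul_le (by omega)]
    omega
  have hnNB : ¬ NB (fun b => Set.range (g b)) U s := by
    intro hNB
    have heR : (0 : ℝ) < (eN L : ℝ) := by exact_mod_cast he
    refine dense g U hg (N := n) le_rfl hn hNB (by omega) (ε := 1 / (eN L : ℝ)) (by positivity) ?_ ?_ ?_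
    · rw [div_le_one heR]; exact_mod_cast he
    · rw [div_mul_eq_mul_div, one_mul, div_le_iff₀ heR, mul_comm]
      exact_mod_cast hCR
    · have e1 : ((1 / (eN L : ℝ)) ^ 24 / 10 ^ 14) ^ 48 = 1 / ((eN L : ℝ) ^ 24 * 10 ^ 14) ^ 48 := by
        have e0 : (1 / (eN L : ℝ)) ^ 24 / 10 ^ 14 = 1 / ((eN L : ℝ) ^ 24 * 10 ^ 14) := by
          rw [one_div_pow, div_div]
        rw [e0, one_div_pow]
      rw [e1, div_mul_eq_mul_div, one_mul, le_div_iff₀ (by positivity)]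
      have h2 : (X : ℝ) * s ≤ n := by exact_mod_cast hs1
      have h3 : (X : ℝ) = 256 * 10 ^ 28 * (L + 1) * ((eN L : ℝ) ^ 24 * 10 ^ 14) ^ 48 := by
        rw [hXdef]; unfold XN; simp only [Nat.cast_mul, Nat.cast_pow, Nat.cast_add, Nat.cast_ofNat, Nat.cast_one]
      rw [h3] at h2
      calc _ = 256 * 10 ^ 28 * ((L : ℝ) + 1) * ((eN L : ℝ) ^ 24 * 10 ^ 14) ^ 48 * s := by
            generalize ((eN L : ℝ) ^ 24 * 10 ^ 14) ^ 48 = y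
            ring
        _ ≤ _ := h2
  unfold NB at hnNB
  push Not at hnNB
  obtain ⟨A, hA, B, hB, hAs, hBs, hAB⟩ := hnNB
  obtain ⟨A1, hA1, hA1c⟩ := Finset.exists_subset_card_eq (show s / 2 ≤ A.card by omega)
  have hBc : s / 2 ≤ (B \ A1).card := by
    have := Finset.le_card_sdiff A1 B
    omega
  have hfin : n ≤ 4 * X * (s / 2) := by
    have h1 : s + 1 ≤ 4 * (s / 2) := by omega
    calc n ≤ X * (s + 1) := hs2.le
      _ ≤ X * (4 * (s / 2)) := Nat.mul_le_mul_left _ h1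
      _ = _ := by ring
  refine ⟨A1, hA1.trans hA, B \ A1, Finset.sdiff_subset.trans hB, Finset.disjoint_sdiff, ?_, ?_, ?_⟩
  · intro a ha b hb
    rw [Finset.mem_sdiff] at hb
    have := hAB a (hA1 ha) b hb.1 (by rintro rfl; exact hb.2 ha)
    exact this
  · rw [hQX, hA1c]; exact hfin
  · rw [hQX]; exact hfin.trans (Nat.mul_le_mul_left _ hBc)

theorem dichotomy (g : V → ℕ → Pt) (U : Finset V) (hg : ∀ v ∈ U, St (g v)) {L : ℕ} (hL : 1 ≤ L)
    (hn : U.card ≤ 2 ^ L) (hQ : QN L < U.card) :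
    (∃ A ⊆ U, ∃ B ⊆ U, Disjoint A B ∧ (∀ a ∈ A, ∀ b ∈ B, (Set.range (g a) ∩ Set.range (g b)).Nonempty) ∧
      U.card ≤ QN L * A.card ∧ U.card ≤ QN L * B.card) ∨
    (∃ A ⊆ U, ∃ B ⊆ U, Disjoint A B ∧ (∀ a ∈ A, ∀ b ∈ B, Set.range (g a) ∩ Set.range (g b) = ∅) ∧
      10 * A.card ≤ 9 * U.card ∧ 10 * B.card ≤ 9 * U.card ∧
      42 * L * U.card ≤ 42 * L * (A.card + B.card) + 3 * U.card) := by
  set n := U.card with hndef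
  set D := 42 * L with hD
  have hD1 : 42 ≤ D := by omega
  set Y := 640001 * D ^ 3 * L ^ 2 with hY
  have hL2 : 1 ≤ L ^ 2 := Nat.one_le_pow _ _ hL
  have hD3 : 1 ≤ D ^ 3 := Nat.one_le_pow _ _ (by omega)
  have hY1 : 1 ≤ Y := by rw [hY]; exact Nat.mul_pos (Nat.mul_pos (by norm_num) hD3) hL2
  have hYe : 2 * (D * Y) ≤ eN L := by
    unfold eN; rw [← hD, hY]
    calc 2 * (D * (640001 * D ^ 3 * L ^ 2)) = 1280002 * (D ^ 4 * L ^ 2) := by ring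
      _ ≤ 10 ^ 7 * (D ^ 4 * L ^ 2) := Nat.mul_le_mul_right _ (by norm_num)
      _ = _ := by ring
  have hYn : Y ≤ n := by
    have h1 := eN_le_XN hL
    have h2 : QN L = 4 * XN L := rfl
    have h3 : Y ≤ D * Y := Nat.le_mul_of_pos_left _ (by omega)
    omega
  set d := n / Y with hd
  have hd1 : 1 ≤ d := by rw [hd, Nat.le_div_iff_mul_le (by omega)]; omega
  have hd2 : Y * d ≤ n := Nat.mul_div_le n Y
  have hd3 : n ≤ 2 * (Y * d) := by
    have h1 : n < Y * (d + 1) := Nat.lt_mul_div_succ n (by omega)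
    have h2 : Y * (d + 1) = Y * d + Y := by ring
    have h3 : Y ≤ Y * d := Nat.le_mul_of_pos_right _ (by omega)
    omega
  set Hi := U.filter (fun u => d < (U.filter (fun v => (Set.range (g u) ∩ Set.range (g v)).Nonempty)).card) with hHi
  have hHiU : Hi ⊆ U := Finset.filter_subset _ _
  by_cases hcase : n < D * Hi.card
  · left
    apply dense_complete g U hg hL hn hQ
    have c1 : Hi.card * d ≤ CR (fun b => Set.range (g b)) U := by
      rw [CR_sum]
      calc Hi.card * d = ∑ u ∈ Hi, d := by rw [Finset.sum_const, smul_eq_mul]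
        _ ≤ ∑ u ∈ Hi, (U.filter (fun y => u ≠ y ∧ (Set.range (g u) ∩ Set.range (g y)).Nonempty)).card := by
            apply Finset.sum_le_sum
            intro u hu
            have h1 := (Finset.mem_filter.1 hu).2
            have h2 : U.filter (fun v => (Set.range (g u) ∩ Set.range (g v)).Nonempty) ⊆
                insert u (U.filter (fun y => u ≠ y ∧ (Set.range (g u) ∩ Set.range (g y)).Nonempty)) := by
              intro v hv
              rw [Finset.mem_filter] at hv
              rw [Finset.mem_insert, Finset.mem_filter]
              by_cases e : v = u
              · exact Or.inl e
              · exact Or.inr ⟨hv.1, fun h => e h.symm, hv.2⟩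
            have h3 := (Finset.card_le_card h2).trans (Finset.card_insert_le _ _)
            omega
        _ ≤ _ := Finset.sum_le_sum_of_subset hHiU
    calc n ^ 2 = n * n := sq n
      _ ≤ (D * Hi.card) * (2 * (Y * d)) := Nat.mul_le_mul hcase.le hd3
      _ = (2 * (D * Y)) * (Hi.card * d) := by ring
      _ ≤ eN L * CR (fun b => Set.range (g b)) U := Nat.mul_le_mul hYe c1
  · right
    push Not at hcase
    have hUc : (U \ Hi).card + Hi.card = n := Finset.card_sdiff_add_card_eq_card hHiU
    set U' := U \ Hi with hU'
    have hU'U : U' ⊆ U := Finset.sdiff_subset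
    have h42 : 42 * Hi.card ≤ n := (Nat.mul_le_mul_right _ hD1).trans hcase
    have hbig : 320000 * D ^ 3 * L ^ 2 * d < U'.card := by
      have h1 : 2 * (320000 * D ^ 3 * L ^ 2 * d) + D ^ 3 * L ^ 2 * d = Y * d := by rw [hY]; ring
      have h2 : 1 ≤ D ^ 3 * L ^ 2 * d := Nat.mul_pos (Nat.mul_pos hD3 hL2) hd1
      omega
    obtain ⟨A, hA, B, hB, hdj, hac, hA9, hB9, hsum⟩ := separator (fun v => Set.range (g v)) U'
      (fun v hv => (hg v (hU'U hv)).cn_range) (fun v _ => ⟨g v 0, 0, rfl⟩) (D := D) (L := L) (d := d)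
      (by omega) hL (by omega) (by
        intro u hu
        rw [hU', Finset.mem_sdiff] at hu
        have h1 : ¬ d < (U.filter (fun v => (Set.range (g u) ∩ Set.range (g v)).Nonempty)).card := by
          intro h
          exact hu.2 (Finset.mem_filter.2 ⟨hu.1, h⟩)
        refine le_trans (Finset.card_le_card ?_) (not_lt.1 h1)
        exact Finset.filter_subset_filter _ hU'U) hbig
    refine ⟨A, hA.trans hU'U, B, hB.trans hU'U, hdj, hac, by omega, by omega, ?_⟩
    calc D * n = D * U'.card + D * Hi.card := by rw [← hUc]; ring
      _ ≤ (D * (A.card + B.card) + 2 * U'.card) + n := Nat.add_le_add hsum hcase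
      _ ≤ _ := by omega

end RR
end SG

namespace SG
open Finset SimpleGraph

section REC
open scoped Classical

variable {V : Type*}

/-- pairwise meeting -/
def MeetAll (g : V → ℕ → Pt) (K : Finset V) : Prop :=
  ∀ a ∈ K, ∀ b ∈ K, a ≠ b → (Set.range (g a) ∩ Set.range (g b)).Nonempty

/-- pairwise disjoint -/
def SepAll (g : V → ℕ → Pt) (K : Finset V) : Prop :=
  ∀ a ∈ K, ∀ b ∈ K, a ≠ b → Set.range (g a) ∩ Set.range (g b) = ∅

theorem recursion (g : V → ℕ → Pt) {L : ℕ} (hL : 1 ≤ L) :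
    ∀ (N : ℕ) (U : Finset V), U.card ≤ N → (∀ v ∈ U, St (g v)) → U.card ≤ 2 ^ L → ∀ m k : ℕ,
      U.card * 9 ^ m ≤ 10 ^ m → (∀ K ⊆ U, MeetAll g K → K.card < 2 ^ k) →
      ∃ I ⊆ U, SepAll g I ∧
        (U.card : ℝ) * (1 - 3 / (42 * (L : ℝ))) ^ m ≤ (QN L : ℝ) ^ k * (I.card : ℝ) := by
  have hLR : (1 : ℝ) ≤ L := by exact_mod_cast hL
  set r : ℝ := 1 - 3 / (42 * (L : ℝ)) with hr
  have hr0 : 0 ≤ r := by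
    rw [hr, sub_nonneg, div_le_one (by positivity)]; linarith
  have hr1 : r ≤ 1 := by
    rw [hr, sub_le_self_iff]; positivity
  have hQ1 : 1 ≤ QN L := by
    have := (eN_pos hL).trans (eN_le_XN hL)
    unfold QN; omega
  have hQR : (1 : ℝ) ≤ (QN L : ℝ) := by exact_mod_cast hQ1
  intro N
  induction N with
  | zero =>
    intro U hU _ _ m k _ _
    have : U = ∅ := by rw [← Finset.card_eq_zero]; omega
    subst this
    exact ⟨∅, le_rfl, by intro a ha; simp at ha, by simp⟩
  | succ N ih =>
    intro U hU hg hn m k hm hk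
    rcases U.eq_empty_or_nonempty with rfl | ⟨x, hx⟩
    · exact ⟨∅, le_rfl, by intro a ha; simp at ha, by simp⟩
    have hxK : MeetAll g {x} := by
      intro a ha b hb hab
      simp only [Finset.mem_singleton] at ha hb
      exact absurd (ha.trans hb.symm) hab
    have hUpos : 1 ≤ U.card := Finset.card_pos.mpr ⟨x, hx⟩
    have hk1 : 1 ≤ k := by
      by_contra h0
      have : k = 0 := by omega
      subst this
      have := hk {x} (by simpa using hx) hxK
      simp at this
    by_cases hQ : U.card ≤ QN L
    · refine ⟨{x}, by simpa using hx, ?_, ?_⟩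
      · intro a ha b hb hab
        simp only [Finset.mem_singleton] at ha hb
        exact absurd (ha.trans hb.symm) hab
      · have h1 : (U.card : ℝ) ≤ QN L := by exact_mod_cast hQ
        have h2 : r ^ m ≤ 1 := pow_le_one₀ hr0 hr1
        have h3 : (QN L : ℝ) ≤ (QN L : ℝ) ^ k := by
          calc (QN L : ℝ) = (QN L : ℝ) ^ 1 := (pow_one _).symm
            _ ≤ _ := pow_le_pow_right₀ hQR hk1
        rw [Finset.card_singleton, Nat.cast_one, mul_one]
        calc (U.card : ℝ) * r ^ m ≤ U.card * 1 := by gcongr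
          _ ≤ _ := by linarith
    push Not at hQ
    rcases dichotomy g U hg hL hn hQ with ⟨A, hA, B, hB, hAB, hmeet, hAc, hBc⟩ |
      ⟨A, hA, B, hB, hAB, hsep, hAc, hBc, hABc⟩
    · obtain ⟨k', rfl⟩ : ∃ k', k = k' + 1 := ⟨k - 1, by omega⟩
      have hApos : 0 < A.card := by
        by_contra h0
        have : A.card = 0 := by omega
        rw [this] at hAc; omega
      have hBpos : 0 < B.card := by
        by_contra h0
        have : B.card = 0 := by omega
        rw [this] at hBc; omega
      have hsum : A.card + B.card ≤ U.card := by
        rw [← Finset.card_union_of_disjoint hAB]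
        exact Finset.card_le_card (Finset.union_subset hA hB)
      have key : ∀ C ⊆ U, C.card < U.card → U.card ≤ QN L * C.card →
          (∀ K ⊆ C, MeetAll g K → K.card < 2 ^ k') →
          ∃ I ⊆ U, SepAll g I ∧ (U.card : ℝ) * r ^ m ≤ (QN L : ℝ) ^ (k' + 1) * (I.card : ℝ) := by
        intro C hC hlt hCc hCk
        obtain ⟨I, hI, hS, hIc⟩ := ih C (by omega) (fun v hv => hg v (hC hv)) (by omega) m k'
          ((Nat.mul_le_mul_right _ hlt.le).trans hm) hCk
        refine ⟨I, hI.trans hC, hS, ?_⟩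
        have h1 : (U.card : ℝ) ≤ QN L * C.card := by exact_mod_cast hCc
        calc (U.card : ℝ) * r ^ m ≤ (QN L * C.card) * r ^ m := by gcongr
          _ = QN L * (C.card * r ^ m) := by ring
          _ ≤ QN L * ((QN L : ℝ) ^ k' * (I.card : ℝ)) := by gcongr
          _ = _ := by ring
      by_cases hAk : ∀ K ⊆ A, MeetAll g K → K.card < 2 ^ k'
      · exact key A hA (by omega) hAc hAk
      by_cases hBk : ∀ K ⊆ B, MeetAll g K → K.card < 2 ^ k'
      · exact key B hB (by omega) hBc hBk
      push Not at hAk hBk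
      obtain ⟨K1, hK1, hM1, hc1⟩ := hAk
      obtain ⟨K2, hK2, hM2, hc2⟩ := hBk
      exfalso
      have := hk (K1 ∪ K2) (Finset.union_subset (hK1.trans hA) (hK2.trans hB)) (by
        intro a ha b hb hab
        rw [Finset.mem_union] at ha hb
        rcases ha with ha | ha <;> rcases hb with hb | hb
        · exact hM1 a ha b hb hab
        · exact hmeet a (hK1 ha) b (hK2 hb)
        · rw [Set.inter_comm]; exact hmeet b (hK1 hb) a (hK2 ha)
        · exact hM2 a ha b hb hab)
      rw [Finset.card_union_of_disjoint (Finset.disjoint_of_subset_left hK1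
        (Finset.disjoint_of_subset_right hK2 hAB)), pow_succ] at this
      omega
    · obtain ⟨m', rfl⟩ : ∃ m', m = m' + 1 := by
        refine ⟨m - 1, ?_⟩
        by_contra h0
        have : m = 0 := by omega
        subst this
        simp at hm
        omega
      have hsm : ∀ C : Finset V, 10 * C.card ≤ 9 * U.card → C.card * 9 ^ m' ≤ 10 ^ m' := by
        intro C hC
        have h1 : 10 * (C.card * 9 ^ m') ≤ 10 * 10 ^ m' := by
          calc 10 * (C.card * 9 ^ m') = (10 * C.card) * 9 ^ m' := by ring
            _ ≤ (9 * U.card) * 9 ^ m' := Nat.mul_le_mul_right _ hC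
            _ = U.card * 9 ^ (m' + 1) := by ring
            _ ≤ 10 ^ (m' + 1) := hm
            _ = _ := by ring
        omega
      obtain ⟨I, hI, hS, hIc⟩ := ih A (by omega) (fun v hv => hg v (hA hv)) (by omega) m' k
          (hsm A hAc) (fun K hK => hk K (hK.trans hA))
      obtain ⟨J, hJ, hT, hJc⟩ := ih B (by omega) (fun v hv => hg v (hB hv)) (by omega) m' k
          (hsm B hBc) (fun K hK => hk K (hK.trans hB))
      refine ⟨I ∪ J, Finset.union_subset (hI.trans hA) (hJ.trans hB), ?_, ?_⟩
      · intro a ha b hb hab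
        rw [Finset.mem_union] at ha hb
        rcases ha with ha | ha <;> rcases hb with hb | hb
        · exact hS a ha b hb hab
        · exact hsep a (hI ha) b (hJ hb)
        · rw [Set.inter_comm]; exact hsep b (hI hb) a (hJ ha)
        · exact hT a ha b hb hab
      · rw [Finset.card_union_of_disjoint (Finset.disjoint_of_subset_left hI
          (Finset.disjoint_of_subset_right hJ hAB))]
        push_cast
        have h1 : (42 * L * U.card : ℝ) ≤ 42 * L * (A.card + B.card) + 3 * U.card := by
          exact_mod_cast hABc
        have h2 : (U.card : ℝ) * r ≤ A.card + B.card := by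
          have e : (42 * L : ℝ) * (U.card * r) = 42 * L * U.card - 3 * U.card := by
            rw [hr]; field_simp
          have : (42 * L : ℝ) * (U.card * r) ≤ (42 * L) * (A.card + B.card) := by
            rw [e]; linarith
          exact le_of_mul_le_mul_left this (by positivity)
        calc (U.card : ℝ) * r ^ (m' + 1) = (U.card * r) * r ^ m' := by ring
          _ ≤ (A.card + B.card) * r ^ m' := by gcongr
          _ = A.card * r ^ m' + B.card * r ^ m' := by ring
          _ ≤ _ := by linarith

theorem rec_concl (g : V → ℕ → Pt) {L : ℕ} (hL : 1 ≤ L) (U : Finset V) (hg : ∀ v ∈ U, St (g v))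
    (hn : U.card ≤ 2 ^ L) (k : ℕ) (hk : ∀ K ⊆ U, MeetAll g K → K.card < 2 ^ k) :
    ∃ I ⊆ U, SepAll g I ∧ (U.card : ℝ) ≤ 2 * (QN L : ℝ) ^ k * (I.card : ℝ) := by
  have hLR : (1 : ℝ) ≤ L := by exact_mod_cast hL
  obtain ⟨I, hI, hS, hc⟩ := recursion g hL U.card U le_rfl hg hn (7 * L) k (by
    calc U.card * 9 ^ (7 * L) ≤ 2 ^ L * 9 ^ (7 * L) := Nat.mul_le_mul_right _ hn
      _ = (2 * 9 ^ 7) ^ L := by rw [mul_pow, pow_mul]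
      _ ≤ (10 ^ 7) ^ L := Nat.pow_le_pow_left (by norm_num) _
      _ = _ := by rw [pow_mul]) hk
  refine ⟨I, hI, hS, ?_⟩
  have hb : (1 : ℝ) / 2 ≤ (1 - 3 / (42 * (L : ℝ))) ^ (7 * L) := by
    have h0 : 3 / (42 * (L : ℝ)) ≤ 1 := by
      rw [div_le_one (by positivity)]; linarith
    have := one_add_mul_le_pow (a := -(3 / (42 * (L : ℝ)))) (by linarith) (7 * L)
    have e : (1 : ℝ) + ((7 * L : ℕ) : ℝ) * -(3 / (42 * (L : ℝ))) = 1 / 2 := by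
      push_cast; field_simp; norm_num
    rw [e] at this
    rw [sub_eq_add_neg]; exact this
  have : (U.card : ℝ) * (1 / 2) ≤ U.card * (1 - 3 / (42 * (L : ℝ))) ^ (7 * L) := by gcongr
  linarith

end REC
end SG

namespace SG
open Finset SimpleGraph

theorem row_cn (a y : ℤ) (n : ℕ) : Cn {p : Pt | a ≤ p.1 ∧ p.1 ≤ a + n ∧ p.2 = y} := by
  induction n with
  | zero =>
    have : {p : Pt | a ≤ p.1 ∧ p.1 ≤ a + (0 : ℕ) ∧ p.2 = y} =
        {x | x ∈ (Walk.nil : BW.Walk (a, y) (a, y)).support} := by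
      ext ⟨p, q⟩
      simp only [Set.mem_ofPred_eq, Walk.support_nil, List.mem_singleton, Prod.mk.injEq]
      push_cast; omega
    rw [this]; exact Cn.walk _
  | succ n ih =>
    have h1 : Cn {x | x ∈ (Walk.nil : BW.Walk (a + n + 1, y) (a + n + 1, y)).support} := Cn.walk _
    have h2 := ih.union_adj h1 (a := (a + n, y)) (b := (a + n + 1, y)) (by simp) (by simp)
      (by left; simp)
    convert h2 using 1
    ext ⟨p, q⟩
    simp only [Set.mem_ofPred_eq, Set.mem_union, Walk.support_nil, List.mem_singleton, Prod.mk.injEq]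
    push_cast; omega

theorem box_cn (a y : ℤ) (n m : ℕ) (hn : 1 ≤ n) :
    Cn {p : Pt | a ≤ p.1 ∧ p.1 ≤ a + n ∧ y ≤ p.2 ∧ p.2 ≤ y + m} := by
  induction m with
  | zero =>
    convert row_cn a y n using 1
    ext ⟨p, q⟩
    simp only [Set.mem_ofPred_eq]
    push_cast; omega
  | succ m ih =>
    have h1 := row_cn a (y + m + 1) n
    have hex : ∃ x : ℤ, a ≤ x ∧ x ≤ a + 1 ∧ (x + (y + m)) % 2 = 0 := by
      rcases Int.emod_two_eq_zero_or_one (a + (y + m)) with h | h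
      · exact ⟨a, le_rfl, by omega, h⟩
      · exact ⟨a + 1, by omega, le_rfl, by omega⟩
    obtain ⟨x, hx1, hx2, hx3⟩ := hex
    have h2 := ih.union_adj h1 (a := (x, y + m)) (b := (x, y + m + 1))
      (by simp only [Set.mem_ofPred_eq]; omega) ⟨hx1, by dsimp only; omega, rfl⟩
      (by right; exact ⟨rfl, Or.inl ⟨rfl, hx3⟩⟩)
    convert h2 using 1
    ext ⟨p, q⟩
    simp only [Set.mem_ofPred_eq, Set.mem_union]
    push_cast; omega

def blk (c : Pt) : Set Pt := {p | c.1 - 1 ≤ p.1 ∧ p.1 ≤ c.1 + 1 ∧ c.2 - 1 ≤ p.2 ∧ p.2 ≤ c.2 + 1}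

theorem blk_cn (c : Pt) : Cn (blk c) := by
  have := box_cn (c.1 - 1) (c.2 - 1) 2 2 (by norm_num)
  convert this using 1
  ext ⟨p, q⟩
  simp only [blk, Set.mem_ofPred_eq]
  push_cast; omega

theorem blk_fin (c : Pt) : (blk c).Finite := by
  apply ((Set.finite_Icc (c.1 - 1) (c.1 + 1)).prod (Set.finite_Icc (c.2 - 1) (c.2 + 1))).subset
  rintro ⟨p, q⟩ h
  simp only [blk, Set.mem_ofPred_eq] at h
  simp only [Set.mem_prod, Set.mem_Icc]
  omega

theorem self_blk (c : Pt) : c ∈ blk c := by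
  simp only [blk, Set.mem_ofPred_eq]; omega

def bls (c : ℕ → Pt) (N : ℕ) : Set Pt := {x | ∃ k ≤ N, x ∈ blk (c k)}

theorem bls_succ (c : ℕ → Pt) (N : ℕ) : bls c (N + 1) = bls c N ∪ blk (c (N + 1)) := by
  ext x
  simp only [bls, Set.mem_union, Set.mem_ofPred_eq]
  constructor
  · rintro ⟨k, hk, h⟩
    rcases Nat.lt_or_ge k (N + 1) with h1 | h1
    · exact Or.inl ⟨k, by omega, h⟩
    · right
      have : k = N + 1 := by omega
      rwa [← this]
  · rintro (⟨k, hk, h⟩ | h)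
    · exact ⟨k, by omega, h⟩
    · exact ⟨N + 1, le_rfl, h⟩

theorem bls_zero (c : ℕ → Pt) : bls c 0 = blk (c 0) := by
  ext x
  simp [bls]

theorem bls_cn (c : ℕ → Pt) (N : ℕ) (h : ∀ k < N, c (k + 1) ∈ blk (c k)) : Cn (bls c N) := by
  induction N with
  | zero => rw [bls_zero]; exact blk_cn _
  | succ N ih =>
    rw [bls_succ]
    refine (ih (fun k hk => h k (by omega))).union (blk_cn _) ⟨c (N + 1), ?_, self_blk _⟩
    exact ⟨N, le_rfl, h N (by omega)⟩

theorem bls_fin (c : ℕ → Pt) (N : ℕ) : (bls c N).Finite := by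
  induction N with
  | zero => rw [bls_zero]; exact blk_fin _
  | succ N ih => rw [bls_succ]; exact ih.union (blk_fin _)

theorem cover_walk {S : Set Pt} (hS : Cn S) {x : Pt} (hx : x ∈ S) (F : Finset Pt) (hF : ∀ y ∈ F, y ∈ S) :
    ∃ y ∈ S, ∃ w : BW.Walk x y, (∀ z ∈ w.support, z ∈ S) ∧ ∀ z ∈ F, z ∈ w.support := by
  classical
  induction F using Finset.induction_on with
  | empty => exact ⟨x, hx, Walk.nil, by simpa using hx, by simp⟩
  | insert a F ha ih =>
    obtain ⟨y, hy, w, hw, hwF⟩ := ih (fun z hz => hF z (Finset.mem_insert_of_mem hz))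
    have haS := hF a (Finset.mem_insert_self _ _)
    obtain ⟨w', hw'⟩ := hS y hy a haS
    refine ⟨a, haS, w.append w', ?_, ?_⟩
    · intro z hz
      rw [Walk.mem_support_append_iff] at hz
      exact hz.elim (hw z) (hw' z)
    · intro z hz
      rw [Walk.mem_support_append_iff]
      rcases Finset.mem_insert.mp hz with rfl | hz
      · right; exact Walk.end_mem_support _
      · exact Or.inl (hwF z hz)

theorem cn_st {S : Set Pt} (hS : Cn S) (hf : S.Finite) (hne : S.Nonempty) :
    ∃ g : ℕ → Pt, St g ∧ Set.range g = S := by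
  obtain ⟨x, hx⟩ := hne
  obtain ⟨y, _, w, hw, hwF⟩ := cover_walk hS hx hf.toFinset (by simp)
  refine ⟨w.getVert, ?_, ?_⟩
  · intro i
    by_cases hi : i < w.length
    · right; exact w.adj_getVert_succ hi
    · left
      rw [w.getVert_of_length_le (by omega), w.getVert_of_length_le (by omega)]
  · ext z
    constructor
    · rintro ⟨i, rfl⟩
      exact hw _ (w.getVert_mem_support i)
    · intro hz
      obtain ⟨i, hi, _⟩ := Walk.mem_support_iff_exists_getVert.mp (hwF z (by simpa using hz))
      exact ⟨i, hi⟩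

noncomputable def cell (h : ℝ) (p : ℝ × ℝ) : Pt := (⌊p.1 / h⌋, ⌊p.2 / h⌋)

theorem fl_close {h a b : ℝ} (hh : 0 < h) (hab : |a - b| ≤ h) :
    ⌊a / h⌋ - 1 ≤ ⌊b / h⌋ ∧ ⌊b / h⌋ ≤ ⌊a / h⌋ + 1 := by
  rw [abs_le] at hab
  have e1 : a / h ≤ b / h + 1 := by
    rw [div_add_one hh.ne']; gcongr; linarith
  have e2 : b / h ≤ a / h + 1 := by
    rw [div_add_one hh.ne']; gcongr; linarith
  have f1 := Int.floor_le_floor e1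
  have f2 := Int.floor_le_floor e2
  rw [Int.floor_add_one] at f1 f2
  omega

theorem cell_close {h : ℝ} (hh : 0 < h) {p q : ℝ × ℝ} (hpq : dist p q ≤ h) : cell h q ∈ blk (cell h p) := by
  rw [Prod.dist_eq, max_le_iff, Real.dist_eq, Real.dist_eq] at hpq
  have h1 := fl_close hh hpq.1
  have h2 := fl_close hh hpq.2
  simp only [cell, blk, Set.mem_ofPred_eq]
  omega

theorem fl_far {h a b : ℝ} (hh : 0 < h) (h1 : ⌊a / h⌋ - 2 ≤ ⌊b / h⌋) (h2 : ⌊b / h⌋ ≤ ⌊a / h⌋ + 2) :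
    |a - b| ≤ 3 * h := by
  have a1 := Int.floor_le (a / h)
  have a2 := Int.lt_floor_add_one (a / h)
  have b1 := Int.floor_le (b / h)
  have b2 := Int.lt_floor_add_one (b / h)
  have c1 : (⌊a / h⌋ : ℝ) - 2 ≤ ⌊b / h⌋ := by exact_mod_cast h1
  have c2 : (⌊b / h⌋ : ℝ) ≤ ⌊a / h⌋ + 2 := by exact_mod_cast h2
  have ea : a / h * h = a := div_mul_cancel₀ _ hh.ne'
  have eb : b / h * h = b := div_mul_cancel₀ _ hh.ne'
  rw [abs_le]
  constructor <;> nlinarith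

theorem cell_far {h : ℝ} (hh : 0 < h) {p q : ℝ × ℝ} {z : Pt} (h1 : z ∈ blk (cell h p))
    (h2 : z ∈ blk (cell h q)) : dist p q ≤ 3 * h := by
  simp only [cell, blk, Set.mem_ofPred_eq] at h1 h2
  rw [Prod.dist_eq, max_le_iff, Real.dist_eq, Real.dist_eq]
  exact ⟨fl_far hh (by omega) (by omega), fl_far hh (by omega) (by omega)⟩

theorem sample {f : ℝ → ℝ × ℝ} (hf : ContinuousOn f (Set.Icc 0 1)) {h : ℝ} (hh : 0 < h) :
    ∃ (N : ℕ) (s : ℕ → ℝ × ℝ), (∀ k ≤ N, s k ∈ f '' Set.Icc 0 1) ∧ (∀ k < N, dist (s k) (s (k + 1)) ≤ h) ∧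
      ∀ p ∈ f '' Set.Icc 0 1, ∃ k ≤ N, dist (s k) p ≤ h := by
  have huc := isCompact_Icc.uniformContinuousOn_of_continuous hf
  rw [Metric.uniformContinuousOn_iff] at huc
  obtain ⟨η, hη, huc⟩ := huc h hh
  obtain ⟨N0, hN0⟩ := exists_nat_one_div_lt hη
  set N := N0 + 1 with hN
  have hNpos : (0 : ℝ) < N := by positivity
  have hN1 : 1 / (N : ℝ) < η := by rw [hN]; push_cast; exact hN0
  have hmem : ∀ k ≤ N, (k : ℝ) / N ∈ Set.Icc (0 : ℝ) 1 := by
    intro k hk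
    refine ⟨by positivity, ?_⟩
    rw [div_le_one hNpos]; exact_mod_cast hk
  refine ⟨N, fun k => f (k / N), fun k hk => ⟨_, hmem k hk, rfl⟩, ?_, ?_⟩
  · intro k hk
    apply le_of_lt
    apply huc _ (hmem k hk.le) _ (hmem (k + 1) hk)
    rw [Real.dist_eq]
    have : (k : ℝ) / N - ((k + 1 : ℕ) : ℝ) / N = - (1 / N) := by push_cast; ring
    rw [this, abs_neg, abs_of_pos (by positivity)]
    exact hN1
  · rintro p ⟨t, ht, rfl⟩
    have h0 : 0 ≤ t * N := mul_nonneg ht.1 hNpos.le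
    have hk : ⌊t * N⌋₊ ≤ N := by
      have h1 := Nat.floor_le h0
      have : (⌊t * N⌋₊ : ℝ) ≤ N := h1.trans (by nlinarith [ht.2])
      exact_mod_cast this
    refine ⟨⌊t * N⌋₊, hk, ?_⟩
    apply le_of_lt
    apply huc _ (hmem _ hk) _ ht
    have h1 := Nat.floor_le h0
    have h2 := Nat.lt_floor_add_one (t * N)
    have e1 : (⌊t * N⌋₊ : ℝ) / N ≤ t := by rw [div_le_iff₀ hNpos]; exact h1
    have e2 : t - (⌊t * N⌋₊ : ℝ) / N ≤ 1 / N := by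
      rw [sub_le_iff_le_add, ← add_div, le_div_iff₀ hNpos]; linarith
    rw [Real.dist_eq, abs_sub_comm, abs_of_nonneg (by linarith)]
    linarith

theorem discretize {V : Type*} [Finite V] (γ : V → Set (ℝ × ℝ))
    (hγ : ∀ v, ∃ f : ℝ → ℝ × ℝ, ContinuousOn f (Set.Icc 0 1) ∧ γ v = f '' Set.Icc 0 1) :
    ∃ g : V → ℕ → Pt, (∀ v, St (g v)) ∧
      ∀ u v, (Set.range (g u) ∩ Set.range (g v)).Nonempty ↔ (γ u ∩ γ v).Nonempty := by
  choose f hf hγf using hγ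
  have hcpt : ∀ v, IsCompact (γ v) := fun v => by
    rw [hγf v]; exact isCompact_Icc.image_of_continuousOn (hf v)
  have hd : ∀ u v, ∃ d : ℝ, 0 < d ∧ (γ u ∩ γ v = ∅ → ∀ p ∈ γ u, ∀ q ∈ γ v, d < dist p q) := by
    intro u v
    by_cases he : γ u ∩ γ v = ∅
    · obtain ⟨r, hr, h⟩ := Metric.exists_pos_forall_lt_edist (hcpt u) (hcpt v).isClosed
        (Set.disjoint_iff_inter_eq_empty.mpr he)
      refine ⟨r, by exact_mod_cast hr, fun _ p hp q hq => ?_⟩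
      have := h p hp q hq
      rw [edist_nndist] at this
      have h3 : r < nndist p q := by exact_mod_cast this
      exact_mod_cast h3
    · exact ⟨1, one_pos, fun h => absurd h he⟩
  choose d hd0 hd using hd
  have hh : ∃ h : ℝ, 0 < h ∧ ∀ u v, 3 * h < d u v := by
    have h1 : ∀ᶠ h : ℝ in nhdsWithin 0 (Set.Ioi 0), ∀ u v, 3 * h < d u v := by
      rw [Filter.eventually_all]; intro u
      rw [Filter.eventually_all]; intro v
      have : Filter.Tendsto (fun h : ℝ => 3 * h) (nhdsWithin 0 (Set.Ioi 0)) (nhds (3 * 0)) :=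
        ((continuous_const.mul continuous_id).tendsto 0).mono_left nhdsWithin_le_nhds
      apply this.eventually_lt_const
      simpa using hd0 u v
    obtain ⟨h, h2, h3⟩ := (h1.and self_mem_nhdsWithin).exists
    exact ⟨h, h3, h2⟩
  obtain ⟨h, hpos, hh⟩ := hh
  have hs := fun v => sample (hf v) hpos
  choose N s hs1 hs2 hs3 using hs
  have hg : ∀ v, ∃ g : ℕ → Pt, St g ∧ Set.range g = bls (fun k => cell h (s v k)) (N v) := by
    intro v
    apply cn_st
    · apply bls_cn
      intro k hk
      exact cell_close hpos (hs2 v k hk)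
    · exact bls_fin _ _
    · exact ⟨_, 0, Nat.zero_le _, self_blk _⟩
  choose g hgst hgr using hg
  refine ⟨g, hgst, ?_⟩
  intro u v
  rw [hgr, hgr]
  constructor
  · rintro ⟨z, ⟨k, hk, hz1⟩, ⟨l, hl, hz2⟩⟩
    have h1 := cell_far hpos hz1 hz2
    by_contra hne
    rw [Set.not_nonempty_iff_eq_empty] at hne
    have h2 := hd u v hne (s u k) (by rw [hγf u]; exact hs1 u k hk) (s v l) (by rw [hγf v]; exact hs1 v l hl)
    have h3 := hh u v
    linarith
  · rintro ⟨p, hp1, hp2⟩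
    rw [hγf u] at hp1
    rw [hγf v] at hp2
    obtain ⟨k, hk, h1⟩ := hs3 u p hp1
    obtain ⟨l, hl, h2⟩ := hs3 v p hp2
    exact ⟨cell h p, ⟨k, hk, cell_close hpos h1⟩, ⟨l, hl, cell_close hpos h2⟩⟩

end SG

namespace SG
open Finset SimpleGraph

def PB (f : ℕ → ℕ) : Prop := ∃ K a : ℕ, ∀ L, 1 ≤ L → f L ≤ K * L ^ a

theorem PB.const (c : ℕ) : PB (fun _ => c) := ⟨c, 0, fun L _ => by simp⟩
theorem PB.id : PB (fun L => L) := ⟨1, 1, fun L _ => by simp⟩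
theorem PB.mul {f g : ℕ → ℕ} (hf : PB f) (hg : PB g) : PB (fun L => f L * g L) := by
  obtain ⟨K, a, h⟩ := hf
  obtain ⟨K', a', h'⟩ := hg
  refine ⟨K * K', a + a', fun L hL => ?_⟩
  calc f L * g L ≤ (K * L ^ a) * (K' * L ^ a') := Nat.mul_le_mul (h L hL) (h' L hL)
    _ = _ := by ring
theorem PB.pow {f : ℕ → ℕ} (hf : PB f) (b : ℕ) : PB (fun L => f L ^ b) := by
  obtain ⟨K, a, h⟩ := hf
  refine ⟨K ^ b, a * b, fun L hL => ?_⟩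
  calc f L ^ b ≤ (K * L ^ a) ^ b := Nat.pow_le_pow_left (h L hL) b
    _ = _ := by rw [mul_pow, pow_mul]
theorem PB.succ : PB (fun L => L + 1) := ⟨2, 1, fun L hL => by simp; omega⟩

theorem pb_QN : PB (fun L => 2 * QN L) := by
  have he : PB eN := by
    unfold eN
    exact ((PB.const _).mul (((PB.const _).mul PB.id).pow 4)).mul (PB.id.pow 2)
  have hX : PB XN := by
    unfold XN
    exact ((PB.const (256 * 10 ^ 28)).mul PB.succ).mul (((he.pow 24).mul (PB.const (10 ^ 14))).pow 48)
  exact (PB.const 2).mul ((PB.const 4).mul hX)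

theorem logQ : ∃ M : ℝ, 1 ≤ M ∧ ∀ (L : ℕ) (x : ℝ), 1 ≤ L → 1 ≤ x → (L : ℝ) ≤ 2 * x →
    Real.logb 2 (2 * QN L) ≤ M * (1 + Real.logb 2 x) := by
  obtain ⟨K, a, h⟩ := pb_QN
  have hK0 : 1 ≤ K := by
    have := h 1 le_rfl
    have h2 : 1 ≤ QN 1 := by
      have := (eN_pos (le_refl 1)).trans (eN_le_XN le_rfl)
      unfold QN; omega
    simp only [one_pow, mul_one] at this
    omega
  have hKR : (1 : ℝ) ≤ K := by exact_mod_cast hK0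
  have hlK : 0 ≤ Real.logb 2 K := Real.logb_nonneg (by norm_num) hKR
  refine ⟨Real.logb 2 K + a + 1, by linarith [(Nat.cast_nonneg a : (0 : ℝ) ≤ a)], ?_⟩
  intro L x hL hx hLx
  have hQ1 : 1 ≤ QN L := by
    have := (eN_pos hL).trans (eN_le_XN hL)
    unfold QN; omega
  have hQR : (1 : ℝ) ≤ (QN L : ℝ) := by exact_mod_cast hQ1
  have hLR : (1 : ℝ) ≤ L := by exact_mod_cast hL
  have h1 : (2 * QN L : ℝ) ≤ K * (L : ℝ) ^ a := by exact_mod_cast h L hL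
  have hlx : 0 ≤ Real.logb 2 x := Real.logb_nonneg (by norm_num) hx
  have h2 : Real.logb 2 L ≤ 1 + Real.logb 2 x := by
    calc Real.logb 2 L ≤ Real.logb 2 (2 * x) :=
          Real.logb_le_logb_of_le (by norm_num) (by linarith) hLx
      _ = _ := by
          rw [Real.logb_mul (by norm_num) (by linarith), Real.logb_self_eq_one (by norm_num)]
  calc Real.logb 2 (2 * QN L) ≤ Real.logb 2 (K * (L : ℝ) ^ a) :=
        Real.logb_le_logb_of_le (by norm_num) (by linarith) h1
    _ = Real.logb 2 K + a * Real.logb 2 L := by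
        rw [Real.logb_mul (by linarith) (by positivity), Real.logb_pow]
    _ ≤ Real.logb 2 K + a * (1 + Real.logb 2 x) := by gcongr
    _ ≤ _ := by nlinarith

theorem main_aux (ε : ℝ) (hε : 0 < ε) : ∃ c : ℝ, 0 < c ∧
    ∀ (V : Type) [Fintype V] (G : SimpleGraph V) (g : V → ℕ → Pt), (∀ v, St (g v)) →
      (∀ u v, u ≠ v → (G.Adj u v ↔ (Set.range (g u) ∩ Set.range (g v)).Nonempty)) →
      2 < Fintype.card V →
      (∃ K : Finset V, G.IsClique ↑K ∧
        (Fintype.card V : ℝ) ^ (c / Real.logb 2 (Real.logb 2 (Fintype.card V))) ≤ K.card) ∨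
      (∃ I : Finset V, (I : Set V).Pairwise (fun u v => ¬ G.Adj u v) ∧
        (Fintype.card V : ℝ) ^ (1 - ε) ≤ I.card) := by
  classical
  obtain ⟨M, hM, hlog⟩ := logQ
  have hl3 : 1 < Real.logb 2 3 := by
    rw [Real.lt_logb_iff_rpow_lt (by norm_num) (by norm_num)]; norm_num
  set l0 := Real.logb 2 (Real.logb 2 3) with hl0
  have hl0pos : 0 < l0 := Real.logb_pos (by norm_num) hl3
  obtain ⟨x0, hx0⟩ : ∃ x0 : ℝ, ∀ x, x0 ≤ x → Real.logb 2 x ≤ ε / (4 * M) * x := by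
    have h1 := Real.isLittleO_log_id_atTop.bound
      (show 0 < ε / (4 * M) * Real.log 2 by have := Real.log_pos (show (1 : ℝ) < 2 by norm_num); positivity)
    obtain ⟨x1, hx1⟩ := Filter.eventually_atTop.mp h1
    refine ⟨max x1 1, fun x hx => ?_⟩
    have h2 := hx1 x ((le_max_left _ _).trans hx)
    have h3 : 1 ≤ x := (le_max_right _ _).trans hx
    have hl2 := Real.log_pos (show (1 : ℝ) < 2 by norm_num)
    simp only [id, Real.norm_eq_abs] at h2
    rw [abs_of_nonneg (Real.log_nonneg h3), abs_of_nonneg (by linarith)] at h2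
    rw [Real.logb, div_le_iff₀ hl2]
    linarith
  set y0 := max x0 2 with hy0
  have hy2 : 2 ≤ y0 := le_max_right _ _
  refine ⟨min (ε / (4 * M)) (l0 / y0), lt_min (by positivity) (by positivity), ?_⟩
  set c := min (ε / (4 * M)) (l0 / y0) with hc
  have hcpos : 0 < c := lt_min (by positivity) (by positivity)
  have hc1 : c ≤ ε / (4 * M) := min_le_left _ _
  have hc2 : c ≤ l0 / y0 := min_le_right _ _
  intro V _ G g hst hadj hn
  set n := Fintype.card V with hndef
  have hn3 : (3 : ℝ) ≤ n := by exact_mod_cast hn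
  set l := Real.logb 2 n with hl
  have hl3' : Real.logb 2 3 ≤ l := Real.logb_le_logb_of_le (by norm_num) (by norm_num) hn3
  have hl1 : 1 < l := hl3.trans_le hl3'
  set m := Real.logb 2 l with hm
  have hm0 : l0 ≤ m := Real.logb_le_logb_of_le (by norm_num) (by linarith) hl3'
  have hmpos : 0 < m := hl0pos.trans_le hm0
  have hn2 : (n : ℝ) = 2 ^ l := (Real.rpow_logb (by norm_num) (by norm_num) (by linarith)).symm
  have hnc : (n : ℝ) ^ (c / m) = 2 ^ (c * l / m) := by
    rw [hn2, ← Real.rpow_mul (by norm_num)]; congr 1; ring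
  by_cases hly : l < y0
  · -- small case
    have hle2 : (n : ℝ) ^ (c / m) ≤ 2 := by
      rw [hnc]
      have : c * l / m ≤ 1 := by
        rw [div_le_one hmpos]
        calc c * l ≤ (l0 / y0) * y0 := by gcongr
          _ = l0 := by field_simp
          _ ≤ m := hm0
      calc (2 : ℝ) ^ (c * l / m) ≤ 2 ^ (1 : ℝ) := Real.rpow_le_rpow_of_exponent_le (by norm_num) this
        _ = 2 := Real.rpow_one _
    by_cases hE : ∃ u v, G.Adj u v
    · obtain ⟨u, v, huv⟩ := hE
      left
      refine ⟨{u, v}, ?_, ?_⟩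
      · rw [SimpleGraph.isClique_iff]
        intro a ha b hb hab
        simp only [Finset.coe_insert, Finset.coe_singleton, Set.mem_insert_iff, Set.mem_singleton_iff] at ha hb
        rcases ha with rfl | rfl <;> rcases hb with rfl | rfl
        · exact absurd rfl hab
        · exact huv
        · exact huv.symm
        · exact absurd rfl hab
      · rw [Finset.card_pair huv.ne]; exact_mod_cast hle2
    · push Not at hE
      right
      refine ⟨Finset.univ, fun a _ b _ _ => hE a b, ?_⟩
      rw [Finset.card_univ, ← hndef]
      calc (n : ℝ) ^ (1 - ε) ≤ (n : ℝ) ^ (1 : ℝ) :=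
            Real.rpow_le_rpow_of_exponent_le (by linarith) (by linarith)
        _ = n := Real.rpow_one _
  · push Not at hly
    have hlx : m ≤ ε / (4 * M) * l := hx0 l ((le_max_left _ _).trans hly)
    have hl2 : 2 ≤ l := hy2.trans hly
    have hm1 : 1 ≤ m := by
      rw [hm, Real.le_logb_iff_rpow_le (by norm_num) (by linarith), Real.rpow_one]; exact hl2
    by_cases hcl : ∃ K : Finset V, G.IsClique ↑K ∧ (n : ℝ) ^ (c / m) ≤ K.card
    · exact Or.inl hcl
    push Not at hcl
    right
    set L := ⌈l⌉₊ with hLdef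
    have hL1 : 1 ≤ L := Nat.one_le_iff_ne_zero.mpr (by
      rw [hLdef, Ne, Nat.ceil_eq_zero]; linarith)
    have hlL : l ≤ L := Nat.le_ceil l
    have hLl : (L : ℝ) ≤ 2 * l := by
      have := Nat.ceil_lt_add_one (show 0 ≤ l by linarith)
      linarith
    have hnL : (Finset.univ : Finset V).card ≤ 2 ^ L := by
      rw [Finset.card_univ, ← hndef]
      have : (n : ℝ) ≤ 2 ^ (L : ℝ) := by
        rw [hn2]; exact Real.rpow_le_rpow_of_exponent_le (by norm_num) hlL
      rw [Real.rpow_natCast] at this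
      exact_mod_cast this
    set k := ⌊c * l / m⌋₊ + 1 with hk
    have hnn : 0 ≤ c * l / m := by positivity
    have hkl : c * l / m < k := by rw [hk]; push_cast; exact Nat.lt_floor_add_one _
    have hku : (k : ℝ) ≤ c * l / m + 1 := by
      rw [hk]; push_cast; linarith [Nat.floor_le hnn]
    obtain ⟨I, _, hI, hIc⟩ := rec_concl g hL1 Finset.univ (fun v _ => hst v) hnL k (by
      intro K _ hK
      have hcK := hcl K (by
        rw [SimpleGraph.isClique_iff]
        intro a ha b hb hab
        exact (hadj a b hab).mpr (hK a ha b hb hab))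
      rw [hnc] at hcK
      have h2 : (2 : ℝ) ^ (c * l / m) ≤ 2 ^ (k : ℝ) :=
        Real.rpow_le_rpow_of_exponent_le (by norm_num) hkl.le
      rw [Real.rpow_natCast] at h2
      exact_mod_cast hcK.trans_le h2)
    refine ⟨I, ?_, ?_⟩
    · intro a ha b hb hab hAdj
      have := (hadj a b hab).mp hAdj
      rw [hI a ha b hb hab] at this
      exact Set.not_nonempty_empty this
    · rw [Finset.card_univ, ← hndef] at hIc
      have hQ1 : 1 ≤ QN L := by
        have := (eN_pos hL1).trans (eN_le_XN hL1)
        unfold QN; omega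
      have hQR : (1 : ℝ) ≤ (QN L : ℝ) := by exact_mod_cast hQ1
      have hlq := hlog L l hL1 hl1.le hLl
      rw [← hm] at hlq
      have hexp : k * Real.logb 2 (2 * QN L) ≤ l * ε := by
        have e1 : (k : ℝ) * Real.logb 2 (2 * QN L) ≤ k * (M * (2 * m)) := by
          gcongr
          refine hlq.trans ?_
          gcongr
          linarith
        have e2 : (k : ℝ) * m ≤ c * l + m := by
          have := mul_le_mul_of_nonneg_right hku hmpos.le
          rwa [add_mul, div_mul_cancel₀ _ hmpos.ne', one_mul] at this
        have e3 : c * l ≤ ε / (4 * M) * l := by gcongr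
        have e4 : (k : ℝ) * m ≤ 2 * (ε / (4 * M) * l) := by linarith
        calc (k : ℝ) * Real.logb 2 (2 * QN L) ≤ k * (M * (2 * m)) := e1
          _ = (2 * M) * (k * m) := by ring
          _ ≤ (2 * M) * (2 * (ε / (4 * M) * l)) := by gcongr
          _ = l * ε := by field_simp; ring
      have h2Q : 2 * (QN L : ℝ) ^ k ≤ (n : ℝ) ^ ε := by
        calc 2 * (QN L : ℝ) ^ k ≤ 2 ^ k * (QN L : ℝ) ^ k := by
              gcongr
              calc (2 : ℝ) = 2 ^ 1 := by norm_num
                _ ≤ 2 ^ k := pow_le_pow_right₀ (by norm_num) (by omega)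
          _ = (2 * (QN L : ℝ)) ^ (k : ℝ) := by rw [← mul_pow, Real.rpow_natCast]
          _ = ((2 : ℝ) ^ (Real.logb 2 (2 * QN L))) ^ (k : ℝ) := by
              rw [Real.rpow_logb (by norm_num) (by norm_num) (by linarith)]
          _ = 2 ^ (k * Real.logb 2 (2 * QN L)) := by
              rw [← Real.rpow_mul (by norm_num), mul_comm]
          _ ≤ 2 ^ (l * ε) := Real.rpow_le_rpow_of_exponent_le (by norm_num) hexp
          _ = (n : ℝ) ^ ε := by rw [hn2, ← Real.rpow_mul (by norm_num)]
      have hnpos : (0 : ℝ) < n := by linarith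
      rw [Real.rpow_sub hnpos, Real.rpow_one, div_le_iff₀ (Real.rpow_pos_of_pos hnpos _)]
      calc (n : ℝ) ≤ 2 * (QN L : ℝ) ^ k * I.card := hIc
        _ ≤ (n : ℝ) ^ ε * I.card := mul_le_mul_of_nonneg_right h2Q (Nat.cast_nonneg _)
        _ = _ := mul_comm _ _

end SG

/-- For every `ε > 0` there is a constant `c > 0` such that every string graph on `n > 2`
vertices contains a clique with at least `n^(c / log₂ log₂ n)` vertices or an independent
set of size at least `n^(1−ε)`. -/
theorem string_graph_clique_or_independent_set :
    ∀ ε : ℝ, 0 < ε →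
      ∃ c : ℝ, 0 < c ∧
        ∀ (V : Type) [Fintype V] (G : SimpleGraph V),
          IsStringGraph G → 2 < Fintype.card V →
          (∃ K : Finset V, G.IsClique ↑K ∧
            (Fintype.card V : ℝ) ^ (c / Real.logb 2 (Real.logb 2 (Fintype.card V)))
              ≤ K.card) ∨
          (∃ I : Finset V, (I : Set V).Pairwise (fun u v => ¬ G.Adj u v) ∧
            (Fintype.card V : ℝ) ^ (1 - ε) ≤ I.card) := by
  intro ε hε
  obtain ⟨c, hc, h⟩ := SG.main_aux ε hε
  refine ⟨c, hc, ?_⟩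
  intro V _ G hG hn
  obtain ⟨γ, hγ, hadj⟩ := hG
  obtain ⟨g, hst, hg⟩ := SG.discretize γ hγ
  exact h V G g hst (fun u v huv => (hadj u v huv).trans (hg u v).symm) hn
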